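/- Fix b > 0, Q = b + b⁻¹, real numbers s, u, v, an integer N ≥ 1, a sign δ ∈ {+1, −1}, and points x, x′ ∈ ℝ^N with the cyclic convention x_{N+1} = x₁ and x′_{N+1} = x′₁. Define V(u,v;x,x′) = ∫_{ℝ^N} ∏_{r=1}^{N} D_{−(u−s)/2 − iQ/4}(z_r − δ·x_{r+1}) · D_{(u+s)/2 − iQ/4}(z_r − x_r) · D_{(v−s)/2 − iQ/4}(z_r − δ·x′_{r+1}) · D_{−(v+s)/2 − iQ/4}(z_r − x′_r) dz₁⋯dz_N; the integral converges absolutely. Then the exchange relation V(u,v;x,x′) = (D_s(u)·D_{−s}(v))^N · V(v,u;x,x′) holds. (This is the kernel form of the identity (Y(ū))*·Y(v) = (D_s(u)·D_{−s}(v))^N·(Y(v̄))*·Y(u) of Lemma E.3, which underlies the commutativity of the Q-operators; δ = +1 corresponds to the modular XXZ magnet and δ = −1 to the lattice sinh–Gordon model.) -/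

import Mathlib

open MeasureTheory

/-- The function `D_α` (defined for `|Im α| + |Im z| < Q/2`, `Q = b + b⁻¹`,
via a regularized contour integral over `ℝ + iε`). -/
noncomputable def Dfun (b ε : ℝ) (α z : ℂ) : ℂ :=
  Complex.exp (Complex.I *
    ∫ t : ℝ,
      Complex.cos (2 * ((t : ℂ) + Complex.I * (ε : ℂ)) * z) *
          Complex.sin (2 * α * ((t : ℂ) + Complex.I * (ε : ℂ))) /
        (2 * ((t : ℂ) + Complex.I * (ε : ℂ)) *
          Complex.sinh ((b : ℂ) * ((t : ℂ) + Complex.I * (ε : ℂ))) *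
          Complex.sinh (((t : ℂ) + Complex.I * (ε : ℂ)) / (b : ℂ))))

/-- The integrand of the kernel `V(u,v;x,x′)`, with the cyclic convention
`x_{r+1}` given by addition in `Fin N`. -/
noncomputable def Vint (b ε s : ℝ) (N : ℕ) [NeZero N] (δ : ℝ) (x x' : Fin N → ℝ)
    (u v : ℝ) (z : Fin N → ℝ) : ℂ :=
  ∏ r : Fin N,
    Dfun b ε (-((((u - s) / 2 : ℝ) : ℂ)) - Complex.I * (((b + b⁻¹) : ℝ) : ℂ) / 4)
        ((z r : ℂ) - (δ : ℂ) * (x (r + 1) : ℂ)) *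
      Dfun b ε ((((u + s) / 2 : ℝ) : ℂ) - Complex.I * (((b + b⁻¹) : ℝ) : ℂ) / 4)
        ((z r : ℂ) - (x r : ℂ)) *
      Dfun b ε ((((v - s) / 2 : ℝ) : ℂ) - Complex.I * (((b + b⁻¹) : ℝ) : ℂ) / 4)
        ((z r : ℂ) - (δ : ℂ) * (x' (r + 1) : ℂ)) *
      Dfun b ε (-((((v + s) / 2 : ℝ) : ℂ)) - Complex.I * (((b + b⁻¹) : ℝ) : ℂ) / 4)
        ((z r : ℂ) - (x' r : ℂ))


section Helpers
open Filter Topology Complex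

section

/-- holomorphic parameter integrals -/
lemma holo_param {f : ℂ → ℝ → ℂ} {y0 : ℂ} {r : ℝ} (hr : 0 < r) {B : ℝ → ℝ}
    (hm : ∀ y ∈ Metric.ball y0 r, AEStronglyMeasurable (f y) volume)
    (hd : ∀ x : ℝ, ∀ y ∈ Metric.ball y0 r, DifferentiableAt ℂ (fun y => f y x) y)
    (hB : Integrable B) (hb : ∀ x : ℝ, ∀ y ∈ Metric.ball y0 r, ‖f y x‖ ≤ B x) :
    DifferentiableAt ℂ (fun y => ∫ x, f y x) y0 := by
  have hy0 : y0 ∈ Metric.ball y0 r := Metric.mem_ball_self hr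
  have hm0 : AEStronglyMeasurable (fun x => deriv (fun y => f y x) y0) volume := by
    have hseq : Tendsto (fun n : ℕ => y0 + ((1 / ((n : ℝ) + 1) : ℝ) : ℂ)) atTop (𝓝 y0) := by
      have := (tendsto_one_div_add_atTop_nhds_zero_nat (𝕜 := ℝ))
      have h2 := (Complex.continuous_ofReal.tendsto 0).comp this
      simpa using h2.const_add y0
    have hev : ∀ᶠ n : ℕ in atTop, y0 + ((1 / ((n : ℝ) + 1) : ℝ) : ℂ) ∈ Metric.ball y0 r :=
      hseq.eventually (Metric.ball_mem_nhds _ hr)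
    obtain ⟨n0, hn0⟩ := eventually_atTop.1 hev
    refine aestronglyMeasurable_of_tendsto_ae atTop
      (f := fun n : ℕ => fun x => slope (fun y => f y x) y0
        (y0 + ((1 / (((n + n0 : ℕ) : ℝ) + 1) : ℝ) : ℂ))) ?_ ?_
    · intro n
      have h1 := hm _ (hn0 (n + n0) (Nat.le_add_left _ _))
      have h2 := (h1.sub (hm _ hy0)).const_smul
        ((y0 + ((1 / (((n + n0 : ℕ) : ℝ) + 1) : ℝ) : ℂ)) - y0)⁻¹
      exact h2
    · refine Eventually.of_forall fun x => ?_
      have h1 := (hd x y0 hy0).hasDerivAt.tendsto_slope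
      refine h1.comp ?_
      refine tendsto_nhdsWithin_iff.2 ⟨?_, ?_⟩
      · exact hseq.comp (tendsto_add_atTop_nat n0)
      · refine Eventually.of_forall fun n => ?_
        have : (0 : ℝ) < 1 / (((n + n0 : ℕ) : ℝ) + 1) := by positivity
        simp only [Set.mem_compl_iff, Set.mem_singleton_iff, add_eq_left]
        exact_mod_cast this.ne'
  have := hasDerivAt_integral_of_dominated_loc_of_deriv_le (μ := volume) (F := f) (x₀ := y0)
    (F' := fun y x => deriv (fun y => f y x) y) (s := Metric.ball y0 (r/2))
    (bound := fun x => B x / (r/2)) (Metric.ball_mem_nhds _ (by positivity))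
    (by filter_upwards [Metric.ball_mem_nhds y0 hr] with y hy using hm y hy)
    (hB.mono' (hm _ hy0) (Eventually.of_forall fun x => hb x _ hy0)) hm0
    (Eventually.of_forall fun x y hy => ?_) (hB.div_const _)
    (Eventually.of_forall fun x y hy => ?_)
  · exact this.2.differentiableAt
  · have hsub : Metric.closedBall y (r/2) ⊆ Metric.ball y0 r := by
      intro w hw
      rw [Metric.mem_closedBall] at hw
      rw [Metric.mem_ball] at hy ⊢
      linarith [dist_triangle w y y0]
    refine Complex.norm_deriv_le_of_forall_mem_sphere_norm_le (by positivity) ?_ ?_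
    · refine DifferentiableOn.diffContOnCl ?_
      intro w hw
      rw [closure_ball _ (by positivity)] at hw
      exact (hd x w (hsub hw)).differentiableWithinAt
    · intro w hw
      exact hb x w (hsub (Metric.sphere_subset_closedBall hw))
  · exact (hd x y (Metric.ball_subset_ball (by linarith) hy)).hasDerivAt

lemma cauchy_strip_tendsto {f : ℂ → ℂ} {y1 y2 : ℝ} (h12 : y1 ≤ y2)
    (hd : ∀ τ : ℂ, y1 ≤ τ.im → τ.im ≤ y2 → DifferentiableAt ℂ f τ)
    {m : ℝ → ℝ} (hm1 : Tendsto m atTop (𝓝 0)) (hm2 : Tendsto m atBot (𝓝 0))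
    (hb : ∀ x y : ℝ, y1 ≤ y → y ≤ y2 → ‖f (x + y * I)‖ ≤ m x) :
    Tendsto (fun R : ℝ => (∫ x in (-R)..R, f (x + y1 * I)) - ∫ x in (-R)..R, f (x + y2 * I))
      atTop (𝓝 0) := by
  have key : ∀ R : ℝ, ((∫ x in (-R)..R, f (x + y1 * I)) - ∫ x in (-R)..R, f (x + y2 * I))
     = I • (∫ y : ℝ in y1..y2, f (((-R : ℝ) : ℂ) + y * I)) -
       I • (∫ y : ℝ in y1..y2, f ((R : ℂ) + y * I)) := by
    intro R
    have := integral_boundary_rect_eq_zero_of_differentiableOn f (⟨-R, y1⟩ : ℂ) ⟨R, y2⟩ (by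
      intro τ hτ
      have h2 := hτ.2
      simp only [Set.mem_preimage, Set.uIcc_of_le h12, Set.mem_Icc] at h2
      exact (hd τ h2.1 h2.2).differentiableWithinAt)
    simp only at this
    linear_combination this
  have bd : ∀ R : ℝ, ‖∫ y : ℝ in y1..y2, f ((R : ℂ) + y * I)‖ ≤ m R * |y2 - y1| := by
    intro R
    refine intervalIntegral.norm_integral_le_of_norm_le_const fun y hy => ?_
    rw [Set.uIoc_of_le h12] at hy
    exact hb R y hy.1.le hy.2
  have t1 : Tendsto (fun R : ℝ => ∫ y : ℝ in y1..y2, f ((R : ℂ) + y * I)) atTop (𝓝 0) :=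
    squeeze_zero_norm bd (by simpa using hm1.mul_const |y2 - y1|)
  have t2 : Tendsto (fun R : ℝ => ∫ y : ℝ in y1..y2, f (((-R : ℝ) : ℂ) + y * I)) atTop (𝓝 0) :=
    squeeze_zero_norm (fun R => bd (-R))
      (by simpa using (hm2.comp tendsto_neg_atTop_atBot).mul_const |y2 - y1|)
  simp_rw [key]
  simpa using (t2.const_smul I).sub (t1.const_smul I)

lemma cauchy_strip {f : ℂ → ℂ} {y1 y2 : ℝ} (h12 : y1 ≤ y2)
    (hd : ∀ τ : ℂ, y1 ≤ τ.im → τ.im ≤ y2 → DifferentiableAt ℂ f τ)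
    {m : ℝ → ℝ} (hm1 : Tendsto m atTop (𝓝 0)) (hm2 : Tendsto m atBot (𝓝 0))
    (hb : ∀ x y : ℝ, y1 ≤ y → y ≤ y2 → ‖f (x + y * I)‖ ≤ m x)
    (i1 : Integrable fun x : ℝ => f (x + y1 * I)) (i2 : Integrable fun x : ℝ => f (x + y2 * I)) :
    ∫ x : ℝ, f (x + y1 * I) = ∫ x : ℝ, f (x + y2 * I) := by
  have h := cauchy_strip_tendsto h12 hd hm1 hm2 hb
  have t1 := intervalIntegral_tendsto_integral i1 tendsto_neg_atTop_atBot tendsto_id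
  have t2 := intervalIntegral_tendsto_integral i2 tendsto_neg_atTop_atBot tendsto_id
  exact sub_eq_zero.1 (tendsto_nhds_unique (t1.sub t2) h)

lemma inv_line_tendsto_pos {y : ℝ} (hy : 0 < y) :
    Tendsto (fun R : ℝ => ∫ x in (-R)..R, ((x : ℂ) + y * I)⁻¹) atTop (𝓝 (-I * Real.pi)) := by
  have hne : ∀ x : ℝ, (x : ℂ) + y * I ≠ 0 := fun x h => hy.ne' (by simpa using congrArg im h)
  have hc : Continuous fun x : ℝ => ((x : ℂ) + y * I)⁻¹ :=
    Continuous.inv₀ (by fun_prop) hne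
  have key : ∀ R : ℝ, ∫ x in (-R)..R, ((x : ℂ) + y * I)⁻¹ =
      ∫ x in (-R)..R, (-I * ((y⁻¹ * (1 + (y⁻¹ * x) ^ 2)⁻¹ : ℝ) : ℂ)) := by
    intro R
    have e1 : ∫ x in (-R)..R, ((x : ℂ) + y * I)⁻¹ = ∫ x in (-R)..R, (((-x : ℝ) : ℂ) + y * I)⁻¹ := by
      rw [intervalIntegral.integral_comp_neg (fun x : ℝ => ((x : ℂ) + y * I)⁻¹)]; simp
    have e2 : (2 : ℂ) * ∫ x in (-R)..R, ((x : ℂ) + y * I)⁻¹ =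
        2 * ∫ x in (-R)..R, (-I * ((y⁻¹ * (1 + (y⁻¹ * x) ^ 2)⁻¹ : ℝ) : ℂ)) := by
      rw [two_mul]
      nth_rewrite 2 [e1]
      have hc' : Continuous fun x : ℝ => (((-x : ℝ) : ℂ) + y * I)⁻¹ := hc.comp continuous_neg
      rw [← intervalIntegral.integral_add (hc.intervalIntegrable _ _)
        (hc'.intervalIntegrable _ _), ← intervalIntegral.integral_const_mul]
      refine intervalIntegral.integral_congr fun x _ => ?_
      have h1 := hne x
      have h2 := hne (-x)
      have h3 : (y : ℂ) ≠ 0 := by exact_mod_cast hy.ne'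
      have h4 : (y : ℂ)^2 + x ^ 2 ≠ 0 := by
        have : (0:ℝ) < y^2 + x^2 := by positivity
        exact_mod_cast this.ne'
      have h5 : (1 + ((y : ℂ)⁻¹ * x) ^ 2) ≠ 0 := by
        intro h
        apply h4
        field_simp at h
        linear_combination h
      push_cast at h2 ⊢
      have h6 : (y : ℂ)^2 + x ^ 2 = -(((x : ℂ) + y * I) * (-(x : ℂ) + y * I)) := by
        linear_combination ((y:ℂ)^2) * I_sq
      have h7 : (y : ℂ)⁻¹ * (1 + ((y : ℂ)⁻¹ * x) ^ 2)⁻¹ = y / (y^2 + x^2) := by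
        field_simp
      rw [h7, h6]
      field_simp
      ring
    exact mul_left_cancel₀ two_ne_zero e2
  have hint : Integrable fun x : ℝ => y⁻¹ * (1 + (y⁻¹ * x) ^ 2)⁻¹ :=
    (integrable_inv_one_add_sq.comp_mul_left' (by positivity)).const_mul _
  have hval : ∫ x : ℝ, y⁻¹ * (1 + (y⁻¹ * x) ^ 2)⁻¹ = Real.pi := by
    rw [integral_const_mul, Measure.integral_comp_mul_left (fun x : ℝ => (1 + x ^ 2)⁻¹),
      integral_univ_inv_one_add_sq]
    simp [abs_of_pos hy]
    field_simp
  simp_rw [key]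
  have := intervalIntegral_tendsto_integral (hint.ofReal (𝕜 := ℂ) |>.const_mul (-I))
    tendsto_neg_atTop_atBot tendsto_id
  rw [integral_const_mul] at this
  have e : ∫ x : ℝ, ((y⁻¹ * (1 + (y⁻¹ * x) ^ 2)⁻¹ : ℝ) : ℂ) = Real.pi := by
    rw [integral_complex_ofReal, hval]
  exact e ▸ this

lemma inv_line_tendsto_neg {y : ℝ} (hy : y < 0) :
    Tendsto (fun R : ℝ => ∫ x in (-R)..R, ((x : ℂ) + y * I)⁻¹) atTop (𝓝 (I * Real.pi)) := by
  have h := (inv_line_tendsto_pos (y := -y) (by linarith)).neg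
  have e : ∀ R : ℝ, ∫ x in (-R)..R, ((x : ℂ) + y * I)⁻¹ =
     - ∫ x in (-R)..R, ((x : ℂ) + ((-y : ℝ) : ℂ) * I)⁻¹ := by
    intro R
    have := intervalIntegral.integral_comp_neg (a := -R) (b := R)
      (fun x : ℝ => ((x : ℂ) + y * I)⁻¹)
    rw [neg_neg] at this
    rw [← this, ← intervalIntegral.integral_neg]
    refine intervalIntegral.integral_congr fun x _ => ?_
    simp only [← inv_neg]
    push_cast
    ring_nf
  simp_rw [e]
  convert h using 2
  ring

/-- residue at a simple pole, strip version -/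
lemma residue_strip {h g : ℂ → ℂ} {y1 y2 : ℝ} (h1 : y1 < 0) (h2 : 0 < y2) {U : Set ℂ}
    (hU : IsOpen U) (hUs : ∀ τ : ℂ, y1 ≤ τ.im → τ.im ≤ y2 → τ ∈ U)
    (hd : DifferentiableOn ℂ h U) (hg : ∀ τ ∈ U, τ ≠ 0 → g τ = h τ / τ)
    {m : ℝ → ℝ} (hm1 : Tendsto m atTop (𝓝 0)) (hm2 : Tendsto m atBot (𝓝 0))
    (hb : ∀ x y : ℝ, x ≠ 0 → y1 ≤ y → y ≤ y2 → ‖g (x + y * I)‖ ≤ m x)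
    (i1 : Integrable fun x : ℝ => g (x + y1 * I)) (i2 : Integrable fun x : ℝ => g (x + y2 * I)) :
    (∫ x : ℝ, g (x + y1 * I)) - ∫ x : ℝ, g (x + y2 * I) = 2 * Real.pi * I * h 0 := by
  have h0U : (0 : ℂ) ∈ U := hUs 0 (by simpa using h1.le) (by simpa using h2.le)
  have hkd : DifferentiableOn ℂ (dslope h 0) U :=
    (differentiableOn_dslope (hU.mem_nhds h0U)).2 hd
  have hk : ∀ τ ∈ U, τ ≠ 0 → dslope h 0 τ = g τ - h 0 * τ⁻¹ := by
    intro τ hτ hτ0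
    rw [dslope_of_ne _ hτ0, slope_def_field, hg τ hτ hτ0]
    field_simp
    ring
  have hne : ∀ x y : ℝ, y ≠ 0 → (x : ℂ) + y * I ≠ 0 := fun x y hy h => hy (by simpa using congrArg im h)
  have hne' : ∀ x y : ℝ, x ≠ 0 → (x : ℂ) + y * I ≠ 0 := fun x y hy h => hy (by simpa using congrArg re h)
  have hmem : ∀ x y : ℝ, y1 ≤ y → y ≤ y2 → (x : ℂ) + y * I ∈ U := fun x y a b =>
    hUs _ (by simpa using a) (by simpa using b)
  obtain ⟨M, hM⟩ : ∃ M : ℝ, ∀ y : ℝ, y1 ≤ y → y ≤ y2 → ‖dslope h 0 (((0 : ℝ) : ℂ) + y * I)‖ ≤ M := by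
    have hc : ContinuousOn (fun y : ℝ => dslope h 0 (((0 : ℝ) : ℂ) + y * I)) (Set.Icc y1 y2) := by
      refine hkd.continuousOn.comp (by fun_prop) ?_
      intro y hy
      exact hmem 0 y hy.1 hy.2
    obtain ⟨M, hM⟩ := isCompact_Icc.exists_bound_of_continuousOn hc
    exact ⟨M, fun y a b => hM y ⟨a, b⟩⟩
  have hT := cauchy_strip_tendsto (f := dslope h 0) (y1 := y1) (y2 := y2) (by linarith)
    (fun τ a b => (hkd τ (hUs τ a b)).differentiableAt (hU.mem_nhds (hUs τ a b)))
    (m := fun x => if x = 0 then M else m x + ‖h 0‖ * |x|⁻¹) ?_ ?_ ?_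
  · have e : ∀ y : ℝ, y1 ≤ y → y ≤ y2 → y ≠ 0 → (Integrable fun x : ℝ => g (x + y * I)) →
        ∀ R : ℝ, ∫ x in (-R)..R, dslope h 0 (x + y * I) =
        (∫ x in (-R)..R, g (x + y * I)) - h 0 * ∫ x in (-R)..R, ((x : ℂ) + y * I)⁻¹ := by
      intro y a b hy hi R
      have hc : Continuous fun x : ℝ => ((x : ℂ) + y * I)⁻¹ :=
        Continuous.inv₀ (by fun_prop) (fun x => hne x y hy)
      rw [← intervalIntegral.integral_const_mul, ← intervalIntegral.integral_sub
        hi.intervalIntegrable ((hc.intervalIntegrable _ _).const_mul _)]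
      exact intervalIntegral.integral_congr fun x _ => hk _ (hmem x y a b) (hne x y hy)
    simp_rw [e y1 le_rfl (by linarith) h1.ne i1, e y2 (by linarith) le_rfl h2.ne' i2] at hT
    have t1 := intervalIntegral_tendsto_integral i1 tendsto_neg_atTop_atBot tendsto_id
    have t2 := intervalIntegral_tendsto_integral i2 tendsto_neg_atTop_atBot tendsto_id
    have t3 := (t1.sub ((inv_line_tendsto_neg h1).const_mul (h 0))).sub
      (t2.sub ((inv_line_tendsto_pos h2).const_mul (h 0)))
    have := tendsto_nhds_unique t3 hT
    linear_combination this
  · have : Tendsto (fun x : ℝ => m x + ‖h 0‖ * |x|⁻¹) atTop (𝓝 0) := by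
      simpa using hm1.add ((tendsto_abs_atTop_atTop.inv_tendsto_atTop).const_mul ‖h 0‖)
    refine this.congr' ?_
    filter_upwards [eventually_gt_atTop 0] with x hx
    rw [if_neg hx.ne']
  · have : Tendsto (fun x : ℝ => m x + ‖h 0‖ * |x|⁻¹) atBot (𝓝 0) := by
      simpa using hm2.add ((tendsto_abs_atBot_atTop.inv_tendsto_atTop).const_mul ‖h 0‖)
    refine this.congr' ?_
    filter_upwards [eventually_lt_atBot 0] with x hx
    rw [if_neg hx.ne]
  · intro x y a b
    by_cases hx : x = 0
    · subst hx
      rw [if_pos rfl]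
      exact hM y a b
    · rw [if_neg hx, hk _ (hmem x y a b) (hne' x y hx)]
      refine (norm_sub_le _ _).trans (add_le_add (hb x y hx a b) ?_)
      rw [norm_mul, norm_inv]
      refine mul_le_mul_of_nonneg_left ?_ (norm_nonneg _)
      refine inv_anti₀ (abs_pos.2 hx) ?_
      simpa using Complex.abs_re_le_norm ((x : ℂ) + y * I)

/-- Liouville theorem for periodic functions on a strip. -/
lemma liouville_strip {f : ℂ → ℂ} {a W b : ℝ} (hb : 0 < b) (hbW : b < W)
    (hd : ∀ y : ℂ, a < y.im → y.im < a + W → DifferentiableAt ℂ f y)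
    (hp : ∀ y : ℂ, a < y.im → y.im + b < a + W → f (y + b * I) = f y)
    (hbd : ∀ a1 a2 : ℝ, a < a1 → a2 < a + W →
      ∃ M : ℝ, ∀ y : ℂ, a1 ≤ y.im → y.im ≤ a2 → ‖f y‖ ≤ M)
    {y z : ℂ} (hy1 : a < y.im) (hy2 : y.im < a + W) (hz1 : a < z.im) (hz2 : z.im < a + W) :
    f y = f z := by
  obtain ⟨c, hc⟩ : ∃ c : ℝ, c = a + (W - b) / 2 := ⟨_, rfl⟩
  have hc1 : a < c := by rw [hc]; linarith
  have hc2 : c + b < a + W := by rw [hc]; linarith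
  -- shifts by natural numbers
  have hnat : ∀ (n : ℕ) (y : ℂ), a < y.im → y.im + n * b < a + W →
      f (y + n * b * I) = f y := by
    intro n
    induction n with
    | zero => intro y _ _; simp
    | succ k ih =>
      intro y h1 h2
      push_cast at h2 ⊢
      have hk : (0 : ℝ) ≤ k * b := by positivity
      have := hp (y + k * b * I) (by simp; linarith) (by simp; linarith)
      rw [← ih y h1 (by linarith), ← this]
      congr 1; ring
  have hint : ∀ (n : ℤ) (y : ℂ), a < y.im → y.im < a + W → a < y.im + n * b →
      y.im + n * b < a + W → f (y + n * b * I) = f y := by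
    intro n y h1 h2 h3 h4
    rcases Int.eq_nat_or_neg n with ⟨k, rfl | rfl⟩
    · exact_mod_cast hnat k y h1 (by exact_mod_cast h4)
    · push_cast at h3 h4 ⊢
      have := hnat k (y + -k * b * I) (by simp; linarith) (by simp; linarith)
      rw [← this]
      congr 1; ring
  let nf : ℂ → ℤ := fun y => ⌊(y.im - c) / b⌋
  let F : ℂ → ℂ := fun y => f (y - nf y * b * I)
  have hnf : ∀ y, c ≤ y.im - nf y * b ∧ y.im - nf y * b < c + b := by
    intro y
    have h1 := Int.floor_le ((y.im - c) / b)
    have h2 := Int.lt_floor_add_one ((y.im - c) / b)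
    rw [le_div_iff₀ hb] at h1
    rw [div_lt_iff₀ hb] at h2
    simp only [nf]
    constructor <;> nlinarith
  have hF : ∀ (n : ℤ) (y : ℂ), a < y.im - n * b → y.im - n * b < a + W → F y = f (y - n * b * I) := by
    intro n y h1 h2
    have h := hnf y
    have := hint (n - nf y) (y - n * b * I) (by simpa using h1) (by simpa using h2)
      (by simp; linarith) (by simp; linarith)
    rw [← this]
    simp only [F]
    congr 1; push_cast; ring
  have hFd : Differentiable ℂ F := by
    intro y
    have h := hnf y
    have hev : F =ᶠ[𝓝 y] fun y' => f (y' - nf y * b * I) := by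
      have hc : ContinuousAt (fun y' : ℂ => y'.im - nf y * b) y := by fun_prop
      filter_upwards [hc.eventually (lt_mem_nhds (show a < y.im - nf y * b by linarith)),
        hc.eventually (gt_mem_nhds (show y.im - nf y * b < a + W by linarith))] with y' h1 h2
      exact hF _ _ h1 h2
    refine DifferentiableAt.congr_of_eventuallyEq ?_ hev
    have := hd (y - nf y * b * I) (by simp; linarith) (by simp; linarith)
    exact DifferentiableAt.comp y this (by fun_prop)
  have hFb : Bornology.IsBounded (Set.range F) := by
    obtain ⟨M, hM⟩ := hbd c (c + b) hc1 hc2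
    rw [isBounded_iff_forall_norm_le]
    refine ⟨M, ?_⟩
    rintro _ ⟨y, rfl⟩
    have h := hnf y
    exact hM _ (by simp; linarith) (by simp; linarith)
  have e1 := hF 0 y (by simpa using hy1) (by simpa using hy2)
  have e2 := hF 0 z (by simpa using hz1) (by simpa using hz2)
  have e3 := hFd.apply_eq_apply_of_bounded hFb y z
  simp only [Int.cast_zero, zero_mul, sub_zero] at e1 e2
  rw [← e1, ← e2, e3]

end

section

lemma integrable_exp_abs {c : ℝ} (hc : c < 0) : Integrable fun x : ℝ => Real.exp (c * |x|) := by
  rw [← integrableOn_univ, ← Set.Iic_union_Ioi (a := (0 : ℝ))]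
  refine IntegrableOn.union ?_ ?_
  · refine (integrableOn_exp_mul_Iic (a := -c) (by linarith) 0).congr_fun (fun x hx => ?_)
      measurableSet_Iic
    simp only [abs_of_nonpos (Set.mem_Iic.1 hx)]; congr 1; ring
  · refine (integrableOn_exp_mul_Ioi hc 0).congr_fun (fun x hx => ?_) measurableSet_Ioi
    simp only [abs_of_pos (Set.mem_Ioi.1 hx)]

lemma tendsto_exp_abs {c : ℝ} (hc : c < 0) (K : ℝ) :
    Tendsto (fun x : ℝ => K * Real.exp (c * |x|)) atTop (𝓝 0) ∧
    Tendsto (fun x : ℝ => K * Real.exp (c * |x|)) atBot (𝓝 0) := by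
  have h : Tendsto (fun y : ℝ => K * Real.exp (c * y)) atTop (𝓝 0) := by
    simpa using (Real.tendsto_exp_atBot.comp (tendsto_id.const_mul_atTop_of_neg hc)).const_mul K
  exact ⟨h.comp tendsto_abs_atTop_atTop, h.comp tendsto_abs_atBot_atTop⟩

structure GP (b : ℝ) (G : ℂ → ℂ) : Prop where
  hb : 0 < b
  diff : ∀ w : ℂ, |w.im| < (b + b⁻¹) / 2 → DifferentiableAt ℂ G w
  neg : ∀ w : ℂ, G (-w) * G w = 1
  conj : ∀ w : ℂ, (starRingEnd ℂ) (G w) = G (-(starRingEnd ℂ) w)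
  shift : ∃ C : ℂ, ∀ w : ℂ, |w.im| < b⁻¹ / 2 →
    G (w + b / 2 * I) = C * cosh (Real.pi * b * w) * G (w - b / 2 * I)
  bound : ∀ κ : ℝ, κ < (b + b⁻¹) / 2 → ∃ K : ℝ, 0 < K ∧ ∀ w : ℂ, |w.im| ≤ κ →
    ‖G w‖ ≤ K * Real.exp (Real.pi * (|w.re| * w.im))

lemma GP.ne {b : ℝ} {G : ℂ → ℂ} (h : GP b G) (w : ℂ) : G w ≠ 0 := by
  intro h0
  have := h.neg w
  simp [h0] at this

noncomputable def Lin (G : ℂ → ℂ) {ι : Type} [Fintype ι] (p q : ι → ℂ) (z : ℂ) : ℂ :=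
  ∏ i, (G (p i + z) * G (q i - z))

noncomputable def Lf (G : ℂ → ℂ) {ι : Type} [Fintype ι] (p q : ι → ℂ) : ℂ :=
  ∫ z : ℝ, Lin G p q z

section
variable {b : ℝ} {G : ℂ → ℂ} {ι : Type} [Fintype ι]

lemma lin_bound0 (hG : GP b G) {κ : ℝ} (hκ : κ < (b + b⁻¹) / 2) :
    ∃ K : ℝ, 0 < K ∧ ∀ p q : ι → ℂ, (∀ i, |(p i).im| ≤ κ) → (∀ i, |(q i).im| ≤ κ) → ∀ z : ℝ,
      ‖Lin G p q z‖ ≤ K * Real.exp (Real.pi *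
        ∑ i, (|(p i).re + z| * (p i).im + |(q i).re - z| * (q i).im)) := by
  obtain ⟨K, hK, hb⟩ := hG.bound κ hκ
  refine ⟨∏ _i : ι, (K * K), Finset.prod_pos fun _ _ => by positivity, fun p q hp hq z => ?_⟩
  rw [Lin, norm_prod, Finset.mul_sum, Real.exp_sum, ← Finset.prod_mul_distrib]
  refine Finset.prod_le_prod (fun _ _ => norm_nonneg _) fun i _ => ?_
  rw [norm_mul]
  have h1 := hb (p i + z) (by simpa using hp i)
  have h2 := hb (q i - z) (by simpa using hq i)
  simp only [add_re, sub_re, add_im, sub_im, ofReal_re, ofReal_im, add_zero, sub_zero] at h1 h2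
  calc _ ≤ _ := mul_le_mul h1 h2 (norm_nonneg _) (by positivity)
    _ = _ := by rw [mul_add, Real.exp_add]; ring

lemma abs_add_mul_le {a w c ρ κ : ℝ} (ha : |a| ≤ ρ) (hc : |c| ≤ κ) :
    |a + w| * c ≤ |w| * c + ρ * κ := by
  have h1 : |(|a + w| - |w|)| ≤ |a| := by
    have := abs_abs_sub_abs_le_abs_sub (a + w) w
    simpa using this
  have h2 : (|a + w| - |w|) * c ≤ ρ * κ := by
    refine (le_abs_self _).trans ?_
    rw [abs_mul]
    exact mul_le_mul (h1.trans ha) hc (abs_nonneg _) ((abs_nonneg _).trans ha)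
  linarith

lemma abs_sub_mul_le {a w c ρ κ : ℝ} (ha : |a| ≤ ρ) (hc : |c| ≤ κ) :
    |a - w| * c ≤ |w| * c + ρ * κ := by
  have := abs_add_mul_le (w := -w) ha hc
  rwa [abs_neg, ← sub_eq_add_neg] at this

lemma lin_bound (hG : GP b G) {κ : ℝ} (hκ : κ < (b + b⁻¹) / 2) (ρ : ℝ) :
    ∃ K : ℝ, 0 < K ∧ ∀ p q : ι → ℂ, (∀ i, |(p i).im| ≤ κ) → (∀ i, |(q i).im| ≤ κ) →
      (∀ i, |(p i).re| ≤ ρ) → (∀ i, |(q i).re| ≤ ρ) → ∀ z : ℝ,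
      ‖Lin G p q z‖ ≤ K * Real.exp ((Real.pi * ∑ i, ((p i).im + (q i).im)) * |z|) := by
  obtain ⟨K, hK, hb⟩ := lin_bound0 (ι := ι) hG hκ
  refine ⟨K * Real.exp (Real.pi * ∑ _i : ι, (ρ * κ + ρ * κ)), by positivity,
    fun p q hp hq hp' hq' z => (hb p q hp hq z).trans ?_⟩
  rw [mul_assoc, ← Real.exp_add]
  gcongr
  rw [mul_assoc, ← mul_add, Finset.sum_mul, ← Finset.sum_add_distrib]
  refine mul_le_mul_of_nonneg_left (Finset.sum_le_sum fun i _ => ?_) Real.pi_pos.le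
  linarith [abs_add_mul_le (w := z) (hp' i) (hp i), abs_sub_mul_le (w := z) (hq' i) (hq i)]

lemma lin_vshift (p q : ι → ℂ) (z w : ℂ) :
    Lin G p q (z + w) = Lin G (fun i => p i + w) (fun i => q i - w) z := by
  unfold Lin
  refine Finset.prod_congr rfl fun i _ => ?_
  congr 2 <;> ring

lemma lin_diff (hG : GP b G) {p q : ι → ℂ → ℂ} {z y : ℂ}
    (hp : ∀ i, DifferentiableAt ℂ (p i) y) (hq : ∀ i, DifferentiableAt ℂ (q i) y)
    (h1 : ∀ i, |(p i y + z).im| < (b + b⁻¹) / 2) (h2 : ∀ i, |(q i y - z).im| < (b + b⁻¹) / 2) :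
    DifferentiableAt ℂ (fun y => Lin G (fun i => p i y) (fun i => q i y) z) y := by
  unfold Lin
  refine DifferentiableAt.fun_finsetProd fun i _ => ?_
  refine DifferentiableAt.mul ?_ ?_
  · exact DifferentiableAt.comp (g := G) y (hG.diff _ (h1 i)) ((hp i).add_const _)
  · exact DifferentiableAt.comp (g := G) y (hG.diff _ (h2 i)) ((hq i).sub_const _)

lemma lin_diff_z (hG : GP b G) {p q : ι → ℂ} {z : ℂ}
    (h1 : ∀ i, |(p i + z).im| < (b + b⁻¹) / 2) (h2 : ∀ i, |(q i - z).im| < (b + b⁻¹) / 2) :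
    DifferentiableAt ℂ (fun z => Lin G p q z) z := by
  unfold Lin
  refine DifferentiableAt.fun_finsetProd fun i _ => ?_
  refine DifferentiableAt.mul ?_ ?_
  · exact DifferentiableAt.comp (g := G) z (hG.diff _ (h1 i)) (by fun_prop)
  · exact DifferentiableAt.comp (g := G) z (hG.diff _ (h2 i)) (by fun_prop)

lemma lin_cont (hG : GP b G) {p q : ι → ℂ}
    (h1 : ∀ i, |(p i).im| < (b + b⁻¹) / 2) (h2 : ∀ i, |(q i).im| < (b + b⁻¹) / 2) :
    Continuous (fun z : ℝ => Lin G p q z) := by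
  rw [continuous_iff_continuousAt]
  intro z
  have := (lin_diff_z (z := (z : ℂ)) hG (p := p) (q := q) (by simpa using h1)
    (by simpa using h2)).continuousAt
  exact ContinuousAt.comp (g := fun z : ℂ => Lin G p q z) this (by fun_prop)

lemma exists_bd (hG : GP b G) {p q : ι → ℂ}
    (h1 : ∀ i, |(p i).im| < (b + b⁻¹) / 2) (h2 : ∀ i, |(q i).im| < (b + b⁻¹) / 2) :
    ∃ κ ρ : ℝ, κ < (b + b⁻¹) / 2 ∧ ∀ i, |(p i).im| < κ ∧ |(q i).im| < κ ∧
      |(p i).re| < ρ ∧ |(q i).re| < ρ := by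
  have e1 : ∀ᶠ κ in 𝓝[<] ((b + b⁻¹) / 2), ∀ i, |(p i).im| < κ ∧ |(q i).im| < κ := by
    rw [eventually_all]
    intro i
    filter_upwards [Ioo_mem_nhdsLT (h1 i), Ioo_mem_nhdsLT (h2 i)] with κ a c
    exact ⟨a.1, c.1⟩
  have e2 : ∀ᶠ ρ in (atTop : Filter ℝ), ∀ i, |(p i).re| < ρ ∧ |(q i).re| < ρ := by
    rw [eventually_all]
    intro i
    filter_upwards [eventually_gt_atTop |(p i).re|, eventually_gt_atTop |(q i).re|] with κ a c
    exact ⟨a, c⟩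
  obtain ⟨κ, hκ1, hκ2⟩ := (e1.and self_mem_nhdsWithin).exists
  obtain ⟨ρ, hρ⟩ := e2.exists
  exact ⟨κ, ρ, hκ2, fun i => ⟨(hκ1 i).1, (hκ1 i).2, (hρ i).1, (hρ i).2⟩⟩

lemma lin_integrable (hG : GP b G) {p q : ι → ℂ}
    (h1 : ∀ i, |(p i).im| < (b + b⁻¹) / 2) (h2 : ∀ i, |(q i).im| < (b + b⁻¹) / 2)
    (hs : ∑ i, ((p i).im + (q i).im) < 0) : Integrable (fun z : ℝ => Lin G p q z) := by
  obtain ⟨κ, ρ, hκ, h⟩ := exists_bd hG h1 h2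
  obtain ⟨K, hK, hb⟩ := lin_bound (ι := ι) hG hκ ρ
  refine Integrable.mono' ((integrable_exp_abs (c := Real.pi * ∑ i, ((p i).im + (q i).im))
    (mul_neg_of_pos_of_neg Real.pi_pos hs)).const_mul K) (lin_cont hG h1 h2).aestronglyMeasurable ?_
  exact Eventually.of_forall fun z => hb p q (fun i => (h i).1.le) (fun i => (h i).2.1.le)
    (fun i => (h i).2.2.1.le) (fun i => (h i).2.2.2.le) z

lemma Lf_holo (hG : GP b G) {p q : ι → ℂ → ℂ} {y0 : ℂ}
    (hp : ∀ i, Differentiable ℂ (p i)) (hq : ∀ i, Differentiable ℂ (q i))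
    (h1 : ∀ i, |(p i y0).im| < (b + b⁻¹) / 2) (h2 : ∀ i, |(q i y0).im| < (b + b⁻¹) / 2)
    (hs : ∑ i, ((p i y0).im + (q i y0).im) < 0) :
    DifferentiableAt ℂ (fun y => Lf G (fun i => p i y) (fun i => q i y)) y0 := by
  obtain ⟨κ, ρ, hκ, h⟩ := exists_bd hG h1 h2
  obtain ⟨K, hK, hb⟩ := lin_bound (ι := ι) hG hκ ρ
  obtain ⟨σ, hσ1, hσ2⟩ := exists_between hs
  have cp : ∀ i, Continuous (p i) := fun i => (hp i).continuous
  have cq : ∀ i, Continuous (q i) := fun i => (hq i).continuous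
  have ev : ∀ᶠ y in 𝓝 y0, (∀ i, |(p i y).im| < κ ∧ |(q i y).im| < κ ∧
      |(p i y).re| < ρ ∧ |(q i y).re| < ρ) ∧ ∑ i, ((p i y).im + (q i y).im) < σ := by
    refine Filter.Eventually.and ?_ ?_
    · rw [eventually_all]
      intro i
      have c1 : Continuous fun y => |(p i y).im| := by have := cp i; fun_prop
      have c2 : Continuous fun y => |(q i y).im| := by have := cq i; fun_prop
      have c3 : Continuous fun y => |(p i y).re| := by have := cp i; fun_prop
      have c4 : Continuous fun y => |(q i y).re| := by have := cq i; fun_prop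
      filter_upwards [c1.continuousAt.eventually (gt_mem_nhds (h i).1),
        c2.continuousAt.eventually (gt_mem_nhds (h i).2.1),
        c3.continuousAt.eventually (gt_mem_nhds (h i).2.2.1),
        c4.continuousAt.eventually (gt_mem_nhds (h i).2.2.2)] with y a1 a2 a3 a4
      exact ⟨a1, a2, a3, a4⟩
    · have c : Continuous fun y => ∑ i, ((p i y).im + (q i y).im) := by fun_prop
      exact c.continuousAt.eventually (gt_mem_nhds hσ1)
  obtain ⟨r, hr, hball⟩ := Metric.eventually_nhds_iff_ball.1 ev
  unfold Lf
  refine holo_param hr (B := fun z => K * Real.exp ((Real.pi * σ) * |z|)) ?_ ?_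
    ((integrable_exp_abs (mul_neg_of_pos_of_neg Real.pi_pos hσ2)).const_mul K) ?_
  · intro y hy
    have := (hball y hy).1
    exact (lin_cont hG (fun i => (this i).1.trans hκ) (fun i => (this i).2.1.trans hκ)).aestronglyMeasurable
  · intro z y hy
    have := (hball y hy).1
    exact lin_diff hG (fun i => hp i y) (fun i => hq i y)
      (fun i => by simpa using (this i).1.trans hκ) (fun i => by simpa using (this i).2.1.trans hκ)
  · intro z y hy
    have := (hball y hy).1
    refine (hb _ _ (fun i => (this i).1.le) (fun i => (this i).2.1.le) (fun i => (this i).2.2.1.le)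
      (fun i => (this i).2.2.2.le) z).trans ?_
    have h3 := (hball y hy).2.le
    gcongr

end

end

section

lemma trig_id (p1 p2 p3 q1 q2 q3 z e : ℂ)
    (h : exp (p1 + p2 + p3 + q1 + q2 + q3) = exp (-4 * e)) :
    cosh (p1 + z) * cosh (p2 + z + e) * cosh (p3 + z + e) -
      cosh (q1 - z) * cosh (q2 - z + e) * cosh (q3 - z + e) =
    (-(sinh (p2 + q1 + e) * sinh (p3 + q1 + e))) * cosh (p1 + z) -
    (-(sinh (q2 + p1 + e) * sinh (q3 + p1 + e))) * cosh (q1 - z) := by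
  have e1 := exp_ne_zero p1
  have e2 := exp_ne_zero p2
  have e3 := exp_ne_zero p3
  have f1 := exp_ne_zero q1
  have f2 := exp_ne_zero q2
  have hz := exp_ne_zero z
  have he := exp_ne_zero e
  have h4 : exp (-4 * e) = (exp e ^ 4)⁻¹ := by
    rw [← exp_nat_mul, ← exp_neg]; congr 1; push_cast; ring
  rw [h4] at h
  simp only [exp_add] at h
  have f3 : exp q3 = (exp e ^ 4 * (exp p1 * exp p2 * exp p3 * exp q1 * exp q2))⁻¹ := by
    rw [mul_inv, ← h]; field_simp
  simp only [Complex.cosh, Complex.sinh, exp_add, exp_sub, exp_neg, neg_add, neg_sub, f3]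
  field_simp
  ring

lemma cosh_add_half (x : ℂ) : cosh (x + Real.pi / 2 * I) = I * sinh x := by
  rw [cosh_add, cosh_mul_I, sinh_mul_I]
  simp
  ring

structure TD (b : ℝ) (p q : Fin 3 → ℂ) : Prop where
  sum : p 0 + p 1 + p 2 + q 0 + q 1 + q 2 = ((-2 * (b + b⁻¹) : ℝ) : ℂ) * I
  hp : ∀ i, -((b + b⁻¹) / 2) < (p i).im
  hq : ∀ i, -((b + b⁻¹) / 2) < (q i).im

noncomputable def Rf (b : ℝ) (G : ℂ → ℂ) (p q : Fin 3 → ℂ) : ℂ :=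
  ∏ i, ∏ j, G (p i + q j + (((b + b⁻¹) / 2 : ℝ) : ℂ) * I)

lemma TD.im_sum {b : ℝ} {p q : Fin 3 → ℂ} (h : TD b p q) :
    (p 0).im + (p 1).im + (p 2).im + (q 0).im + (q 1).im + (q 2).im = -2 * (b + b⁻¹) := by
  have := congrArg im h.sum
  simpa using this

lemma sum_margin {Q μ : ℝ} {p q : Fin 3 → ℂ}
    (hs : (p 0).im + (p 1).im + (p 2).im + (q 0).im + (q 1).im + (q 2).im = -2 * Q)
    (hμ : 0 ≤ μ) (hp : ∀ i, -(Q / 2) + μ ≤ (p i).im) (hq : ∀ i, -(Q / 2) + μ ≤ (q i).im) :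
    (∀ i, |(p i).im| ≤ Q / 2 - μ) ∧ (∀ i, |(q i).im| ≤ Q / 2 - μ) ∧
    (∀ i j, |(p i).im + (q j).im + Q / 2| ≤ Q / 2 - μ) := by
  have p0 := hp 0
  have p1 := hp 1
  have p2 := hp 2
  have q0 := hq 0
  have q1 := hq 1
  have q2 := hq 2
  refine ⟨fun i => ?_, fun i => ?_, fun i j => ?_⟩
  · rw [abs_le]; fin_cases i <;> simp <;> constructor <;> linarith
  · rw [abs_le]; fin_cases i <;> simp <;> constructor <;> linarith
  · rw [abs_le]; fin_cases i <;> fin_cases j <;> simp <;> constructor <;> linarith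

lemma TD.margin {b : ℝ} {p q : Fin 3 → ℂ} (h : TD b p q) :
    ∃ μ : ℝ, 0 < μ ∧ (∀ i, -((b + b⁻¹) / 2) + μ ≤ (p i).im) ∧
      (∀ i, -((b + b⁻¹) / 2) + μ ≤ (q i).im) := by
  have e : ∀ᶠ μ in 𝓝[>] (0 : ℝ), ∀ i, -((b + b⁻¹) / 2) + μ ≤ (p i).im ∧
      -((b + b⁻¹) / 2) + μ ≤ (q i).im := by
    rw [eventually_all]
    intro i
    have h1 := h.hp i
    have h2 := h.hq i
    filter_upwards [Ioo_mem_nhdsGT (show 0 < (p i).im + (b + b⁻¹) / 2 by linarith),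
      Ioo_mem_nhdsGT (show 0 < (q i).im + (b + b⁻¹) / 2 by linarith)] with μ a c
    exact ⟨by linarith [a.2], by linarith [c.2]⟩
  obtain ⟨μ, h1, h2⟩ := (e.and self_mem_nhdsWithin).exists
  exact ⟨μ, h2, fun i => (h1 i).1, fun i => (h1 i).2⟩

lemma TD.str {b : ℝ} {p q : Fin 3 → ℂ} (h : TD b p q) :
    (∀ i, |(p i).im| < (b + b⁻¹) / 2) ∧ (∀ i, |(q i).im| < (b + b⁻¹) / 2) ∧
    (∀ i j, |(p i).im + (q j).im + (b + b⁻¹) / 2| < (b + b⁻¹) / 2) := by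
  obtain ⟨μ, hμ, h1, h2⟩ := h.margin
  obtain ⟨a1, a2, a3⟩ := sum_margin h.im_sum hμ.le h1 h2
  exact ⟨fun i => (a1 i).trans_lt (by linarith), fun i => (a2 i).trans_lt (by linarith),
    fun i j => (a3 i j).trans_lt (by linarith)⟩

section
variable {b : ℝ} {G : ℂ → ℂ}

lemma GP.C_ne (hG : GP b G) : ∃ C : ℂ, C ≠ 0 ∧ ∀ w : ℂ, |w.im| < b⁻¹ / 2 →
    cosh (Real.pi * b * w) ≠ 0 ∧
    G (w + b / 2 * I) = C * cosh (Real.pi * b * w) * G (w - b / 2 * I) := by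
  obtain ⟨C, hC⟩ := hG.shift
  have hb : 0 < b⁻¹ / 2 := by have := hG.hb; positivity
  refine ⟨C, ?_, fun w hw => ⟨?_, hC w hw⟩⟩
  · rintro rfl
    have := hC 0 (by simpa using hb)
    simp [hG.ne] at this
  · intro h
    have := hC w hw
    simp [hG.ne, h] at this

lemma star_rec (hG : GP b G) {p q : Fin 3 → ℂ}
    (hsum : p 0 + p 1 + p 2 + q 0 + q 1 + q 2 = ((-2 * (b + b⁻¹) : ℝ) : ℂ) * I)
    (hp0 : |(p 0).im| < b⁻¹ / 2) (hq0 : |(q 0).im| < b⁻¹ / 2)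
    (hpl : ∀ j, j ≠ 0 → -((b + b⁻¹) / 2) < (p j).im) (hql : ∀ j, j ≠ 0 → -((b + b⁻¹) / 2) < (q j).im)
    (hpu : ∀ j, j ≠ 0 → (p j).im < (b + b⁻¹) / 2 - b) (hqu : ∀ j, j ≠ 0 → (q j).im < (b + b⁻¹) / 2 - b) :
    (sinh (Real.pi * b * (p 1 + q 0 + b / 2 * I)) * sinh (Real.pi * b * (p 2 + q 0 + b / 2 * I))) *
      Lf G ![p 0 + b / 2 * I, p 1, p 2] ![q 0 - b / 2 * I, q 1, q 2] =
    (sinh (Real.pi * b * (q 1 + p 0 + b / 2 * I)) * sinh (Real.pi * b * (q 2 + p 0 + b / 2 * I))) *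
      Lf G ![p 0 - b / 2 * I, p 1, p 2] ![q 0 + b / 2 * I, q 1, q 2] := by
  obtain ⟨C, hC0, hC⟩ := hG.C_ne
  have hb := hG.hb
  have hbi : 0 < b⁻¹ := inv_pos.2 hb
  have himsum : (p 0).im + (p 1).im + (p 2).im + (q 0).im + (q 1).im + (q 2).im = -2 * (b + b⁻¹) := by
    have := congrArg im hsum
    simpa using this
  have p1l := hpl 1 (by decide)
  have p2l := hpl 2 (by decide)
  have q1l := hql 1 (by decide)
  have q2l := hql 2 (by decide)
  have p1u := hpu 1 (by decide)
  have p2u := hpu 2 (by decide)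
  have q1u := hqu 1 (by decide)
  have q2u := hqu 2 (by decide)
  rw [abs_lt] at hp0 hq0
  set A := sinh (Real.pi * b * (p 1 + q 0 + b / 2 * I)) * sinh (Real.pi * b * (p 2 + q 0 + b / 2 * I)) with hA
  set B := sinh (Real.pi * b * (q 1 + p 0 + b / 2 * I)) * sinh (Real.pi * b * (q 2 + p 0 + b / 2 * I)) with hB
  -- the auxiliary function
  let pJ : Fin 3 → ℂ := ![p 0 - b / 2 * I, p 1, p 2]
  let qJ : Fin 3 → ℂ := ![q 0 + b / 2 * I, q 1 + b * I, q 2 + b * I]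
  have sJ : ∀ y : ℝ, 0 ≤ y → y ≤ b → (∀ i, |(pJ i).im + y| < (b + b⁻¹) / 2) ∧
      (∀ i, |(qJ i).im - y| < (b + b⁻¹) / 2) := by
    intro y y1 y2
    constructor <;> intro i <;> rw [abs_lt] <;> fin_cases i <;> simp [pJ, qJ] <;> constructor <;> linarith
  have sumJ : ∀ y : ℝ, ∑ i, ((pJ i + y * I).im + (qJ i - y * I).im) = - 2 * b⁻¹ := by
    intro y
    simp [pJ, qJ, Fin.sum_univ_three]
    linarith
  obtain ⟨κ, hκ1, hκ2⟩ : ∃ κ : ℝ, κ < (b + b⁻¹) / 2 ∧ ∀ y : ℝ, 0 ≤ y → y ≤ b →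
      (∀ i, |(pJ i).im + y| ≤ κ) ∧ (∀ i, |(qJ i).im - y| ≤ κ) := by
    have e : ∀ᶠ κ in 𝓝[<] ((b + b⁻¹) / 2), ∀ i, |(pJ i).im + 0| < κ ∧ |(qJ i).im - 0| < κ ∧
        |(pJ i).im + b| < κ ∧ |(qJ i).im - b| < κ := by
      rw [eventually_all]
      intro i
      have h1 := sJ 0 le_rfl hb.le
      have h2 := sJ b hb.le le_rfl
      filter_upwards [Ioo_mem_nhdsLT (h1.1 i), Ioo_mem_nhdsLT (h1.2 i), Ioo_mem_nhdsLT (h2.1 i),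
        Ioo_mem_nhdsLT (h2.2 i)] with κ a1 a2 a3 a4
      exact ⟨a1.1, a2.1, a3.1, a4.1⟩
    obtain ⟨κ, h1, h2⟩ := (e.and self_mem_nhdsWithin).exists
    refine ⟨κ, h2, fun y y1 y2 => ⟨fun i => ?_, fun i => ?_⟩⟩
    · obtain ⟨a1, a2, a3, a4⟩ := h1 i
      rw [abs_lt] at a1 a2 a3 a4
      rw [abs_le]; constructor <;> linarith
    · obtain ⟨a1, a2, a3, a4⟩ := h1 i
      rw [abs_lt] at a1 a2 a3 a4
      rw [abs_le]; constructor <;> linarith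
  obtain ⟨_, ρ, _, hρ⟩ := exists_bd (p := fun i => pJ i + (0:ℝ) * I) (q := fun i => qJ i - (0:ℝ) * I) hG
    (by simpa using (sJ 0 le_rfl hb.le).1) (by simpa using (sJ 0 le_rfl hb.le).2)
  obtain ⟨K, hK, hKb⟩ := lin_bound (ι := Fin 3) hG hκ1 ρ
  have hneg : Real.pi * (-2 * b⁻¹) < 0 := by
    have := Real.pi_pos
    nlinarith [mul_pos this hbi]
  have Jint : ∀ y : ℝ, 0 ≤ y → y ≤ b → Integrable fun x : ℝ => Lin G pJ qJ (x + y * I) := by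
    intro y y1 y2
    simp_rw [lin_vshift]
    refine lin_integrable hG ?_ ?_ ?_
    · simpa using (sJ y y1 y2).1
    · simpa using (sJ y y1 y2).2
    · rw [sumJ]; linarith
  have hcs := cauchy_strip (f := fun z => Lin G pJ qJ z) (y1 := 0) (y2 := b) hb.le
    (m := fun x => K * Real.exp ((Real.pi * (-2 * b⁻¹)) * |x|))
    (fun τ t1 t2 => lin_diff_z hG (by simpa using (sJ τ.im t1 t2).1) (by simpa using (sJ τ.im t1 t2).2))
    (tendsto_exp_abs hneg K).1 (tendsto_exp_abs hneg K).2 (by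
      intro x y y1 y2
      have := hKb (fun i => pJ i + y * I) (fun i => qJ i - y * I) (by simpa using (hκ2 y y1 y2).1)
        (by simpa using (hκ2 y y1 y2).2) (fun i => by simpa using (hρ i).2.2.1.le)
        (fun i => by simpa using (hρ i).2.2.2.le) x
      rw [sumJ, ← lin_vshift] at this
      exact this)
    (Jint 0 le_rfl hb.le) (Jint b hb.le le_rfl)
  -- pointwise identity
  have ii1 : Integrable fun x : ℝ => Lin G ![p 0 + b / 2 * I, p 1, p 2] ![q 0 - b / 2 * I, q 1, q 2] x := by
    refine lin_integrable hG ?_ ?_ ?_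
    · intro i; rw [abs_lt]; fin_cases i <;> simp <;> constructor <;> linarith
    · intro i; rw [abs_lt]; fin_cases i <;> simp <;> constructor <;> linarith
    · simp [Fin.sum_univ_three]; linarith
  have ii2 : Integrable fun x : ℝ => Lin G ![p 0 - b / 2 * I, p 1, p 2] ![q 0 + b / 2 * I, q 1, q 2] x := by
    refine lin_integrable hG ?_ ?_ ?_
    · intro i; rw [abs_lt]; fin_cases i <;> simp <;> constructor <;> linarith
    · intro i; rw [abs_lt]; fin_cases i <;> simp <;> constructor <;> linarith
    · simp [Fin.sum_univ_three]; linarith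
  have pt : ∀ x : ℝ, Lin G pJ qJ (x + b * I) - Lin G pJ qJ (x + (0 : ℝ) * I) =
      -(C ^ 2) * (A * Lin G ![p 0 + b / 2 * I, p 1, p 2] ![q 0 - b / 2 * I, q 1, q 2] x -
        B * Lin G ![p 0 - b / 2 * I, p 1, p 2] ![q 0 + b / 2 * I, q 1, q 2] x) := by
    intro x
    have g1 := (hC (p 0 + x) (by rw [abs_lt]; simp; constructor <;> linarith)).2
    have g2 := (hC (q 0 - x) (by rw [abs_lt]; simp; constructor <;> linarith)).2
    have g3 := (hC (p 1 + x + b / 2 * I) (by rw [abs_lt]; simp; constructor <;> linarith)).2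
    have g4 := (hC (p 2 + x + b / 2 * I) (by rw [abs_lt]; simp; constructor <;> linarith)).2
    have g5 := (hC (q 1 - x + b / 2 * I) (by rw [abs_lt]; simp; constructor <;> linarith)).2
    have g6 := (hC (q 2 - x + b / 2 * I) (by rw [abs_lt]; simp; constructor <;> linarith)).2
    have tr := trig_id (Real.pi * b * p 0) (Real.pi * b * p 1) (Real.pi * b * p 2)
      (Real.pi * b * q 0) (Real.pi * b * q 1) (Real.pi * b * q 2) (Real.pi * b * x)
      (Real.pi * b * (b / 2 * I)) (by
        have e : (Real.pi * b * p 0 + Real.pi * b * p 1 + Real.pi * b * p 2 +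
          Real.pi * b * q 0 + Real.pi * b * q 1 + Real.pi * b * q 2 : ℂ) =
          -4 * (Real.pi * b * (b / 2 * I)) - 2 * Real.pi * I := by
          have : (b : ℂ) ≠ 0 := by exact_mod_cast hb.ne'
          have h2 : Real.pi * b * (p 0 + p 1 + p 2 + q 0 + q 1 + q 2) =
            Real.pi * b * (((-2 * (b + b⁻¹) : ℝ) : ℂ) * I) := by rw [hsum]
          push_cast at h2
          field_simp at h2
          linear_combination (Real.pi : ℂ) * h2
        rw [e, exp_sub, exp_two_pi_mul_I, div_one])
    simp only [← mul_add, ← mul_sub] at tr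
    rw [← hA, ← hB] at tr
    simp only [Lin, Fin.prod_univ_three, pJ, qJ, Matrix.cons_val_zero, Matrix.cons_val_one,
      Matrix.cons_val]
    have r1 : G (p 0 - b / 2 * I + (x + b * I)) = G (p 0 + x + b / 2 * I) := by congr 1; ring
    have r2 : G (q 0 + b / 2 * I - (x + b * I)) = G (q 0 - x - b / 2 * I) := by congr 1; ring
    have r3 : G (p 1 + (x + b * I)) = G (p 1 + x + b / 2 * I + b / 2 * I) := by congr 1; ring
    have r4 : G (p 2 + (x + b * I)) = G (p 2 + x + b / 2 * I + b / 2 * I) := by congr 1; ring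
    have r5 : G (q 1 + b * I - (x + b * I)) = G (q 1 - x + b / 2 * I - b / 2 * I) := by congr 1; ring
    have r6 : G (q 2 + b * I - (x + b * I)) = G (q 2 - x + b / 2 * I - b / 2 * I) := by congr 1; ring
    have s1 : G (p 0 - b / 2 * I + (x + (0 : ℝ) * I)) = G (p 0 + x - b / 2 * I) := by congr 1; push_cast; ring
    have s2 : G (q 0 + b / 2 * I - (x + (0 : ℝ) * I)) = G (q 0 - x + b / 2 * I) := by congr 1; push_cast; ring
    have s3 : G (p 1 + (x + (0 : ℝ) * I)) = G (p 1 + x + b / 2 * I - b / 2 * I) := by congr 1; push_cast; ring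
    have s4 : G (p 2 + (x + (0 : ℝ) * I)) = G (p 2 + x + b / 2 * I - b / 2 * I) := by congr 1; push_cast; ring
    have s5 : G (q 1 + b * I - (x + (0 : ℝ) * I)) = G (q 1 - x + b / 2 * I + b / 2 * I) := by congr 1; push_cast; ring
    have s6 : G (q 2 + b * I - (x + (0 : ℝ) * I)) = G (q 2 - x + b / 2 * I + b / 2 * I) := by congr 1; push_cast; ring
    have t1 : G (p 0 + b / 2 * I + x) = G (p 0 + x + b / 2 * I) := by congr 1; ring
    have t2 : G (q 0 - b / 2 * I - x) = G (q 0 - x - b / 2 * I) := by congr 1; ring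
    have t1' : G (p 0 - b / 2 * I + x) = G (p 0 + x - b / 2 * I) := by congr 1; ring
    have t2' : G (q 0 + b / 2 * I - x) = G (q 0 - x + b / 2 * I) := by congr 1; ring
    have t3 : G (p 1 + x) = G (p 1 + x + b / 2 * I - b / 2 * I) := by congr 1; ring
    have t4 : G (p 2 + x) = G (p 2 + x + b / 2 * I - b / 2 * I) := by congr 1; ring
    have t5 : G (q 1 - x) = G (q 1 - x + b / 2 * I - b / 2 * I) := by congr 1; ring
    have t6 : G (q 2 - x) = G (q 2 - x + b / 2 * I - b / 2 * I) := by congr 1; ring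
    rw [r1, r2, r3, r4, r5, r6, s1, s2, s3, s4, s5, s6, t1, t2, t1', t2', t3, t4, t5, t6,
      g1, g2, g3, g4, g5, g6]
    generalize G (p 0 + x - b / 2 * I) = a1
    generalize G (q 0 - x - b / 2 * I) = a2
    generalize G (p 1 + x + b / 2 * I - b / 2 * I) = a3
    generalize G (p 2 + x + b / 2 * I - b / 2 * I) = a4
    generalize G (q 1 - x + b / 2 * I - b / 2 * I) = a5
    generalize G (q 2 - x + b / 2 * I - b / 2 * I) = a6
    linear_combination (C ^ 3 * a1 * a2 * a3 * a4 * a5 * a6) * tr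
  have h0 : ∫ x : ℝ, (Lin G pJ qJ (x + b * I) - Lin G pJ qJ (x + (0 : ℝ) * I)) = 0 := by
    rw [integral_sub (Jint b hb.le le_rfl) (Jint 0 le_rfl hb.le), hcs, sub_self]
  simp_rw [pt] at h0
  rw [integral_const_mul, integral_sub (ii1.const_mul _) (ii2.const_mul _), integral_const_mul,
    integral_const_mul] at h0
  have h3 : (-(C ^ 2)) ≠ 0 := by simpa using hC0
  exact sub_eq_zero.1 ((mul_eq_zero.1 h0).resolve_left h3)

end

end

section

section
variable {b : ℝ} {G : ℂ → ℂ}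

noncomputable def Ff (b : ℝ) (G : ℂ → ℂ) (p q : Fin 3 → ℂ) : ℂ := Lf G p q / Rf b G p q

lemma Rf_ne (hG : GP b G) (p q : Fin 3 → ℂ) : Rf b G p q ≠ 0 := by
  unfold Rf
  exact Finset.prod_ne_zero_iff.2 fun i _ => Finset.prod_ne_zero_iff.2 fun j _ => hG.ne _

lemma Ff_holo (hG : GP b G) {p q : Fin 3 → ℂ → ℂ} {y0 : ℂ}
    (hp : ∀ i, Differentiable ℂ (p i)) (hq : ∀ i, Differentiable ℂ (q i))
    (h : TD b (fun i => p i y0) (fun i => q i y0)) :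
    DifferentiableAt ℂ (fun y => Ff b G (fun i => p i y) (fun i => q i y)) y0 := by
  obtain ⟨h1, h2, h3⟩ := h.str
  refine DifferentiableAt.div ?_ ?_ (Rf_ne hG _ _)
  · refine Lf_holo hG hp hq h1 h2 ?_
    have := h.im_sum
    have hb := hG.hb
    have hbi : 0 < b⁻¹ := inv_pos.2 hb
    simp [Fin.sum_univ_three]
    linarith
  · unfold Rf
    refine DifferentiableAt.fun_finsetProd fun i _ => DifferentiableAt.fun_finsetProd fun j _ => ?_
    refine DifferentiableAt.comp (g := G) y0 (hG.diff _ ?_) (((hp i y0).add (hq j y0)).add_const _)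
    simpa using h3 i j

lemma TD.line {p q : Fin 3 → ℂ} (h : TD b p q) {y : ℂ} (h1 : -((b + b⁻¹) / 2) < (p 0).im + y.im)
    (h2 : -((b + b⁻¹) / 2) < (q 0).im - y.im) : TD b ![p 0 + y, p 1, p 2] ![q 0 - y, q 1, q 2] := by
  refine ⟨?_, ?_, ?_⟩
  · rw [← h.sum]; simp; ring
  · intro i; have := h.hp i; fin_cases i
    · simpa using h1
    · simpa using this
    · simpa using this
  · intro i; have := h.hq i; fin_cases i
    · simpa using h2
    · simpa using this
    · simpa using this

lemma Ff_rec (hG : GP b G) {p q : Fin 3 → ℂ} (h : TD b p q)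
    (hpu : ∀ j, j ≠ 0 → (p j).im < (b + b⁻¹) / 2 - b) (hqu : ∀ j, j ≠ 0 → (q j).im < (b + b⁻¹) / 2 - b)
    (h0 : -((b + b⁻¹) / 2) < (q 0).im - b) :
    Ff b G ![p 0 + b * I, p 1, p 2] ![q 0 - b * I, q 1, q 2] = Ff b G ![p 0, p 1, p 2] ![q 0, q 1, q 2] := by
  have hb := hG.hb
  have hbi : 0 < b⁻¹ := inv_pos.2 hb
  have hbc : (b : ℂ) ≠ 0 := by exact_mod_cast hb.ne'
  have h' := h.line (y := b * I) (by have := h.hp 0; simp; linarith) (by simpa using h0)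
  obtain ⟨-, -, s1⟩ := h.str
  obtain ⟨-, -, s2⟩ := h'.str
  have is := h.im_sum
  have p0 := h.hp 0
  have p1 := h.hp 1
  have p2 := h.hp 2
  have q0 := h.hq 0
  have q1 := h.hq 1
  have q2 := h.hq 2
  have hrec := star_rec hG (p := ![p 0 + b / 2 * I, p 1, p 2]) (q := ![q 0 - b / 2 * I, q 1, q 2])
    (by rw [← h.sum]; simp; ring) (by rw [abs_lt]; simp; constructor <;> linarith)
    (by rw [abs_lt]; simp; constructor <;> linarith)
    (by intro j hj; fin_cases j <;> simp at hj ⊢ <;> linarith)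
    (by intro j hj; fin_cases j <;> simp at hj ⊢ <;> linarith)
    (by intro j hj; have := hpu j hj; fin_cases j <;> simp at hj this ⊢ <;> linarith)
    (by intro j hj; have := hqu j hj; fin_cases j <;> simp at hj this ⊢ <;> linarith)
  simp only [Matrix.cons_val_zero, Matrix.cons_val_one, Matrix.cons_val] at hrec
  have e1 : p 0 + b / 2 * I + b / 2 * I = p 0 + b * I := by ring
  have e2 : q 0 - b / 2 * I - b / 2 * I = q 0 - b * I := by ring
  have e3 : p 0 + b / 2 * I - b / 2 * I = p 0 := by ring
  have e4 : q 0 - b / 2 * I + b / 2 * I = q 0 := by ring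
  rw [e1, e2, e3, e4] at hrec
  obtain ⟨C, hC0, hC⟩ := hG.C_ne
  have key : ∀ w : ℂ, |w.im + (b + b⁻¹) / 2| < (b + b⁻¹) / 2 →
      |w.im + b + (b + b⁻¹) / 2| < (b + b⁻¹) / 2 →
      sinh (Real.pi * b * (w + b * I)) ≠ 0 ∧
      G (w + b * I + (((b + b⁻¹) / 2 : ℝ) : ℂ) * I) =
        C * I * sinh (Real.pi * b * (w + b * I)) * G (w + (((b + b⁻¹) / 2 : ℝ) : ℂ) * I) := by
    intro w w1 w2
    rw [abs_lt] at w1 w2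
    obtain ⟨g1, g2⟩ := hC (w + (((b + b⁻¹) / 2 : ℝ) : ℂ) * I + b / 2 * I)
      (by rw [abs_lt]; simp; constructor <;> linarith)
    have e : (Real.pi * b * (w + (((b + b⁻¹) / 2 : ℝ) : ℂ) * I + b / 2 * I) : ℂ) =
      Real.pi * b * (w + b * I) + Real.pi / 2 * I := by
      push_cast; field_simp; ring
    rw [e, cosh_add_half] at g1 g2
    refine ⟨right_ne_zero_of_mul g1, ?_⟩
    rw [show w + b * I + (((b + b⁻¹) / 2 : ℝ) : ℂ) * I = w + (((b + b⁻¹) / 2 : ℝ) : ℂ) * I + b / 2 * I + b / 2 * I by ring, g2,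
      show w + (((b + b⁻¹) / 2 : ℝ) : ℂ) * I + b / 2 * I - b / 2 * I = w + (((b + b⁻¹) / 2 : ℝ) : ℂ) * I by ring]
    ring
  obtain ⟨k1, K1⟩ := key (q 1 + p 0) (by simpa [add_comm] using s1 0 1) (by
    have := s2 0 1; simp at this; simpa [add_comm, add_left_comm, add_assoc] using this)
  obtain ⟨k2, K2⟩ := key (q 2 + p 0) (by simpa [add_comm] using s1 0 2) (by
    have := s2 0 2; simp at this; simpa [add_comm, add_left_comm, add_assoc] using this)
  obtain ⟨k3, K3⟩ := key (p 1 + q 0 - b * I) (by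
    have := s2 1 0; simp at this; simpa [add_sub_assoc] using this) (by simpa using s1 1 0)
  obtain ⟨k4, K4⟩ := key (p 2 + q 0 - b * I) (by
    have := s2 2 0; simp at this; simpa [add_sub_assoc] using this) (by simpa using s1 2 0)
  have f1 : p 1 + (q 0 - b / 2 * I) + b / 2 * I = p 1 + q 0 - b * I + b * I := by ring
  have f2 : p 2 + (q 0 - b / 2 * I) + b / 2 * I = p 2 + q 0 - b * I + b * I := by ring
  have f3 : q 1 + (p 0 + b / 2 * I) + b / 2 * I = q 1 + p 0 + b * I := by ring
  have f4 : q 2 + (p 0 + b / 2 * I) + b / 2 * I = q 2 + p 0 + b * I := by ring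
  rw [f1, f2, f3, f4] at hrec
  have rr : (sinh (Real.pi * b * (p 1 + q 0 - b * I + b * I)) * sinh (Real.pi * b * (p 2 + q 0 - b * I + b * I))) *
      Rf b G ![p 0 + b * I, p 1, p 2] ![q 0 - b * I, q 1, q 2] =
    (sinh (Real.pi * b * (q 1 + p 0 + b * I)) * sinh (Real.pi * b * (q 2 + p 0 + b * I))) *
      Rf b G ![p 0, p 1, p 2] ![q 0, q 1, q 2] := by
    simp only [Rf, Fin.prod_univ_three, Matrix.cons_val_zero, Matrix.cons_val_one, Matrix.cons_val]
    generalize (((b + b⁻¹) / 2 : ℝ) : ℂ) * I = e at *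
    rw [show p 0 + b * I + (q 0 - b * I) + e = p 0 + q 0 + e by ring,
      show p 0 + b * I + q 1 + e = q 1 + p 0 + b * I + e by ring,
      show p 0 + b * I + q 2 + e = q 2 + p 0 + b * I + e by ring, K1, K2,
      show p 0 + q 1 + e = q 1 + p 0 + e by ring,
      show p 0 + q 2 + e = q 2 + p 0 + e by ring,
      show p 1 + q 0 + e = p 1 + q 0 - b * I + b * I + e by ring,
      show p 2 + q 0 + e = p 2 + q 0 - b * I + b * I + e by ring, K3, K4,
      show p 1 + (q 0 - b * I) + e = p 1 + q 0 - b * I + e by ring,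
      show p 2 + (q 0 - b * I) + e = p 2 + q 0 - b * I + e by ring]
    ring
  unfold Ff
  rw [div_eq_div_iff (Rf_ne hG _ _) (Rf_ne hG _ _)]
  have n1 := mul_ne_zero k1 k2
  have n2 := mul_ne_zero k3 k4
  apply mul_left_cancel₀ (mul_ne_zero n1 n2)
  generalize Rf b G ![p 0 + b * I, p 1, p 2] ![q 0 - b * I, q 1, q 2] = R1 at *
  generalize Rf b G ![p 0, p 1, p 2] ![q 0, q 1, q 2] = R2 at *
  generalize Lf G ![p 0 + b * I, p 1, p 2] ![q 0 - b * I, q 1, q 2] = L1 at *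
  generalize Lf G ![p 0, p 1, p 2] ![q 0, q 1, q 2] = L2 at *
  generalize sinh (Real.pi * b * (p 1 + q 0 - b * I + b * I)) * sinh (Real.pi * b * (p 2 + q 0 - b * I + b * I)) = A at *
  generalize sinh (Real.pi * b * (q 1 + p 0 + b * I)) * sinh (Real.pi * b * (q 2 + p 0 + b * I)) = B at *
  linear_combination (B * R2) * hrec - (B * L2) * rr

lemma Ff_bdd (hG : GP b G) {p q : Fin 3 → ℂ} (h : TD b p q)
    (h0 : b < (p 0).im + (q 0).im + (b + b⁻¹)) {a1 a2 : ℝ}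
    (ha1 : -((b + b⁻¹) / 2) < (p 0).im + a1) (ha2 : -((b + b⁻¹) / 2) < (q 0).im - a2) :
    ∃ M : ℝ, ∀ y : ℂ, a1 ≤ y.im → y.im ≤ a2 →
      ‖Ff b G ![p 0 + y, p 1, p 2] ![q 0 - y, q 1, q 2]‖ ≤ M := by
  have hb := hG.hb
  have hpi := Real.pi_pos
  have hbi : 0 < b⁻¹ := inv_pos.2 hb
  obtain ⟨μ0, hμ0, m1, m2⟩ := h.margin
  obtain ⟨μ, hμ, hμ1, hμ2, hμ3⟩ : ∃ μ : ℝ, 0 < μ ∧ μ ≤ μ0 ∧ μ ≤ (p 0).im + a1 + (b + b⁻¹) / 2 ∧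
      μ ≤ (q 0).im - a2 + (b + b⁻¹) / 2 := by
    refine ⟨min μ0 (min ((p 0).im + a1 + (b + b⁻¹) / 2) ((q 0).im - a2 + (b + b⁻¹) / 2)), ?_, ?_, ?_, ?_⟩
    · refine lt_min hμ0 (lt_min ?_ ?_) <;> linarith
    · exact min_le_left _ _
    · exact (min_le_right _ _).trans (min_le_left _ _)
    · exact (min_le_right _ _).trans (min_le_right _ _)
  set κ := (b + b⁻¹) / 2 - μ with hκd
  have hκ : κ < (b + b⁻¹) / 2 := by rw [hκd]; linarith
  obtain ⟨_, ρ, _, hρ⟩ := exists_bd hG h.str.1 h.str.2.1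
  obtain ⟨K, hK, hKb⟩ := lin_bound0 (ι := Fin 3) hG hκ
  obtain ⟨K', hK', hKb'⟩ := hG.bound κ hκ
  have is := h.im_sum
  set B := -((p 0).im + (q 0).im) with hB
  have hBpos : 0 < B := by
    have p1 := h.hp 1
    have p2 := h.hp 2
    have q1 := h.hq 1
    have q2 := h.hq 2
    rw [hB]; linarith
  have hc : Real.pi * (-2 * (b + b⁻¹ - B)) < 0 := by
    apply mul_neg_of_pos_of_neg hpi; rw [hB]; linarith
  have hint := integrable_exp_abs hc
  set T := ∫ z : ℝ, Real.exp (Real.pi * (-2 * (b + b⁻¹ - B)) * |z|) with hT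
  have hT0 : 0 ≤ T := integral_nonneg fun _ => (Real.exp_pos _).le
  have fin3 : ∀ {i : Fin 3}, |(p i).re| ≤ ρ ∧ |(q i).re| ≤ ρ := fun {i} => ⟨(hρ i).2.2.1.le, (hρ i).2.2.2.le⟩
  refine ⟨(K * Real.exp (Real.pi * (6 * (ρ * κ))) * T) * (K' ^ 9 * Real.exp (Real.pi * (18 * (ρ * κ)))), fun y y1 y2 => ?_⟩
  obtain ⟨b1, b2, b3⟩ := sum_margin (Q := b + b⁻¹) (μ := μ) (p := ![p 0 + y, p 1, p 2])
    (q := ![q 0 - y, q 1, q 2]) (by simp; linarith) hμ.le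
    (by intro i; have := m1 i; fin_cases i <;> simp at this ⊢ <;> linarith)
    (by intro i; have := m2 i; fin_cases i <;> simp at this ⊢ <;> linarith)
  rw [← hκd] at b1 b2 b3
  have L : ‖Lf G ![p 0 + y, p 1, p 2] ![q 0 - y, q 1, q 2]‖ ≤
      (K * Real.exp (Real.pi * (6 * (ρ * κ))) * Real.exp (-(Real.pi * (B * |y.re|)))) * T := by
    unfold Lf
    rw [hT, ← integral_const_mul]
    refine norm_integral_le_of_norm_le (hint.const_mul _) (Eventually.of_forall fun z => ?_)
    refine (hKb _ _ b1 b2 z).trans ?_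
    rw [mul_assoc, mul_assoc, ← Real.exp_add, ← Real.exp_add]
    gcongr
    rw [mul_assoc, ← mul_neg, ← mul_add, ← mul_add]
    refine mul_le_mul_of_nonneg_left ?_ hpi.le
    simp only [Fin.sum_univ_three, Matrix.cons_val_zero, Matrix.cons_val_one, Matrix.cons_val, add_re, sub_re, add_im, sub_im]
    have c1 := b1 0
    have c2 := b1 1
    have c3 := b1 2
    have d1 := b2 0
    have d2 := b2 1
    have d3 := b2 2
    simp only [Matrix.cons_val_zero, Matrix.cons_val_one, Matrix.cons_val, add_im, sub_im] at c1 c2 c3 d1 d2 d3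
    have i1 := abs_add_mul_le (w := y.re + z) (fin3 (i := 0)).1 c1
    have i2 := abs_sub_mul_le (w := y.re + z) (fin3 (i := 0)).2 d1
    have i3 := abs_add_mul_le (w := z) (fin3 (i := 1)).1 c2
    have i4 := abs_sub_mul_le (w := z) (fin3 (i := 1)).2 d2
    have i5 := abs_add_mul_le (w := z) (fin3 (i := 2)).1 c3
    have i6 := abs_sub_mul_le (w := z) (fin3 (i := 2)).2 d3
    rw [← add_assoc] at i1
    rw [← sub_sub] at i2
    have tri : |y.re| ≤ |y.re + z| + |z| := by
      have := abs_sub (y.re + z) z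
      simpa using this
    have tri2 := mul_le_mul_of_nonneg_left tri hBpos.le
    have e1 : |y.re + z| * ((p 0).im + y.im) + |y.re + z| * ((q 0).im - y.im) = - (B * |y.re + z|) := by
      rw [hB]; ring
    have e2 : |z| * (p 1).im + |z| * (q 1).im + |z| * (p 2).im + |z| * (q 2).im =
      (-2 * (b + b⁻¹) + B) * |z| := by
      rw [hB]; linear_combination |z| * is
    linarith
  have R : ‖(Rf b G ![p 0 + y, p 1, p 2] ![q 0 - y, q 1, q 2])⁻¹‖ ≤
      K' ^ 9 * Real.exp (Real.pi * (18 * (ρ * κ))) * Real.exp (Real.pi * (B * |y.re|)) := by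
    have g : ∀ w : ℂ, |w.im + (b + b⁻¹) / 2| ≤ κ → ‖(G (w + (((b + b⁻¹) / 2 : ℝ) : ℂ) * I))⁻¹‖ ≤
        K' * Real.exp (Real.pi * (|w.re| * -(w.im + (b + b⁻¹) / 2))) := by
      intro w hw
      have e : (G (w + (((b + b⁻¹) / 2 : ℝ) : ℂ) * I))⁻¹ = G (-(w + (((b + b⁻¹) / 2 : ℝ) : ℂ) * I)) :=
        (eq_inv_of_mul_eq_one_left (hG.neg _)).symm
      rw [e]
      have := hKb' (-(w + (((b + b⁻¹) / 2 : ℝ) : ℂ) * I)) (by rw [neg_im, abs_neg]; simpa using hw)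
      simpa [-neg_add_rev] using this
    have g2 : ∀ (w : ℂ) (Z : ℝ), |w.im + (b + b⁻¹) / 2| ≤ κ → |w.re - Z| ≤ ρ + ρ → ‖(G (w + (((b + b⁻¹) / 2 : ℝ) : ℂ) * I))⁻¹‖ ≤
        K' * Real.exp (Real.pi * (|Z| * -(w.im + (b + b⁻¹) / 2) + 2 * (ρ * κ))) := by
      intro w Z hw hr
      refine (g w hw).trans ?_
      gcongr
      have := abs_add_mul_le (w := Z) hr ((abs_neg _).trans_le hw)
      simp only [sub_add_cancel] at this
      linarith
    have nn : ∀ x1 x2 : ℝ, |x1| ≤ ρ → |x2| ≤ ρ → |x1 + x2| ≤ ρ + ρ := fun x1 x2 h1 h2 =>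
      (abs_add_le _ _).trans (add_le_add h1 h2)
    have k00 := g2 (p 0 + y + (q 0 - y)) 0 (by simpa using b3 0 0)
      (by simp; exact nn _ _ fin3.1 fin3.2)
    have k01 := g2 (p 0 + y + q 1) y.re (by simpa using b3 0 1)
      (by simp; rw [show (p 0).re + y.re + (q 1).re - y.re = (p 0).re + (q 1).re by ring]; exact nn _ _ fin3.1 fin3.2)
    have k02 := g2 (p 0 + y + q 2) y.re (by simpa using b3 0 2)
      (by simp; rw [show (p 0).re + y.re + (q 2).re - y.re = (p 0).re + (q 2).re by ring]; exact nn _ _ fin3.1 fin3.2)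
    have k10 := g2 (p 1 + (q 0 - y)) (-y.re) (by simpa using b3 1 0)
      (by simp; rw [show (p 1).re + ((q 0).re - y.re) + y.re = (p 1).re + (q 0).re by ring]; exact nn _ _ fin3.1 fin3.2)
    have k20 := g2 (p 2 + (q 0 - y)) (-y.re) (by simpa using b3 2 0)
      (by simp; rw [show (p 2).re + ((q 0).re - y.re) + y.re = (p 2).re + (q 0).re by ring]; exact nn _ _ fin3.1 fin3.2)
    have k11 := g2 (p 1 + q 1) 0 (by simpa using b3 1 1) (by simp; exact nn _ _ fin3.1 fin3.2)
    have k12 := g2 (p 1 + q 2) 0 (by simpa using b3 1 2) (by simp; exact nn _ _ fin3.1 fin3.2)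
    have k21 := g2 (p 2 + q 1) 0 (by simpa using b3 2 1) (by simp; exact nn _ _ fin3.1 fin3.2)
    have k22 := g2 (p 2 + q 2) 0 (by simpa using b3 2 2) (by simp; exact nn _ _ fin3.1 fin3.2)
    simp only [Rf, Fin.prod_univ_three, Matrix.cons_val_zero, Matrix.cons_val_one, Matrix.cons_val,
      mul_inv, norm_mul]
    refine (mul_le_mul (mul_le_mul (mul_le_mul (mul_le_mul k00 k01 (by positivity) (by positivity)) k02
      (by positivity) (by positivity))
      (mul_le_mul (mul_le_mul k10 k11 (by positivity) (by positivity)) k12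
      (by positivity) (by positivity)) (by positivity) (by positivity))
      (mul_le_mul (mul_le_mul k20 k21 (by positivity) (by positivity)) k22
      (by positivity) (by positivity)) (by positivity) (by positivity)).trans (le_of_eq ?_)
    have ee : ∀ x1 x2 x3 x4 x5 x6 x7 x8 x9 : ℝ, (K' * Real.exp x1 * (K' * Real.exp x2) * (K' * Real.exp x3)) *
      (K' * Real.exp x4 * (K' * Real.exp x5) * (K' * Real.exp x6)) *
      (K' * Real.exp x7 * (K' * Real.exp x8) * (K' * Real.exp x9)) =
      K' ^ 9 * Real.exp (x1 + x2 + x3 + x4 + x5 + x6 + x7 + x8 + x9) := by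
      intros; simp only [Real.exp_add]; ring
    rw [ee, mul_assoc (K' ^ 9), ← Real.exp_add]
    congr 2
    simp only [add_im, sub_im, abs_neg, abs_zero]
    rw [hB]
    linear_combination (-Real.pi * |y.re|) * is
  unfold Ff
  rw [div_eq_mul_inv, norm_mul]
  refine (mul_le_mul L R (norm_nonneg _) (by positivity)).trans (le_of_eq ?_)
  have : Real.exp (-(Real.pi * (B * |y.re|))) * Real.exp (Real.pi * (B * |y.re|)) = 1 := by
    rw [← Real.exp_add]; simp
  linear_combination (K * Real.exp (Real.pi * (6 * (ρ * κ))) * T * (K' ^ 9 * Real.exp (Real.pi * (18 * (ρ * κ))))) * this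

/-- S1 -/
lemma Ff_S1 (hG : GP b G) {p q : Fin 3 → ℂ} (h : TD b p q)
    (hpu : ∀ j, j ≠ 0 → (p j).im < (b + b⁻¹) / 2 - b) (hqu : ∀ j, j ≠ 0 → (q j).im < (b + b⁻¹) / 2 - b)
    (h0 : b < (p 0).im + (q 0).im + (b + b⁻¹)) (y : ℝ) :
    Ff b G ![p 0 + y, p 1, p 2] ![q 0 - y, q 1, q 2] = Ff b G p q := by
  have p0 := h.hp 0
  have q0 := h.hq 0
  have hb := hG.hb
  have key := liouville_strip (f := fun y => Ff b G ![p 0 + y, p 1, p 2] ![q 0 - y, q 1, q 2])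
    (a := -((p 0).im + (b + b⁻¹) / 2)) (W := (p 0).im + (q 0).im + (b + b⁻¹)) hG.hb h0 (by
      intro y y1 y2
      have := Ff_holo hG (p := ![fun y => p 0 + y, fun _ => p 1, fun _ => p 2])
        (q := ![fun y => q 0 - y, fun _ => q 1, fun _ => q 2]) (y0 := y)
        (by intro i; fin_cases i <;> simp <;> fun_prop) (by intro i; fin_cases i <;> simp <;> fun_prop)
        (by
          convert h.line (y := y) (by linarith) (by linarith) using 1 <;> ext i <;> fin_cases i <;> rfl)
      convert this using 3 <;> ext i <;> fin_cases i <;> rfl) (by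
      intro y y1 y2
      have h' := h.line (y := y) (by linarith) (by linarith)
      have := Ff_rec hG h' (by intro j hj; have := hpu j hj; fin_cases j <;> simp at hj this ⊢ <;> linarith)
        (by intro j hj; have := hqu j hj; fin_cases j <;> simp at hj this ⊢ <;> linarith)
        (by simp; linarith)
      simp only [Matrix.cons_val_zero, Matrix.cons_val_one, Matrix.cons_val] at this
      simp only [← add_assoc, ← sub_sub]
      exact this) (by
      intro a1 a2 h1 h2
      exact Ff_bdd hG h h0 (by linarith) (by linarith)) (y := y) (z := 0)
      (by simp; linarith) (by simp; linarith) (by simp; linarith) (by simp; linarith)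
  simp only [add_zero, sub_zero] at key
  rw [key]
  congr 1 <;> ext i <;> fin_cases i <;> rfl
end

end

section

section
variable {b : ℝ} {G : ℂ → ℂ}

def lineU (b : ℝ) (p q p' q' : Fin 3 → ℂ) : Set ℂ :=
  {l | TD b (fun i => p i + l * (p' i - p i)) (fun i => q i + l * (q' i - q i))}

lemma mem_lineU {p q p' q' : Fin 3 → ℂ} (h : TD b p q) (h' : TD b p' q') (l : ℂ) :
    l ∈ lineU b p q p' q' ↔ ∀ i, -((b + b⁻¹) / 2) < (p i + l * (p' i - p i)).im ∧
      -((b + b⁻¹) / 2) < (q i + l * (q' i - q i)).im := by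
  constructor
  · intro hl i
    exact ⟨hl.hp i, hl.hq i⟩
  · intro hl
    refine ⟨?_, fun i => (hl i).1, fun i => (hl i).2⟩
    linear_combination (1 - l) * h.sum + l * h'.sum

lemma lineU_open {p q p' q' : Fin 3 → ℂ} (h : TD b p q) (h' : TD b p' q') :
    IsOpen (lineU b p q p' q') := by
  have : lineU b p q p' q' = ⋂ i, ({l | -((b + b⁻¹) / 2) < (p i + l * (p' i - p i)).im} ∩
      {l | -((b + b⁻¹) / 2) < (q i + l * (q' i - q i)).im}) := by
    ext l
    simp only [mem_lineU h h', Set.mem_iInter, Set.mem_inter_iff, Set.mem_ofPred_eq]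
  rw [this]
  refine isOpen_iInter_of_finite fun i => IsOpen.inter ?_ ?_
  · exact isOpen_lt (by fun_prop) (by fun_prop)
  · exact isOpen_lt (by fun_prop) (by fun_prop)

lemma lineU_pre {p q p' q' : Fin 3 → ℂ} (h : TD b p q) (h' : TD b p' q') :
    IsPreconnected (lineU b p q p' q') := by
  apply Convex.isPreconnected
  have aux : ∀ (x d l1 l2 : ℂ) (a c e : ℝ), 0 ≤ a → 0 ≤ c → a + c = 1 → e < (x + l1 * d).im →
      e < (x + l2 * d).im → e < (x + (a • l1 + c • l2) * d).im := by
    intro x d l1 l2 a c e ha hc hac h1 h2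
    have e1 : (x + (a • l1 + c • l2) * d) = a * (x + l1 * d) + c * (x + l2 * d) := by
      have : (a : ℂ) + c = 1 := by exact_mod_cast hac
      simp only [real_smul]
      linear_combination (-x) * this
    rw [e1, add_im, im_ofReal_mul, im_ofReal_mul]
    have hc' : c = 1 - a := by linarith
    rcases eq_or_lt_of_le ha with h0 | h0
    · rw [hc', ← h0]; linarith
    · have k1 := mul_lt_mul_of_pos_left h1 h0
      have k2 := mul_le_mul_of_nonneg_left h2.le hc
      have k3 : a * e + c * e = e := by rw [← add_mul, hac, one_mul]
      linarith
  intro l1 h1 l2 h2 a c ha hc hac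
  rw [mem_lineU h h'] at h1 h2 ⊢
  intro i
  exact ⟨aux _ _ _ _ _ _ _ ha hc hac (h1 i).1 (h2 i).1, aux _ _ _ _ _ _ _ ha hc hac (h1 i).2 (h2 i).2⟩

lemma lineU_an (hG : GP b G) {p q p' q' : Fin 3 → ℂ} (h : TD b p q) (h' : TD b p' q') :
    AnalyticOnNhd ℂ (fun l => Ff b G (fun i => p i + l * (p' i - p i)) (fun i => q i + l * (q' i - q i)))
      (lineU b p q p' q') := by
  refine DifferentiableOn.analyticOnNhd (fun l hl => DifferentiableAt.differentiableWithinAt ?_) (lineU_open h h')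
  exact Ff_holo hG (p := fun i l => p i + l * (p' i - p i)) (q := fun i l => q i + l * (q' i - q i))
    (fun i => by fun_prop) (fun i => by fun_prop) hl

lemma TD.tr {p q : Fin 3 → ℂ} (h : TD b p q) (i j : Fin 3) (y : ℝ) :
    TD b (fun k => p k + if k = i then (y : ℂ) else 0) (fun k => q k - if k = j then (y : ℂ) else 0) := by
  refine ⟨?_, ?_, ?_⟩
  · rw [← h.sum]
    fin_cases i <;> fin_cases j <;> simp <;> ring
  · intro k
    have := h.hp k
    split_ifs <;> simpa using this
  · intro k
    have := h.hq k
    split_ifs <;> simpa using this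

lemma TD_base (hb : 0 < b) : TD b ![((-2 * (b⁻¹ / 8) : ℝ) : ℂ) * I, ((-((b + b⁻¹) / 2) + b⁻¹ / 8 : ℝ) : ℂ) * I,
      ((-((b + b⁻¹) / 2) + b⁻¹ / 8 : ℝ) : ℂ) * I]
    ![((-2 * (b⁻¹ / 8) : ℝ) : ℂ) * I, ((-((b + b⁻¹) / 2) + b⁻¹ / 8 : ℝ) : ℂ) * I,
      ((-((b + b⁻¹) / 2) + b⁻¹ / 8 : ℝ) : ℂ) * I] := by
  have hbi : 0 < b⁻¹ := inv_pos.2 hb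
  refine ⟨?_, ?_, ?_⟩
  · simp only [Matrix.cons_val_zero, Matrix.cons_val_one, Matrix.cons_val]
    push_cast
    ring
  · intro k
    fin_cases k <;> simp [-ofReal_add, -ofReal_mul, -ofReal_neg] <;> linarith
  · intro k
    fin_cases k <;> simp [-ofReal_add, -ofReal_mul, -ofReal_neg] <;> linarith

/-- S2 -/
lemma Ff_S2 (hG : GP b G) {p q : Fin 3 → ℂ} (h : TD b p q) (y : ℝ) :
    Ff b G (fun k => p k + if k = 0 then (y : ℂ) else 0) (fun k => q k - if k = 0 then (y : ℂ) else 0) =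
      Ff b G p q := by
  have hb := hG.hb
  have hbi : 0 < b⁻¹ := inv_pos.2 hb
  have hB := TD_base hb
  set p0 : Fin 3 → ℂ := ![((-2 * (b⁻¹ / 8) : ℝ) : ℂ) * I, ((-((b + b⁻¹) / 2) + b⁻¹ / 8 : ℝ) : ℂ) * I,
      ((-((b + b⁻¹) / 2) + b⁻¹ / 8 : ℝ) : ℂ) * I] with hp0
  have a0 : (p0 0).im = -2 * (b⁻¹ / 8) := by simp [hp0, -ofReal_add, -ofReal_mul, -ofReal_neg]
  have a1 : ∀ j, j ≠ 0 → (p0 j).im = -((b + b⁻¹) / 2) + b⁻¹ / 8 := by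
    intro j hj
    fin_cases j <;> simp [hp0, -ofReal_add, -ofReal_mul, -ofReal_neg] at hj ⊢
  have an := lineU_an hG hB h
  have hB' := hB.tr 0 0 y
  have h' := h.tr 0 0 y
  have an' := lineU_an hG hB' h'
  have hU : lineU b (fun k => p0 k + if k = 0 then (y : ℂ) else 0) (fun k => p0 k - if k = 0 then (y : ℂ) else 0)
    (fun k => p k + if k = 0 then (y : ℂ) else 0) (fun k => q k - if k = 0 then (y : ℂ) else 0) =
    lineU b p0 p0 p q := by
    ext l
    rw [mem_lineU hB' h', mem_lineU hB h]
    refine forall_congr' fun i => ?_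
    split_ifs <;> simp
  rw [hU] at an'
  have z0 : (0 : ℂ) ∈ lineU b p0 p0 p q := by
    rw [mem_lineU hB h]; intro i; simpa using hB.hp i
  have z1 : (1 : ℂ) ∈ lineU b p0 p0 p q := by
    rw [mem_lineU hB h]; intro i; simpa using ⟨h.hp i, h.hq i⟩
  have res := an'.eqOn_of_preconnected_of_eventuallyEq an (lineU_pre hB h) z0 (by
    have ev : ∀ᶠ l in 𝓝 (0 : ℂ), (∀ j : Fin 3, j ≠ 0 → (p0 j + l * (p j - p0 j)).im < (b + b⁻¹) / 2 - b) ∧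
      (∀ j : Fin 3, j ≠ 0 → (p0 j + l * (q j - p0 j)).im < (b + b⁻¹) / 2 - b) ∧
      b < (p0 0 + l * (p 0 - p0 0)).im + (p0 0 + l * (q 0 - p0 0)).im + (b + b⁻¹) := by
      refine Filter.Eventually.and ?_ (Filter.Eventually.and ?_ ?_)
      · rw [eventually_all]; intro j
        rw [eventually_imp_distrib_left]; intro hj
        have c : Continuous fun l : ℂ => (p0 j + l * (p j - p0 j)).im := by fun_prop
        exact c.continuousAt.eventually (gt_mem_nhds (by simp [a1 j hj]; linarith))
      · rw [eventually_all]; intro j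
        rw [eventually_imp_distrib_left]; intro hj
        have c : Continuous fun l : ℂ => (p0 j + l * (q j - p0 j)).im := by fun_prop
        exact c.continuousAt.eventually (gt_mem_nhds (by simp [a1 j hj]; linarith))
      · have c : Continuous fun l : ℂ => (p0 0 + l * (p 0 - p0 0)).im + (p0 0 + l * (q 0 - p0 0)).im + (b + b⁻¹) := by fun_prop
        exact c.continuousAt.eventually (lt_mem_nhds (by simp [a0]; linarith))
    filter_upwards [ev, (lineU_open hB h).mem_nhds z0] with l hl hlU
    have := Ff_S1 hG hlU hl.1 hl.2.1 hl.2.2 y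
    rw [← this]
    congr 1 <;> ext i <;> fin_cases i <;> simp <;> ring) z1
  simp only [one_mul, add_sub_cancel] at res
  simpa using res

lemma Ff_perm (p q : Fin 3 → ℂ) (σ τ : Equiv.Perm (Fin 3)) :
    Ff b G (fun k => p (σ k)) (fun k => q (τ k)) = Ff b G p q := by
  unfold Ff
  congr 1
  · unfold Lf Lin
    congr 1; ext z
    simp only [Finset.prod_mul_distrib]
    rw [Equiv.prod_comp σ (fun k => G (p k + z)), Equiv.prod_comp τ (fun k => G (q k - z))]
  · unfold Rf
    rw [Equiv.prod_comp σ (fun k => ∏ j, G (p k + q (τ j) + (((b + b⁻¹) / 2 : ℝ) : ℂ) * I))]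
    refine Finset.prod_congr rfl fun i _ => ?_
    rw [Equiv.prod_comp τ (fun j => G (p i + q j + (((b + b⁻¹) / 2 : ℝ) : ℂ) * I))]

lemma TD.perm {p q : Fin 3 → ℂ} (h : TD b p q) (σ τ : Equiv.Perm (Fin 3)) :
    TD b (fun k => p (σ k)) (fun k => q (τ k)) := by
  refine ⟨?_, fun i => h.hp _, fun i => h.hq _⟩
  have e1 := Equiv.sum_comp σ p
  have e2 := Equiv.sum_comp τ q
  simp only [Fin.sum_univ_three] at e1 e2
  rw [← h.sum]
  linear_combination e1 + e2

lemma Ff_S3 (hG : GP b G) {p q : Fin 3 → ℂ} (h : TD b p q) (i j : Fin 3) (y : ℝ) :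
    Ff b G (fun k => p k + if k = i then (y : ℂ) else 0) (fun k => q k - if k = j then (y : ℂ) else 0) =
      Ff b G p q := by
  have := Ff_S2 hG (h.perm (Equiv.swap 0 i) (Equiv.swap 0 j)) y
  rw [Ff_perm] at this
  rw [← this, ← Ff_perm (fun k => p k + if k = i then (y : ℂ) else 0) _ (Equiv.swap 0 i) (Equiv.swap 0 j)]
  have e : ∀ i k : Fin 3, Equiv.swap 0 i k = i ↔ k = 0 := by decide
  simp only [e]

lemma Ff_S4 (hG : GP b G) {p q : Fin 3 → ℂ} (h : TD b p q) :
    Ff b G (fun k => (p k).im * I) (fun k => (q k).im * I) = Ff b G p q := by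
  have h1 := h.tr 1 0 (-(p 1).re)
  have f1 := Ff_S3 hG h 1 0 (-(p 1).re)
  have h2 := h1.tr 2 0 (-(p 2).re)
  have f2 := Ff_S3 hG h1 2 0 (-(p 2).re)
  have h3 := h2.tr 0 1 ((q 1).re)
  have f3 := Ff_S3 hG h2 0 1 ((q 1).re)
  have h4 := h3.tr 0 2 ((q 2).re)
  have f4 := Ff_S3 hG h3 0 2 ((q 2).re)
  have f5 := Ff_S3 hG h4 0 0 (-((p 0).re + (q 1).re + (q 2).re))
  rw [← f1, ← f2, ← f3, ← f4, ← f5]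
  have hs := congrArg re h.sum
  simp at hs
  congr 1 <;> ext k <;> fin_cases k <;> apply Complex.ext <;> simp <;> linarith

lemma Ff_S5 (hG : GP b G) {p q p' q' : Fin 3 → ℂ} (h : TD b p q) (h' : TD b p' q') :
    Ff b G p q = Ff b G p' q' := by
  have im_TD : ∀ {p q : Fin 3 → ℂ}, TD b p q → TD b (fun k => (p k).im * I) (fun k => (q k).im * I) := by
    intro p q h
    refine ⟨?_, fun i => by simpa using h.hp i, fun i => by simpa using h.hq i⟩
    rw [← h.im_sum]; push_cast; ring
  rw [← Ff_S4 hG h, ← Ff_S4 hG h']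
  have g := im_TD h
  have g' := im_TD h'
  have an := lineU_an hG g g'
  have z0 : (0 : ℂ) ∈ lineU b (fun k => (p k).im * I) (fun k => (q k).im * I)
    (fun k => (p' k).im * I) (fun k => (q' k).im * I) := by
    rw [mem_lineU g g']; intro i; simpa using ⟨h.hp i, h.hq i⟩
  have z1 : (1 : ℂ) ∈ lineU b (fun k => (p k).im * I) (fun k => (q k).im * I)
    (fun k => (p' k).im * I) (fun k => (q' k).im * I) := by
    rw [mem_lineU g g']; intro i; simpa using ⟨h'.hp i, h'.hq i⟩
  have res := an.eqOn_of_preconnected_of_frequently_eq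
    (g := fun _ => Ff b G (fun k => (p k).im * I) (fun k => (q k).im * I)) analyticOnNhd_const
    (lineU_pre g g') z0 (by
      have t : Tendsto (fun r : ℝ => (r : ℂ) * I) (𝓝[≠] 0) (𝓝[≠] 0) := by
        refine tendsto_nhdsWithin_of_tendsto_nhds_of_eventually_within _ ?_ ?_
        · have c : Continuous fun r : ℝ => (r : ℂ) * I := by fun_prop
          have := c.tendsto 0
          simp only [ofReal_zero, zero_mul] at this
          exact this.mono_left nhdsWithin_le_nhds
        · filter_upwards [self_mem_nhdsWithin] with r hr
          simpa using hr
      refine t.frequently (Eventually.frequently (Eventually.of_forall fun r => ?_))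
      have m : (r : ℂ) * I ∈ lineU b (fun k => (p k).im * I) (fun k => (q k).im * I)
          (fun k => (p' k).im * I) (fun k => (q' k).im * I) := by
        rw [mem_lineU g g']; intro i; simpa using ⟨h.hp i, h.hq i⟩
      have := Ff_S4 hG m
      rw [← this]
      simp) z1
  simp only [one_mul, add_sub_cancel] at res
  exact res.symm

lemma star_triangle (hG : GP b G) : ∃ c : ℂ, c ≠ 0 ∧ ∀ p q : Fin 3 → ℂ, TD b p q →
    Lf G p q = c * Rf b G p q := by
  have hb := hG.hb
  have hbi : 0 < b⁻¹ := inv_pos.2 hb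
  let p0 : Fin 3 → ℂ := fun _ => ((-((b + b⁻¹) / 3) : ℝ) : ℂ) * I
  have h0 : TD b p0 p0 := by
    refine ⟨?_, ?_, ?_⟩
    · simp only [p0]; push_cast; ring
    · intro i; simp only [p0, im_ofReal_mul, I_im]; linarith
    · intro i; simp only [p0, im_ofReal_mul, I_im]; linarith
  refine ⟨Ff b G p0 p0, ?_, fun p q h => ?_⟩
  · refine div_ne_zero ?_ (Rf_ne hG _ _)
    have e : ∀ z : ℝ, Lin G p0 p0 z = ((‖G (((-((b + b⁻¹) / 3) : ℝ) : ℂ) * I + z)‖ ^ 6 : ℝ) : ℂ) := by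
      intro z
      have hc := hG.conj (((-((b + b⁻¹) / 3) : ℝ) : ℂ) * I + z)
      have e2 : -(starRingEnd ℂ) (((-((b + b⁻¹) / 3) : ℝ) : ℂ) * I + z) = ((-((b + b⁻¹) / 3) : ℝ) : ℂ) * I - z := by
        simp only [map_add, map_mul, conj_ofReal, conj_I]; ring
      rw [e2] at hc
      simp only [Lin, p0, Fin.prod_univ_three]
      rw [← hc, mul_conj, normSq_eq_norm_sq]
      push_cast
      ring
    have hi : Integrable fun z : ℝ => Lin G p0 p0 z := lin_integrable hG h0.str.1 h0.str.2.1 (by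
      have := h0.im_sum
      simp only [Fin.sum_univ_three]; linarith)
    unfold Lf
    simp_rw [e] at hi ⊢
    rw [integral_complex_ofReal]
    have hi' := hi.re
    simp only [RCLike.re_eq_complex_re, ofReal_re] at hi'
    have pos : 0 < ∫ z : ℝ, ‖G (((-((b + b⁻¹) / 3) : ℝ) : ℂ) * I + z)‖ ^ 6 := by
      rw [integral_pos_iff_support_of_nonneg (fun z => by positivity) hi']
      have : Function.support (fun z : ℝ => ‖G (((-((b + b⁻¹) / 3) : ℝ) : ℂ) * I + z)‖ ^ 6) = Set.univ := by
        ext z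
        simp [hG.ne]
      rw [this]; simp
    exact_mod_cast pos.ne'
  · rw [Ff_S5 hG h0 h, Ff, div_mul_cancel₀ _ (Rf_ne hG _ _)]
end

end

section

section
variable {b : ℝ} {G : ℂ → ℂ}

noncomputable def Dg (G : ℂ → ℂ) (a z : ℂ) : ℂ := G (a + z) * G (a - z)

lemma Dg_neg (a z : ℂ) : Dg G a (-z) = Dg G a z := by
  unfold Dg
  rw [sub_neg_eq_add, ← sub_eq_add_neg, mul_comm]

lemma Dg_comm (a x y : ℂ) : Dg G a (x - y) = Dg G a (y - x) := by
  rw [← Dg_neg, neg_sub]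

noncomputable def hQ (b : ℝ) : ℂ := (((b + b⁻¹) / 2 : ℝ) : ℂ) * I

lemma hQ_im : (hQ b).im = (b + b⁻¹) / 2 := by
  unfold hQ; rw [im_ofReal_mul, I_im, mul_one]

lemma Dg_one (hG : GP b G) {a x : ℂ} (h : ∀ z : ℝ, |(a + (z - x)).im| < (b + b⁻¹) / 2)
    (h' : ∀ z : ℝ, |(a - (z - x)).im| < (b + b⁻¹) / 2) : Continuous fun z : ℝ => Dg G a (z - x) := by
  unfold Dg
  rw [continuous_iff_continuousAt]
  intro z
  refine ContinuousAt.mul ?_ ?_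
  · exact ContinuousAt.comp (g := G) (hG.diff _ (h z)).continuousAt (by fun_prop)
  · exact ContinuousAt.comp (g := G) (hG.diff _ (h' z)).continuousAt (by fun_prop)

lemma star3 (hG : GP b G) {c : ℂ} (hc : ∀ p q : Fin 3 → ℂ, TD b p q → Lf G p q = c * Rf b G p q)
    {a1 a2 a3 : ℂ} (x1 x2 x3 : ℝ) (hs : a1 + a2 + a3 = -hQ b - hQ b)
    (h1 : -((b + b⁻¹) / 2) < a1.im) (h2 : -((b + b⁻¹) / 2) < a2.im) (h3 : -((b + b⁻¹) / 2) < a3.im) :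
    ∫ z : ℝ, Dg G a1 (z - x1) * Dg G a2 (z - x2) * Dg G a3 (z - x3) =
    c * (G (2 * a1 + hQ b) * G (2 * a2 + hQ b) * G (2 * a3 + hQ b)) *
      (Dg G (-hQ b - a3) (x1 - x2) * Dg G (-hQ b - a1) (x2 - x3) * Dg G (-hQ b - a2) (x1 - x3)) := by
  have := hc ![a1 - x1, a2 - x2, a3 - x3] ![a1 + x1, a2 + x2, a3 + x3] (by
    refine ⟨?_, ?_, ?_⟩
    · simp only [Matrix.cons_val_zero, Matrix.cons_val_one, Matrix.cons_val]
      unfold hQ at hs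
      push_cast at hs ⊢
      linear_combination 2 * hs
    · intro i; fin_cases i <;> simpa
    · intro i; fin_cases i <;> simpa)
  have e : Lf G ![a1 - x1, a2 - x2, a3 - x3] ![a1 + (x1 : ℂ), a2 + x2, a3 + x3] =
     ∫ z : ℝ, Dg G a1 (z - x1) * Dg G a2 (z - x2) * Dg G a3 (z - x3) := by
    unfold Lf
    congr 1; ext z
    simp only [Lin, Dg, Fin.prod_univ_three, Matrix.cons_val_zero, Matrix.cons_val_one, Matrix.cons_val]
    congr 1
    · congr 1
      · congr 2 <;> ring
      · congr 2 <;> ring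
    · congr 2 <;> ring
  rw [← e, this]
  have k1 : -hQ b - a1 = a2 + a3 + hQ b := by linear_combination -hs
  have k2 : -hQ b - a2 = a1 + a3 + hQ b := by linear_combination -hs
  have k3 : -hQ b - a3 = a1 + a2 + hQ b := by linear_combination -hs
  rw [k1, k2, k3]
  simp only [Rf, Dg, Fin.prod_univ_three, Matrix.cons_val_zero, Matrix.cons_val_one, Matrix.cons_val]
  rw [show (((b + b⁻¹) / 2 : ℝ) : ℂ) * I = hQ b from rfl]
  rw [show a1 - x1 + (a1 + x1) + hQ b = 2 * a1 + hQ b by ring,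
    show a2 - x2 + (a2 + x2) + hQ b = 2 * a2 + hQ b by ring,
    show a3 - x3 + (a3 + x3) + hQ b = 2 * a3 + hQ b by ring,
    show a1 - x1 + (a2 + x2) + hQ b = a1 + a2 + hQ b - (x1 - x2) by ring,
    show a1 - x1 + (a3 + x3) + hQ b = a1 + a3 + hQ b - (x1 - x3) by ring,
    show a2 - x2 + (a1 + x1) + hQ b = a1 + a2 + hQ b + (x1 - x2) by ring,
    show a2 - x2 + (a3 + x3) + hQ b = a2 + a3 + hQ b - (x2 - x3) by ring,
    show a3 - x3 + (a1 + x1) + hQ b = a1 + a3 + hQ b + (x1 - x3) by ring,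
    show a3 - x3 + (a2 + x2) + hQ b = a2 + a3 + hQ b + (x2 - x3) by ring]
  ring

noncomputable def I4 (G : ℂ → ℂ) (a1 a2 a3 a4 : ℂ) (x1 x2 x3 x4 : ℝ) : ℂ :=
  ∫ z : ℝ, Dg G a1 (z - x1) * Dg G a2 (z - x2) * Dg G a3 (z - x3) * Dg G a4 (z - x4)

lemma I4_lin (a1 a2 a3 a4 : ℂ) (x1 x2 x3 x4 z : ℝ) :
    Dg G a1 (z - x1) * Dg G a2 (z - x2) * Dg G a3 (z - x3) * Dg G a4 (z - x4) =
    Lin G ![a1 - x1, a2 - x2, a3 - x3, a4 - x4] ![a1 + x1, a2 + x2, a3 + x3, a4 + x4] z := by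
  simp only [Lin, Dg, Fin.prod_univ_four, Matrix.cons_val_zero, Matrix.cons_val_one, Matrix.cons_val]
  congr 1
  · congr 1
    · congr 1
      · congr 2 <;> ring
      · congr 2 <;> ring
    · congr 2 <;> ring
  · congr 2 <;> ring

lemma I4_int (hG : GP b G) {a1 a2 a3 a4 : ℂ} (x1 x2 x3 x4 : ℝ)
    (h1 : |a1.im| < (b + b⁻¹) / 2) (h2 : |a2.im| < (b + b⁻¹) / 2) (h3 : |a3.im| < (b + b⁻¹) / 2)
    (h4 : |a4.im| < (b + b⁻¹) / 2) (hs : a1.im + a2.im + a3.im + a4.im < 0) :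
    Integrable fun z : ℝ => Dg G a1 (z - x1) * Dg G a2 (z - x2) * Dg G a3 (z - x3) * Dg G a4 (z - x4) := by
  simp_rw [I4_lin]
  refine lin_integrable hG ?_ ?_ ?_
  · intro i; fin_cases i <;> simpa
  · intro i; fin_cases i <;> simpa
  · simp [Fin.sum_univ_four]; linarith

lemma I2_int (hG : GP b G) {a1 a2 : ℂ} (x1 x2 : ℝ)
    (h1 : |a1.im| < (b + b⁻¹) / 2) (h2 : |a2.im| < (b + b⁻¹) / 2) (hs : a1.im + a2.im < 0) :
    Integrable fun z : ℝ => Dg G a1 (z - x1) * Dg G a2 (z - x2) := by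
  have := lin_integrable (ι := Fin 2) hG (p := ![a1 - x1, a2 - x2]) (q := ![a1 + x1, a2 + x2])
    (by intro i; fin_cases i <;> simpa) (by intro i; fin_cases i <;> simpa)
    (by simp [Fin.sum_univ_two]; linarith)
  refine this.congr (Eventually.of_forall fun z => ?_)
  simp only [Lin, Dg, Fin.prod_univ_two, Matrix.cons_val_zero, Matrix.cons_val_one, Matrix.cons_val]
  congr 1
  · congr 2 <;> ring
  · congr 2 <;> ring

lemma I4_cont (hG : GP b G) {a1 a2 a3 a4 : ℂ} (x1 x2 x3 x4 : ℝ) (d1 d2 d3 d4 : ℂ)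
    (h1 : |a1.im| < (b + b⁻¹) / 2) (h2 : |a2.im| < (b + b⁻¹) / 2) (h3 : |a3.im| < (b + b⁻¹) / 2)
    (h4 : |a4.im| < (b + b⁻¹) / 2) (hs : a1.im + a2.im + a3.im + a4.im < 0) :
    ContinuousAt (fun y : ℂ => I4 G (a1 + d1 * y) (a2 + d2 * y) (a3 + d3 * y) (a4 + d4 * y) x1 x2 x3 x4) 0 := by
  have := Lf_holo (ι := Fin 4) hG
    (p := ![fun y => a1 + d1 * y - x1, fun y => a2 + d2 * y - x2, fun y => a3 + d3 * y - x3, fun y => a4 + d4 * y - x4])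
    (q := ![fun y => a1 + d1 * y + x1, fun y => a2 + d2 * y + x2, fun y => a3 + d3 * y + x3, fun y => a4 + d4 * y + x4])
    (y0 := 0) (by intro i; fin_cases i <;> simp <;> fun_prop) (by intro i; fin_cases i <;> simp <;> fun_prop)
    (by intro i; fin_cases i <;> simpa) (by intro i; fin_cases i <;> simpa)
    (by simp [Fin.sum_univ_four]; linarith)
  convert this.continuousAt using 2 with y
  unfold I4 Lf
  simp_rw [I4_lin]
  congr 1

lemma Dg_bdd (hG : GP b G) {a : ℂ} (h1 : -((b + b⁻¹) / 2) < a.im) (h2 : a.im ≤ 0) :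
    ∃ M : ℝ, ∀ x : ℝ, ‖Dg G a x‖ ≤ M := by
  obtain ⟨K, hK, hb⟩ := hG.bound (-a.im) (by linarith)
  refine ⟨K * K, fun x => ?_⟩
  have k : ∀ w : ℂ, w.im = a.im → ‖G w‖ ≤ K := by
    intro w hw
    refine (hb w (by rw [hw, abs_of_nonpos h2])).trans ?_
    refine mul_le_of_le_one_right hK.le (Real.exp_le_one_iff.2 ?_)
    rw [hw]
    have := mul_nonneg Real.pi_pos.le (mul_nonneg (abs_nonneg w.re) (neg_nonneg.2 h2))
    linarith
  unfold Dg
  rw [norm_mul]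
  exact mul_le_mul (k _ (by simp)) (k _ (by simp)) (norm_nonneg _) hK.le

lemma Dg_cont (hG : GP b G) {a : ℂ} (h : |a.im| < (b + b⁻¹) / 2) : Continuous fun x : ℝ => Dg G a x := by
  have := Dg_one hG (a := a) (x := 0) (by simpa using h) (by simpa using h)
  simpa using this

lemma exch_strict (hG : GP b G) {a1 a2 a3 a4 t : ℂ} (A B C E : ℝ)
    (hs : a1 + a2 + a3 + a4 = -hQ b - hQ b) (ht : a1 + a3 = t - hQ b) (htp : 0 < t.im)
    (h1 : -((b + b⁻¹) / 2) < a1.im) (h2 : -((b + b⁻¹) / 2) < a2.im)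
    (h3 : -((b + b⁻¹) / 2) < a3.im) (h4 : -((b + b⁻¹) / 2) < a4.im)
    (n1 : a1.im < 0) (n2 : a2.im < 0) (n3 : a3.im < 0) (n4 : a4.im < 0) :
    Dg G (-t) (A - C) * I4 G a1 a2 a3 a4 A B C E =
    G (2 * a1 + hQ b) * G (2 * a2 + hQ b) * G (2 * a3 + hQ b) * G (2 * a4 + hQ b) *
      (Dg G (-t) (B - E) * I4 G (-hQ b - a3) (-hQ b - a4) (-hQ b - a1) (-hQ b - a2) A B C E) := by
  obtain ⟨c, hc0, hc⟩ := star_triangle hG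
  have hb := hG.hb
  have hbi : 0 < b⁻¹ := inv_pos.2 hb
  have hti := congrArg im ht
  have hsi := congrArg im hs
  simp only [add_im, sub_im, neg_im, hQ_im] at hti hsi
  have abs1 : |a1.im| < (b + b⁻¹) / 2 := by rw [abs_lt]; constructor <;> linarith
  have abs2 : |a2.im| < (b + b⁻¹) / 2 := by rw [abs_lt]; constructor <;> linarith
  have abs3 : |a3.im| < (b + b⁻¹) / 2 := by rw [abs_lt]; constructor <;> linarith
  have abs4 : |a4.im| < (b + b⁻¹) / 2 := by rw [abs_lt]; constructor <;> linarith
  have abst : |(t - hQ b).im| < (b + b⁻¹) / 2 := by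
    rw [sub_im, hQ_im, abs_lt]; constructor <;> linarith
  have i1 : Integrable fun w : ℝ => Dg G (-hQ b - a3) (w - A) * Dg G (-hQ b - a1) (w - C) :=
    I2_int hG A C (by rw [sub_im, neg_im, hQ_im, abs_lt]; constructor <;> linarith)
      (by rw [sub_im, neg_im, hQ_im, abs_lt]; constructor <;> linarith)
      (by simp only [sub_im, neg_im, hQ_im]; linarith)
  have i2 : Integrable fun z : ℝ => Dg G a2 (z - B) * Dg G a4 (z - E) :=
    I2_int hG B E abs2 abs4 (by linarith)
  have s1 : ∀ z : ℝ, ∫ w : ℝ, Dg G (-hQ b - a3) (w - A) * Dg G (-hQ b - a1) (w - C) * Dg G (t - hQ b) (w - z) =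
      c * (G (2 * (-hQ b - a3) + hQ b) * G (2 * (-hQ b - a1) + hQ b) * G (2 * (t - hQ b) + hQ b)) *
      (Dg G (-t) (A - C) * Dg G a3 (z - C) * Dg G a1 (z - A)) := by
    intro z
    rw [star3 hG hc A C z (by linear_combination -ht) (by rw [sub_im, neg_im, hQ_im]; linarith)
      (by rw [sub_im, neg_im, hQ_im]; linarith) (by rw [sub_im, hQ_im]; linarith)]
    rw [show -hQ b - (t - hQ b) = -t by ring, show -hQ b - (-hQ b - a3) = a3 by ring,
      show -hQ b - (-hQ b - a1) = a1 by ring, Dg_comm _ (C : ℂ), Dg_comm _ (A : ℂ) z]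
  have s2 : ∀ w : ℝ, ∫ z : ℝ, Dg G a2 (z - B) * Dg G a4 (z - E) * Dg G (t - hQ b) (z - w) =
      c * (G (2 * a2 + hQ b) * G (2 * a4 + hQ b) * G (2 * (t - hQ b) + hQ b)) *
      (Dg G (-t) (B - E) * Dg G (-hQ b - a2) (w - E) * Dg G (-hQ b - a4) (w - B)) := by
    intro w
    rw [star3 hG hc B E w (by linear_combination hs - ht) h2 h4 (by rw [sub_im, hQ_im]; linarith)]
    rw [show -hQ b - (t - hQ b) = -t by ring, Dg_comm _ (E : ℂ), Dg_comm _ (B : ℂ) w]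
  obtain ⟨M, hM⟩ := Dg_bdd hG (a := t - hQ b) (by rw [sub_im, hQ_im]; linarith) (by rw [sub_im, hQ_im]; linarith)
  have ii : Integrable (Function.uncurry fun (z w : ℝ) => (Dg G a2 (z - B) * Dg G a4 (z - E)) *
      (Dg G (-hQ b - a3) (w - A) * Dg G (-hQ b - a1) (w - C)) * Dg G (t - hQ b) ((z - w : ℝ) : ℂ))
      (volume.prod volume) := by
    refine Integrable.mul_bdd (c := M) (i2.mul_prod i1) ?_ ?_
    · have c1 := Dg_cont hG abst
      have c2 : Continuous fun p : ℝ × ℝ => p.1 - p.2 := by fun_prop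
      exact (c1.comp c2).aestronglyMeasurable
    · exact Eventually.of_forall fun p => hM _
  have sw := integral_integral_swap ii
  have l : ∀ z : ℝ, ∫ w : ℝ, (Dg G a2 (z - B) * Dg G a4 (z - E)) *
      (Dg G (-hQ b - a3) (w - A) * Dg G (-hQ b - a1) (w - C)) * Dg G (t - hQ b) ((z - w : ℝ) : ℂ) =
      (c * (G (2 * (-hQ b - a3) + hQ b) * G (2 * (-hQ b - a1) + hQ b) * G (2 * (t - hQ b) + hQ b)) * Dg G (-t) (A - C)) *
      (Dg G a1 (z - A) * Dg G a2 (z - B) * Dg G a3 (z - C) * Dg G a4 (z - E)) := by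
    intro z
    have : ∀ w : ℝ, (Dg G a2 (z - B) * Dg G a4 (z - E)) *
      (Dg G (-hQ b - a3) (w - A) * Dg G (-hQ b - a1) (w - C)) * Dg G (t - hQ b) ((z - w : ℝ) : ℂ) =
      (Dg G a2 (z - B) * Dg G a4 (z - E)) * (Dg G (-hQ b - a3) (w - A) * Dg G (-hQ b - a1) (w - C) * Dg G (t - hQ b) (w - z)) := by
      intro w
      rw [ofReal_sub, Dg_comm _ (z : ℂ) (w : ℂ)]; ring
    simp_rw [this]
    rw [integral_const_mul, s1]
    ring
  have r : ∀ w : ℝ, ∫ z : ℝ, (Dg G a2 (z - B) * Dg G a4 (z - E)) *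
      (Dg G (-hQ b - a3) (w - A) * Dg G (-hQ b - a1) (w - C)) * Dg G (t - hQ b) ((z - w : ℝ) : ℂ) =
      (c * (G (2 * a2 + hQ b) * G (2 * a4 + hQ b) * G (2 * (t - hQ b) + hQ b)) * Dg G (-t) (B - E)) *
      (Dg G (-hQ b - a3) (w - A) * Dg G (-hQ b - a4) (w - B) * Dg G (-hQ b - a1) (w - C) * Dg G (-hQ b - a2) (w - E)) := by
    intro w
    have : ∀ z : ℝ, (Dg G a2 (z - B) * Dg G a4 (z - E)) *
      (Dg G (-hQ b - a3) (w - A) * Dg G (-hQ b - a1) (w - C)) * Dg G (t - hQ b) ((z - w : ℝ) : ℂ) =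
      (Dg G (-hQ b - a3) (w - A) * Dg G (-hQ b - a1) (w - C)) * (Dg G a2 (z - B) * Dg G a4 (z - E) * Dg G (t - hQ b) (z - w)) := by
      intro z
      rw [ofReal_sub]; ring
    simp_rw [this]
    rw [integral_const_mul, s2]
    ring
  simp_rw [l, r] at sw
  rw [integral_const_mul, integral_const_mul] at sw
  change _ * I4 G a1 a2 a3 a4 A B C E = _ * I4 G (-hQ b - a3) (-hQ b - a4) (-hQ b - a1) (-hQ b - a2) A B C E at sw
  have m1 := hG.neg (2 * a3 + hQ b)
  have m2 := hG.neg (2 * a1 + hQ b)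
  rw [show -(2 * a3 + hQ b) = 2 * (-hQ b - a3) + hQ b by ring] at m1
  rw [show -(2 * a1 + hQ b) = 2 * (-hQ b - a1) + hQ b by ring] at m2
  have g0 := hG.ne (2 * (t - hQ b) + hQ b)
  apply mul_left_cancel₀ (mul_ne_zero hc0 g0)
  generalize G (2 * (t - hQ b) + hQ b) = gt at *
  generalize G (2 * (-hQ b - a3) + hQ b) = g3' at *
  generalize G (2 * (-hQ b - a1) + hQ b) = g1' at *
  generalize G (2 * a1 + hQ b) = g1 at *
  generalize G (2 * a2 + hQ b) = g2 at *
  generalize G (2 * a3 + hQ b) = g3 at *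
  generalize G (2 * a4 + hQ b) = g4 at *
  generalize I4 G a1 a2 a3 a4 A B C E = J1 at *
  generalize I4 G (-hQ b - a3) (-hQ b - a4) (-hQ b - a1) (-hQ b - a2) A B C E = J2 at *
  generalize Dg G (-t) (A - C) = d1 at *
  generalize Dg G (-t) (B - E) = d2 at *
  linear_combination (g1 * g3) * sw - (c * gt * d1 * J1 * g1' * g1) * m1 - (c * gt * d1 * J1) * m2

lemma Dg_contAt (hG : GP b G) {a : ℂ} (d x : ℝ) (e : ℂ) (h : |a.im| < (b + b⁻¹) / 2) :
    ContinuousAt (fun y : ℂ => Dg G (a + e * y) (d - x)) 0 := by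
  unfold Dg
  refine ContinuousAt.mul ?_ ?_
  · exact ContinuousAt.comp (g := G) (hG.diff _ (by simpa using h)).continuousAt (by fun_prop)
  · exact ContinuousAt.comp (g := G) (hG.diff _ (by simpa using h)).continuousAt (by fun_prop)

lemma exch (hG : GP b G) {a1 a2 a3 a4 : ℂ} {t : ℝ} (A B C E : ℝ)
    (hs : a1 + a2 + a3 + a4 = -hQ b - hQ b) (ht : a1 + a3 = t - hQ b)
    (h1 : -((b + b⁻¹) / 2) < a1.im) (h2 : -((b + b⁻¹) / 2) < a2.im)
    (h3 : -((b + b⁻¹) / 2) < a3.im) (h4 : -((b + b⁻¹) / 2) < a4.im)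
    (n1 : a1.im < 0) (n2 : a2.im < 0) (n3 : a3.im < 0) (n4 : a4.im < 0) :
    Dg G (-t) (A - C) * I4 G a1 a2 a3 a4 A B C E =
    G (2 * a1 + hQ b) * G (2 * a2 + hQ b) * G (2 * a3 + hQ b) * G (2 * a4 + hQ b) *
      (Dg G (-t) (B - E) * I4 G (a1 - t) (a2 + t) (a3 - t) (a4 + t) A B C E) := by
  have hb := hG.hb
  have hbi : 0 < b⁻¹ := inv_pos.2 hb
  have hti := congrArg im ht
  have hsi := congrArg im hs
  simp only [add_im, sub_im, neg_im, hQ_im, ofReal_im] at hti hsi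
  have abs1 : |a1.im| < (b + b⁻¹) / 2 := by rw [abs_lt]; constructor <;> linarith
  have abs2 : |a2.im| < (b + b⁻¹) / 2 := by rw [abs_lt]; constructor <;> linarith
  have abs3 : |a3.im| < (b + b⁻¹) / 2 := by rw [abs_lt]; constructor <;> linarith
  have abs4 : |a4.im| < (b + b⁻¹) / 2 := by rw [abs_lt]; constructor <;> linarith
  have e1 : a1 - t = -hQ b - a3 := by linear_combination ht
  have e2 : a2 + t = -hQ b - a4 := by linear_combination hs - ht
  have e3 : a3 - t = -hQ b - a1 := by linear_combination ht
  have e4 : a4 + t = -hQ b - a2 := by linear_combination hs - ht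
  rw [e1, e2, e3, e4]
  have t0 : |(-(t : ℂ)).im| < (b + b⁻¹) / 2 := by simp; positivity
  have cL : ContinuousAt (fun y : ℂ => Dg G (-t + (-I) * y) (A - C) *
      I4 G (a1 + I * y) (a2 + 0 * y) (a3 + 0 * y) (a4 + (-I) * y) A B C E) 0 :=
    (Dg_contAt hG A C _ t0).mul (I4_cont hG A B C E _ _ _ _ abs1 abs2 abs3 abs4 (by linarith))
  have cG : ∀ (a d : ℂ), |a.im| < (b + b⁻¹) / 2 → ContinuousAt (fun y : ℂ => G (a + d * y)) 0 := by
    intro a d h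
    exact ContinuousAt.comp (g := G) (hG.diff _ (by simpa using h)).continuousAt (by fun_prop)
  have hm : ∀ a : ℂ, -((b + b⁻¹) / 2) < a.im → a.im < 0 → |(2 * a + hQ b).im| < (b + b⁻¹) / 2 := by
    intro a ha hb
    rw [abs_lt, add_im, hQ_im]; simp; constructor <;> linarith
  have hm' : ∀ a : ℂ, -((b + b⁻¹) / 2) < a.im → a.im < 0 → |(-hQ b - a).im| < (b + b⁻¹) / 2 := by
    intro a ha hb
    rw [abs_lt, sub_im, neg_im, hQ_im]; constructor <;> linarith
  have cR : ContinuousAt (fun y : ℂ => G (2 * a1 + hQ b + (2 * I) * y) * G (2 * a2 + hQ b + 0 * y) *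
      G (2 * a3 + hQ b + 0 * y) * G (2 * a4 + hQ b + (-2 * I) * y) * (Dg G (-t + (-I) * y) (B - E) *
      I4 G (-hQ b - a3 + 0 * y) (-hQ b - a4 + I * y) (-hQ b - a1 + (-I) * y) (-hQ b - a2 + 0 * y) A B C E)) 0 :=
    ((((cG _ _ (hm _ h1 n1)).mul (cG _ _ (hm _ h2 n2))).mul (cG _ _ (hm _ h3 n3))).mul (cG _ _ (hm _ h4 n4))).mul
      ((Dg_contAt hG B E _ t0).mul (I4_cont hG A B C E _ _ _ _ (hm' _ h3 n3) (hm' _ h4 n4) (hm' _ h1 n1) (hm' _ h2 n2)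
        (by simp only [sub_im, neg_im, hQ_im]; linarith)))
  have tt : Tendsto (fun r : ℝ => (r : ℂ)) (𝓝[>] 0) (𝓝 0) := by
    have := continuous_ofReal.tendsto 0
    rw [ofReal_zero] at this
    exact this.mono_left nhdsWithin_le_nhds
  have TL := cL.tendsto.comp tt
  have TR := cR.tendsto.comp tt
  have := tendsto_nhds_unique_of_eventuallyEq TL TR (by
    have p1 : 0 < -a1.im := by linarith
    have p2 : 0 < a4.im + (b + b⁻¹) / 2 := by linarith
    filter_upwards [Ioo_mem_nhdsGT p1, Ioo_mem_nhdsGT p2] with r hr hr'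
    have := exch_strict hG (a1 := a1 + I * r) (a2 := a2 + 0 * r) (a3 := a3 + 0 * r) (a4 := a4 + (-I) * r)
      (t := t + I * r) A B C E (by linear_combination hs) (by linear_combination ht) (by simpa using hr.1)
      (by simp; linarith [hr.1]) (by simpa using h2) (by simpa using h3) (by simp; linarith [hr'.2])
      (by simp; linarith [hr.2]) (by simpa using n2) (by simpa using n3) (by simp; linarith [hr.1])
    simp only [Function.comp]
    convert this using 2
    · congr 1; ring
    · congr 1
      · congr 1
        · congr 2 <;> ring
        · congr 1; ring
      · congr 1; ring
    · congr 1
      · congr 1; ring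
      · congr 1 <;> ring)
  simpa using this
end

end

section

section
variable {b : ℝ} {G : ℂ → ℂ}

lemma final_of_GP (hG : GP b G) (ε : ℝ)
    (hD : ∀ a z : ℂ, |a.im| + |z.im| < (b + b⁻¹) / 2 → Dfun b ε a z = Dg G a z) (s u v : ℝ)
    (N : ℕ) [NeZero N] (δ : ℝ) (hδ : δ = 1 ∨ δ = -1) (x x' : Fin N → ℝ) :
    Integrable (Vint b ε s N δ x x' u v) ∧
    Integrable (Vint b ε s N δ x x' v u) ∧
      ∫ z : Fin N → ℝ, Vint b ε s N δ x x' u v z =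
        (Dfun b ε ((s : ℝ) : ℂ) ((u : ℝ) : ℂ) *
            Dfun b ε (-((s : ℝ) : ℂ)) ((v : ℝ) : ℂ)) ^ N *
          ∫ z : Fin N → ℝ, Vint b ε s N δ x x' v u z := by
  have hb := hG.hb
  have hbi : 0 < b⁻¹ := inv_pos.2 hb
  let f : ℝ → ℝ → Fin N → ℝ → ℂ := fun u v r z =>
    Dg G (-((((u - s) / 2 : ℝ) : ℂ)) - Complex.I * (((b + b⁻¹) : ℝ) : ℂ) / 4) (z - ((δ * x (r + 1) : ℝ) : ℂ)) *
    Dg G ((((u + s) / 2 : ℝ) : ℂ) - Complex.I * (((b + b⁻¹) : ℝ) : ℂ) / 4) (z - x r) *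
    Dg G ((((v - s) / 2 : ℝ) : ℂ) - Complex.I * (((b + b⁻¹) : ℝ) : ℂ) / 4) (z - ((δ * x' (r + 1) : ℝ) : ℂ)) *
    Dg G (-((((v + s) / 2 : ℝ) : ℂ)) - Complex.I * (((b + b⁻¹) : ℝ) : ℂ) / 4) (z - x' r)
  have im1 : ∀ w : ℝ, ((w : ℂ) - Complex.I * (((b + b⁻¹) : ℝ) : ℂ) / 4).im = -((b + b⁻¹) / 4) := by
    intro w
    rw [show (w : ℂ) - Complex.I * (((b + b⁻¹) : ℝ) : ℂ) / 4 = (w : ℂ) - (((b + b⁻¹) / 4 : ℝ) : ℂ) * I by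
      push_cast; ring, sub_im, ofReal_im, im_ofReal_mul, I_im]
    ring
  have im2 : ∀ w : ℝ, (-(w : ℂ) - Complex.I * (((b + b⁻¹) : ℝ) : ℂ) / 4).im = -((b + b⁻¹) / 4) := by
    intro w
    have := im1 (-w)
    rwa [ofReal_neg] at this
  have ab : |-((b + b⁻¹) / 4)| < (b + b⁻¹) / 2 := by
    rw [abs_neg, abs_of_pos (by positivity)]; linarith
  have e1 : ∀ w z : ℝ, ∀ y : ℝ, Dfun b ε (w - Complex.I * (((b + b⁻¹) : ℝ) : ℂ) / 4) (z - y) =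
      Dg G (w - Complex.I * (((b + b⁻¹) : ℝ) : ℂ) / 4) (z - y) := by
    intro w z y
    refine hD _ _ ?_
    rw [im1]
    simpa using ab
  have e2 : ∀ w z : ℝ, ∀ y : ℝ, Dfun b ε (-w - Complex.I * (((b + b⁻¹) : ℝ) : ℂ) / 4) (z - y) =
      Dg G (-w - Complex.I * (((b + b⁻¹) : ℝ) : ℂ) / 4) (z - y) := by
    intro w z y
    have := e1 (-w) z y
    rwa [ofReal_neg] at this
  have hV : ∀ u v, Vint b ε s N δ x x' u v = fun z => ∏ r, f u v r (z r) := by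
    intro u v
    ext z
    unfold Vint
    refine Finset.prod_congr rfl fun r _ => ?_
    simp only [f, ← ofReal_mul, e1, e2]
  have hi : ∀ u v r, Integrable (f u v r) := by
    intro u v r
    refine I4_int hG _ _ _ _ ?_ ?_ ?_ ?_ ?_ <;> simp only [im1, im2] <;> first | exact ab | linarith
  have hV' : ∀ u v, ∫ z : Fin N → ℝ, Vint b ε s N δ x x' u v z = ∏ r, ∫ z, f u v r z := by
    intro u v
    rw [hV, integral_fintype_prod_volume_eq_prod]
  refine ⟨?_, ?_, ?_⟩
  · rw [hV]; exact Integrable.fintype_prod (hi u v)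
  · rw [hV]; exact Integrable.fintype_prod (hi v u)
  rw [hV', hV', hD _ _ (by simp; positivity), hD _ _ (by simp; positivity)]
  set t : ℝ := (v - u) / 2 with ht
  set P := Dg G s u * Dg G (-s) v with hP
  have key : ∀ r, Dg G (-t) (x (r + 1) - x' (r + 1)) * ∫ z, f u v r z =
      (P * Dg G (-t) (x r - x' r)) * ∫ z, f v u r z := by
    intro r
    have := exch hG (a1 := -((((u - s) / 2 : ℝ) : ℂ)) - Complex.I * (((b + b⁻¹) : ℝ) : ℂ) / 4)
      (a2 := (((u + s) / 2 : ℝ) : ℂ) - Complex.I * (((b + b⁻¹) : ℝ) : ℂ) / 4)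
      (a3 := (((v - s) / 2 : ℝ) : ℂ) - Complex.I * (((b + b⁻¹) : ℝ) : ℂ) / 4)
      (a4 := -((((v + s) / 2 : ℝ) : ℂ)) - Complex.I * (((b + b⁻¹) : ℝ) : ℂ) / 4) (t := t)
      (δ * x (r + 1)) (x r) (δ * x' (r + 1)) (x' r)
      (by unfold hQ; push_cast; ring) (by unfold hQ; rw [ht]; push_cast; ring)
      (by rw [im2]; linarith) (by rw [im1]; linarith) (by rw [im1]; linarith) (by rw [im2]; linarith)
      (by rw [im2]; linarith) (by rw [im1]; linarith) (by rw [im1]; linarith) (by rw [im2]; linarith)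
    have d1 : Dg G (-t) (((δ * x (r + 1) : ℝ) : ℂ) - ((δ * x' (r + 1) : ℝ) : ℂ)) =
        Dg G (-t) (x (r + 1) - x' (r + 1)) := by
      rcases hδ with h | h
      · rw [h]; simp
      · rw [h, ← Dg_neg]; congr 1; push_cast; ring
    rw [d1] at this
    have q1 : 2 * (-((((u - s) / 2 : ℝ) : ℂ)) - Complex.I * (((b + b⁻¹) : ℝ) : ℂ) / 4) + hQ b = s - u := by
      unfold hQ; push_cast; ring
    have q2 : 2 * ((((u + s) / 2 : ℝ) : ℂ) - Complex.I * (((b + b⁻¹) : ℝ) : ℂ) / 4) + hQ b = s + u := by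
      unfold hQ; push_cast; ring
    have q3 : 2 * ((((v - s) / 2 : ℝ) : ℂ) - Complex.I * (((b + b⁻¹) : ℝ) : ℂ) / 4) + hQ b = -s + v := by
      unfold hQ; push_cast; ring
    have q4 : 2 * (-((((v + s) / 2 : ℝ) : ℂ)) - Complex.I * (((b + b⁻¹) : ℝ) : ℂ) / 4) + hQ b = -s - v := by
      unfold hQ; push_cast; ring
    rw [q1, q2, q3, q4,
      show -((((u - s) / 2 : ℝ) : ℂ)) - Complex.I * (((b + b⁻¹) : ℝ) : ℂ) / 4 - t =
        -((((v - s) / 2 : ℝ) : ℂ)) - Complex.I * (((b + b⁻¹) : ℝ) : ℂ) / 4 by rw [ht]; push_cast; ring,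
      show (((u + s) / 2 : ℝ) : ℂ) - Complex.I * (((b + b⁻¹) : ℝ) : ℂ) / 4 + t =
        (((v + s) / 2 : ℝ) : ℂ) - Complex.I * (((b + b⁻¹) : ℝ) : ℂ) / 4 by rw [ht]; push_cast; ring,
      show (((v - s) / 2 : ℝ) : ℂ) - Complex.I * (((b + b⁻¹) : ℝ) : ℂ) / 4 - t =
        (((u - s) / 2 : ℝ) : ℂ) - Complex.I * (((b + b⁻¹) : ℝ) : ℂ) / 4 by rw [ht]; push_cast; ring,
      show -((((v + s) / 2 : ℝ) : ℂ)) - Complex.I * (((b + b⁻¹) : ℝ) : ℂ) / 4 + t =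
        -((((u + s) / 2 : ℝ) : ℂ)) - Complex.I * (((b + b⁻¹) : ℝ) : ℂ) / 4 by rw [ht]; push_cast; ring] at this
    refine Eq.trans this ?_
    simp only [hP, I4, f, Dg]
    ring
  have hprod := Finset.prod_congr (rfl : (Finset.univ : Finset (Fin N)) = _) fun r _ => key r
  simp only [Finset.prod_mul_distrib, Finset.prod_const, Finset.card_univ, Fintype.card_fin] at hprod
  have hre : ∏ r : Fin N, Dg G (-t) (x (r + 1) - x' (r + 1)) = ∏ r : Fin N, Dg G (-t) (x r - x' r) :=
    Equiv.prod_comp (Equiv.addRight (1 : Fin N)) (fun r => Dg G (-t) (x r - x' r))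
  rw [hre] at hprod
  have hne : ∏ r : Fin N, Dg G (-t) (x r - x' r) ≠ 0 :=
    Finset.prod_ne_zero_iff.2 fun r _ => mul_ne_zero (hG.ne _) (hG.ne _)
  apply mul_left_cancel₀ hne
  linear_combination hprod
end

end

section

lemma normSq_sinh (z : ℂ) : ‖sinh z‖ ^ 2 = Real.sinh z.re ^ 2 + Real.sin z.im ^ 2 := by
  have e : sinh z = ((Real.sinh z.re * Real.cos z.im : ℝ) : ℂ) +
      ((Real.cosh z.re * Real.sin z.im : ℝ) : ℂ) * I := by
    conv_lhs => rw [← re_add_im z]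
    rw [sinh_add, sinh_mul_I, cosh_mul_I]
    push_cast
    ring
  rw [← normSq_eq_norm_sq, e, normSq_add_mul_I]
  have h1 := Real.cosh_sq z.re
  have h2 := Real.sin_sq_add_cos_sq z.im
  have h3 : Real.cos z.im ^ 2 = 1 - Real.sin z.im ^ 2 := by linarith
  rw [mul_pow, mul_pow, h1, h3]; ring

lemma norm_sinh_ge_re (z : ℂ) : |Real.sinh z.re| ≤ ‖sinh z‖ := by
  refine abs_le_of_sq_le_sq' ?_ (norm_nonneg _) |> fun h => abs_le.2 h
  rw [normSq_sinh]; nlinarith [sq_nonneg (Real.sin z.im)]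

lemma norm_sinh_ge_im (z : ℂ) : |Real.sin z.im| * Real.cosh z.re ≤ ‖sinh z‖ := by
  refine abs_le_of_sq_le_sq' (b := ‖sinh z‖) ?_ (norm_nonneg _) |>.2
  rw [normSq_sinh, mul_pow, sq_abs, Real.cosh_sq]
  nlinarith [sq_nonneg (Real.sinh z.re), Real.sin_sq_le_one z.im]

lemma sinh_ne_zero' {z : ℂ} (h1 : |z.im| < Real.pi) (h0 : z ≠ 0) : sinh z ≠ 0 := by
  intro h
  have h2 := normSq_sinh z
  rw [h, norm_zero] at h2
  have h3 : Real.sinh z.re = 0 := by nlinarith [sq_nonneg (Real.sin z.im), sq_nonneg (Real.sinh z.re)]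
  have h4 : Real.sin z.im = 0 := by nlinarith [sq_nonneg (Real.sin z.im), sq_nonneg (Real.sinh z.re)]
  rw [Real.sinh_eq_zero] at h3
  rw [abs_lt] at h1
  rw [Real.sin_eq_zero_iff_of_lt_of_lt h1.1 h1.2] at h4
  exact h0 (Complex.ext h3 h4)

lemma inv_sinh_im (z : ℂ) (h : Real.sin z.im ≠ 0) :
    ‖(sinh z)⁻¹‖ ≤ 2 / |Real.sin z.im| * Real.exp (-|z.re|) := by
  have h1 := norm_sinh_ge_im z
  have hs : 0 < |Real.sin z.im| := abs_pos.2 h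
  have h2 : Real.exp |z.re| / 2 ≤ Real.cosh z.re := by
    rw [← Real.cosh_abs, Real.cosh_eq]
    linarith [Real.exp_pos (-|z.re|)]
  have h3 : |Real.sin z.im| * (Real.exp |z.re| / 2) ≤ ‖sinh z‖ :=
    (mul_le_mul_of_nonneg_left h2 hs.le).trans h1
  rw [norm_inv, Real.exp_neg]
  have h4 : 2 / |Real.sin z.im| * (Real.exp |z.re|)⁻¹ = (|Real.sin z.im| * (Real.exp |z.re| / 2))⁻¹ := by
    have := Real.exp_pos |z.re|
    field_simp
  rw [h4]
  have := Real.exp_pos |z.re|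
  exact inv_anti₀ (by positivity) h3

lemma inv_sinh_re (z : ℂ) (h : z.re ≠ 0) :
    ‖(sinh z)⁻¹‖ ≤ Real.exp (-|z.re|) * (2 + |z.re|⁻¹) := by
  have h1 := norm_sinh_ge_re z
  rw [Real.abs_sinh] at h1
  have hy : 0 < |z.re| := abs_pos.2 h
  set y := |z.re|
  have hs : 0 < Real.sinh y := Real.sinh_pos_iff.2 hy
  rw [norm_inv]
  refine (inv_anti₀ hs h1).trans ?_
  rw [inv_le_iff_one_le_mul₀ hs, Real.sinh_eq]
  have e1 : Real.exp (-y) * Real.exp y = 1 := by rw [← Real.exp_add]; simp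
  have e2 : Real.exp (-y) * Real.exp (-y) * (1 + 2 * y) ≤ 1 := by
    have : 1 + 2 * y ≤ Real.exp y * Real.exp y := by
      rw [← Real.exp_add]; linarith [Real.add_one_le_exp (y + y)]
    calc _ ≤ Real.exp (-y) * Real.exp (-y) * (Real.exp y * Real.exp y) := by gcongr
      _ = (Real.exp (-y) * Real.exp y) ^ 2 := by ring
      _ = 1 := by rw [e1]; norm_num
  have e3 : Real.exp (-y) * (2 + y⁻¹) * ((Real.exp y - Real.exp (-y)) / 2)
    = (1 - Real.exp (-y) * Real.exp (-y)) * (2 + y⁻¹) / 2 := by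
      linear_combination (2 + y⁻¹) / 2 * e1
  rw [e3]
  set q := Real.exp (-y) * Real.exp (-y)
  have e4 : (1 - q) * (2 + y⁻¹) / 2 = (1 - q) * (1 + 2 * y) / (2 * y) := by field_simp; ring
  rw [e4, le_div_iff₀ (by positivity)]
  nlinarith

noncomputable def Tf (ε : ℝ) (f : ℝ → ℂ) (w : ℂ) : ℂ :=
  ∫ x : ℝ, f x * exp (2 * I * (x + ε * I) * w)

lemma norm_kern (ε x : ℝ) (w : ℂ) : ‖exp (2 * I * (x + ε * I) * w)‖ ≤
    Real.exp (-2 * ε * w.re) * Real.exp (2 * |w.im| * |x|) := by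
  rw [norm_exp, ← Real.exp_add]
  apply Real.exp_le_exp.2
  have : (2 * I * (x + ε * I) * w).re = -2 * ε * w.re - 2 * (x * w.im) := by
    simp; ring
  rw [this]
  have h := neg_abs_le (x * w.im)
  rw [abs_mul] at h
  linarith

lemma Tf_int {ε : ℝ} {f : ℝ → ℂ} {C κ : ℝ} (hf : Continuous f)
    (hb : ∀ x, ‖f x‖ ≤ C * Real.exp (-κ * |x|)) {w : ℂ} (hw : |w.im| < κ / 2) :
    Integrable fun x : ℝ => f x * exp (2 * I * (x + ε * I) * w) := by
  refine Integrable.mono' ((integrable_exp_abs (c := 2 * |w.im| - κ) (by linarith)).const_mul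
    (C * Real.exp (-2 * ε * w.re))) (by fun_prop) (Eventually.of_forall fun x => ?_)
  rw [norm_mul]
  calc _ ≤ (C * Real.exp (-κ * |x|)) * (Real.exp (-2 * ε * w.re) * Real.exp (2 * |w.im| * |x|)) :=
        mul_le_mul (hb x) (norm_kern _ _ _) (norm_nonneg _) ((norm_nonneg _).trans (hb x))
    _ = C * Real.exp (-2 * ε * w.re) * (Real.exp (-κ * |x|) * Real.exp (2 * |w.im| * |x|)) := by ring
    _ = _ := by rw [← Real.exp_add]; ring_nf

lemma Tf_bound {ε : ℝ} {f : ℝ → ℂ} {C κ : ℝ}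
    (hb : ∀ x, ‖f x‖ ≤ C * Real.exp (-κ * |x|)) {ρ : ℝ} (hρ : ρ < κ / 2) :
    ∃ M : ℝ, ∀ w : ℂ, |w.im| ≤ ρ → ‖Tf ε f w‖ ≤ M * Real.exp (-2 * ε * w.re) := by
  refine ⟨C * ∫ x : ℝ, Real.exp ((2 * ρ - κ) * |x|), fun w hw => ?_⟩
  have hi := (integrable_exp_abs (c := 2 * ρ - κ) (by linarith)).const_mul
    (C * Real.exp (-2 * ε * w.re))
  have := norm_integral_le_of_norm_le (f := fun x : ℝ => f x * exp (2 * I * (x + ε * I) * w)) hi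
    (Eventually.of_forall fun x => ?_)
  · rw [integral_const_mul] at this
    unfold Tf
    refine this.trans (le_of_eq (by ring))
  · have hC : 0 ≤ C := by
      have := (norm_nonneg _).trans (hb 0)
      simpa using this
    rw [norm_mul]
    calc _ ≤ (C * Real.exp (-κ * |x|)) * (Real.exp (-2 * ε * w.re) * Real.exp (2 * |w.im| * |x|)) :=
          mul_le_mul (hb x) (norm_kern _ _ _) (norm_nonneg _) ((norm_nonneg _).trans (hb x))
      _ ≤ (C * Real.exp (-κ * |x|)) * (Real.exp (-2 * ε * w.re) * Real.exp (2 * ρ * |x|)) := by gcongr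
      _ = C * Real.exp (-2 * ε * w.re) * (Real.exp (-κ * |x|) * Real.exp (2 * ρ * |x|)) := by ring
      _ = _ := by rw [← Real.exp_add]; ring_nf

lemma Tf_deriv {ε : ℝ} (hε : 0 < ε) {f : ℝ → ℂ} {C C' κ : ℝ} (hf : Continuous f)
    (hb : ∀ x, ‖f x‖ ≤ C * Real.exp (-κ * |x|))
    (hb' : ∀ x : ℝ, ‖2 * I * (x + ε * I) * f x‖ ≤ C' * Real.exp (-κ * |x|))
    {w : ℂ} (hw : |w.im| < κ / 2) :
    HasDerivAt (Tf ε f) (Tf ε (fun x : ℝ => 2 * I * (x + ε * I) * f x) w) w := by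
  obtain ⟨ρ, h1, h2⟩ := exists_between hw
  have hC : 0 ≤ C' := by
    have := (norm_nonneg _).trans (hb' 0)
    simpa using this
  have := (hasDerivAt_integral_of_dominated_loc_of_deriv_le (𝕜 := ℂ) (μ := volume) (x₀ := w)
    (F := fun w (x : ℝ) => f x * exp (2 * I * (x + ε * I) * w))
    (F' := fun w (x : ℝ) => (2 * I * (x + ε * I) * f x) * exp (2 * I * (x + ε * I) * w))
    (s := Metric.ball w (ρ - |w.im|))
    (bound := fun x => C' * Real.exp (2 * ε * (|w.re| + ρ)) * Real.exp ((2 * ρ - κ) * |x|))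
    (Metric.ball_mem_nhds _ (by linarith)) ?_ (Tf_int hf hb hw) ?_ ?_ ?_ ?_).2
  · exact this
  · exact Eventually.of_forall fun y => by fun_prop
  · fun_prop
  · refine Eventually.of_forall fun x y hy => ?_
    rw [Metric.mem_ball, dist_eq] at hy
    have i1 : |y.im| ≤ ρ := by
      have a1 := abs_im_le_norm (y - w)
      have a2 := abs_sub_abs_le_abs_sub y.im w.im
      rw [sub_im] at a1; linarith
    have i2 : -y.re ≤ |w.re| + ρ := by
      have a1 := abs_re_le_norm (y - w)
      have a2 := neg_abs_le (y - w).re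
      have a3 := neg_abs_le w.re
      have := abs_nonneg w.im
      rw [sub_re] at a2; rw [sub_re] at a1; linarith
    rw [norm_mul]
    calc _ ≤ (C' * Real.exp (-κ * |x|)) * (Real.exp (-2 * ε * y.re) * Real.exp (2 * |y.im| * |x|)) :=
          mul_le_mul (hb' x) (norm_kern _ _ _) (norm_nonneg _) ((norm_nonneg _).trans (hb' x))
      _ ≤ (C' * Real.exp (-κ * |x|)) * (Real.exp (2 * ε * (|w.re| + ρ)) * Real.exp (2 * ρ * |x|)) := by
          have : -2 * ε * y.re ≤ 2 * ε * (|w.re| + ρ) := by nlinarith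
          gcongr
      _ = C' * Real.exp (2 * ε * (|w.re| + ρ)) * (Real.exp (-κ * |x|) * Real.exp (2 * ρ * |x|)) := by ring
      _ = _ := by rw [← Real.exp_add]; ring_nf
  · exact (integrable_exp_abs (by linarith)).const_mul _
  · refine Eventually.of_forall fun x y hy => ?_
    have h0 : HasDerivAt (fun y : ℂ => 2 * I * (x + ε * I) * y) (2 * I * (x + ε * I)) y := by
      simpa using (hasDerivAt_id y).const_mul (2 * I * (x + ε * I))
    have h3 := (h0.cexp).const_mul (f x)
    have e : f x * (exp (2 * I * (x + ε * I) * y) * (2 * I * (x + ε * I))) =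
      (2 * I * (x + ε * I) * f x) * exp (2 * I * (x + ε * I) * y) := by ring
    rw [e] at h3
    exact h3

end

section

noncomputable def shc : ℂ → ℂ := dslope sinh 0
noncomputable def snc : ℂ → ℂ := dslope sin 0

lemma shc_diff : Differentiable ℂ shc := by
  rw [← differentiableOn_univ]
  exact (Complex.differentiableOn_dslope Filter.univ_mem).2 differentiable_sinh.differentiableOn
lemma snc_diff : Differentiable ℂ snc := by
  rw [← differentiableOn_univ]
  exact (Complex.differentiableOn_dslope Filter.univ_mem).2 differentiable_sin.differentiableOn
lemma shc_zero : shc 0 = 1 := by simp [shc]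
lemma snc_zero : snc 0 = 1 := by simp [snc]
lemma mul_shc (z : ℂ) : sinh z = z * shc z := by
  have := sub_smul_dslope sinh 0 z
  simpa [shc] using this.symm
lemma mul_snc (z : ℂ) : sin z = z * snc z := by
  have := sub_smul_dslope sin 0 z
  simpa [snc] using this.symm
lemma shc_ne {z : ℂ} (h : |z.im| < Real.pi) : shc z ≠ 0 := by
  by_cases h0 : z = 0
  · rw [h0, shc_zero]; exact one_ne_zero
  · intro h1
    have := sinh_ne_zero' h h0
    rw [mul_shc, h1, mul_zero] at this
    exact this rfl

lemma tend_two {c : ℝ} (hc : 0 < c) : Tendsto (fun x : ℝ => 2 + |c * x|⁻¹) atTop (𝓝 2) ∧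
    Tendsto (fun x : ℝ => 2 + |c * x|⁻¹) atBot (𝓝 2) := by
  constructor
  · have h := (tendsto_abs_atTop_atTop.comp (tendsto_id.const_mul_atTop hc)).inv_tendsto_atTop
    simpa using h.const_add (2 : ℝ)
  · have h := (tendsto_abs_atBot_atTop.comp (tendsto_id.const_mul_atBot hc)).inv_tendsto_atTop
    simpa using h.const_add (2 : ℝ)

lemma inv_sinh_line {c : ℝ} (hc : 0 < c) (x y : ℝ) (hx : x ≠ 0) :
    ‖(sinh (c * (x + y * I)))⁻¹‖ ≤ Real.exp (-c * |x|) * (2 + |c * x|⁻¹) := by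
  have e : ((c : ℂ) * (x + y * I)).re = c * x := by simp
  have := inv_sinh_re ((c : ℂ) * (x + y * I)) (by rw [e]; positivity)
  rw [e] at this
  rwa [abs_mul c x, abs_of_pos hc, ← neg_mul, ← abs_of_pos hc, ← abs_mul, abs_of_pos hc] at this

noncomputable def Sc (ε c : ℝ) (x : ℝ) : ℂ := (sinh (c * (x + ε * I)))⁻¹

section
variable {ε c : ℝ}

lemma tau_ne (hε : 0 < ε) (x : ℝ) : (x : ℂ) + ε * I ≠ 0 := fun h => hε.ne' (by simpa using congrArg im h)

lemma Sc_cont (hε : 0 < ε) (hc : 0 < c) (h : c * ε < Real.pi) : Continuous (Sc ε c) := by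
  unfold Sc
  refine Continuous.inv₀ (continuous_sinh.comp (by fun_prop)) fun x => sinh_ne_zero' ?_ ?_
  · simp only [mul_im, ofReal_re, ofReal_im, add_im, I_re, I_im]
    rw [abs_lt]; constructor <;> nlinarith [Real.pi_pos, mul_pos hc hε]
  · exact mul_ne_zero (by exact_mod_cast hc.ne') (tau_ne hε x)

lemma Sc_bound (hε : 0 < ε) (hc : 0 < c) (h : c * ε < Real.pi) :
    ∃ C : ℝ, ∀ x, ‖Sc ε c x‖ ≤ C * Real.exp (-c * |x|) := by
  refine ⟨2 / |Real.sin (c * ε)|, fun x => ?_⟩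
  have e1 : ((c : ℂ) * (x + ε * I)).re = c * x := by simp
  have e2 : ((c : ℂ) * (x + ε * I)).im = c * ε := by simp
  have := inv_sinh_im ((c : ℂ) * (x + ε * I)) (by
    rw [e2]; exact (Real.sin_pos_of_pos_of_lt_pi (mul_pos hc hε) h).ne')
  rw [e1, e2, abs_mul, abs_of_pos hc, ← neg_mul] at this
  exact this

lemma E_formula (hε : 0 < ε) (hc : 0 < c) (h : c * ε < Real.pi) {w : ℂ} (hw : |w.im| < c / 2) :
    (1 + exp (2 * Real.pi * w / c)) * Tf ε (Sc ε c) w = - (2 * Real.pi * I / c) := by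
  have hc' : (c : ℂ) ≠ 0 := by exact_mod_cast hc.ne'
  have hpc : ε < Real.pi / c := by rw [lt_div_iff₀ hc]; linarith
  obtain ⟨C, hC⟩ := Sc_bound hε hc h
  have hint := Tf_int (ε := ε) (Sc_cont hε hc h) hC hw
  set y1 : ℝ := ε - Real.pi / c with hy1
  have hline : ∀ x : ℝ, exp (2 * I * (x + y1 * I) * w) / sinh (c * (x + y1 * I)) =
      - exp (2 * Real.pi * w / c) * (Sc ε c x * exp (2 * I * (x + ε * I) * w)) := by
    intro x
    have e1 : (c : ℂ) * (x + y1 * I) = c * (x + ε * I) - Real.pi * I := by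
      rw [hy1]; push_cast; field_simp; ring
    have e2 : 2 * I * (x + y1 * I) * w = 2 * Real.pi * w / c + 2 * I * (x + ε * I) * w := by
      rw [hy1]; push_cast; field_simp; linear_combination (-(Real.pi : ℂ) * w) * I_sq
    rw [e1, e2, exp_add, sinh_sub, cosh_mul_I, sinh_mul_I]
    simp only [← ofReal_cos, ← ofReal_sin, Real.cos_pi, Real.sin_pi, Sc]
    simp
    ring
  have key := residue_strip (h := fun τ => exp (2 * I * τ * w) / (c * shc (c * τ)))
    (g := fun τ => exp (2 * I * τ * w) / sinh (c * τ)) (y1 := y1) (y2 := ε) (by linarith) hε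
    (U := {τ | |(c * τ).im| < Real.pi}) ?_ ?_ ?_ ?_
    (m := fun x => (Real.exp (2 * (Real.pi / c) * |w.re|) * Real.exp ((2 * |w.im| - c) * |x|)) *
      (2 + |c * x|⁻¹)) ?_ ?_ ?_ ?_ ?_
  · simp only [hline, integral_const_mul] at key
    have e : ∫ x : ℝ, exp (2 * I * (x + ε * I) * w) / sinh (c * (x + ε * I)) = Tf ε (Sc ε c) w := by
      unfold Tf Sc
      congr 1; ext x; rw [div_eq_mul_inv, mul_comm]
    rw [e] at key
    simp only [mul_zero, zero_mul, exp_zero, shc_zero, mul_one] at key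
    unfold Tf at key ⊢
    linear_combination -key
  · exact isOpen_lt (by fun_prop) (by fun_prop)
  · intro τ h1 h2
    have : ((c : ℂ) * τ).im = c * τ.im := by simp
    simp only [Set.mem_ofPred_eq, this]
    rw [abs_lt]
    have hcp : c * (Real.pi / c) = Real.pi := by field_simp
    constructor
    · nlinarith [mul_pos hc hε]
    · nlinarith
  · intro τ hτ
    refine DifferentiableAt.differentiableWithinAt ?_
    refine DifferentiableAt.div (by fun_prop) ?_ (mul_ne_zero hc' (shc_ne hτ))
    exact ((shc_diff _).comp τ (by fun_prop : DifferentiableAt ℂ (fun τ : ℂ => (c : ℂ) * τ) τ)).const_mul _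
  · intro τ hτ h0
    have := shc_ne hτ
    simp only [mul_shc (c * τ)]
    field_simp
  · simpa using ((tendsto_exp_abs (c := 2 * |w.im| - c) (by linarith) _).1.mul (tend_two hc).1)
  · simpa using ((tendsto_exp_abs (c := 2 * |w.im| - c) (by linarith) _).2.mul (tend_two hc).2)
  · intro x y hx h1 h2
    have a1 := inv_sinh_line hc x y hx
    have a2 := norm_kern y x w
    have a3 : -2 * y * w.re ≤ 2 * (Real.pi / c) * |w.re| := by
      have : |y| ≤ Real.pi / c := by rw [abs_le]; constructor <;> linarith
      have a4 := neg_abs_le (y * w.re)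
      rw [abs_mul] at a4
      nlinarith [mul_le_mul_of_nonneg_right this (abs_nonneg w.re)]
    rw [div_eq_mul_inv, norm_mul]
    calc _ ≤ (Real.exp (-2 * y * w.re) * Real.exp (2 * |w.im| * |x|)) *
          (Real.exp (-c * |x|) * (2 + |c * x|⁻¹)) := mul_le_mul a2 a1 (norm_nonneg _) (by positivity)
      _ ≤ (Real.exp (2 * (Real.pi / c) * |w.re|) * Real.exp (2 * |w.im| * |x|)) *
          (Real.exp (-c * |x|) * (2 + |c * x|⁻¹)) := by gcongr
      _ = Real.exp (2 * (Real.pi / c) * |w.re|) * (Real.exp (2 * |w.im| * |x|) *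
          Real.exp (-c * |x|)) * (2 + |c * x|⁻¹) := by ring
      _ = _ := by rw [← Real.exp_add]; ring_nf
  · simp only [hline]
    exact hint.const_mul _
  · refine hint.congr (Eventually.of_forall fun x => ?_)
    simp only [Sc]
    rw [div_eq_mul_inv, mul_comm]
end

end

section

noncomputable def FF (b ε : ℝ) (x : ℝ) : ℂ := (4 * (x + ε * I))⁻¹ * Sc ε b x * Sc ε b⁻¹ x
noncomputable def JJ (b ε : ℝ) : ℂ → ℂ := Tf ε (FF b ε)
noncomputable def GG (b ε : ℝ) (w : ℂ) : ℂ := exp ((JJ b ε w - JJ b ε (-w)) / 2)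

section
variable {b ε : ℝ}

lemma norm_tau_inv (hε : 0 < ε) (x : ℝ) : ‖((x : ℂ) + ε * I)⁻¹‖ ≤ ε⁻¹ := by
  rw [norm_inv]
  refine inv_anti₀ hε ?_
  have := abs_im_le_norm ((x : ℂ) + ε * I)
  simp only [add_im, ofReal_im, mul_im, I_re, I_im, ofReal_re, mul_one, mul_zero, zero_add, add_zero,
    abs_of_pos hε] at this
  exact this

lemma tau_inv_cont (hε : 0 < ε) : Continuous fun x : ℝ => ((x : ℂ) + ε * I)⁻¹ :=
  Continuous.inv₀ (by fun_prop) (tau_ne hε)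

lemma SS_bound (hb : 0 < b) (hε : 0 < ε) (h1 : b * ε < Real.pi) (h2 : b⁻¹ * ε < Real.pi) :
    ∃ C : ℝ, 0 ≤ C ∧ ∀ x, ‖Sc ε b x * Sc ε b⁻¹ x‖ ≤ C * Real.exp (-(b + b⁻¹) * |x|) := by
  obtain ⟨C1, hC1⟩ := Sc_bound hε hb h1
  obtain ⟨C2, hC2⟩ := Sc_bound hε (inv_pos.2 hb) h2
  have p1 : 0 ≤ C1 := by simpa using (norm_nonneg _).trans (hC1 0)
  have p2 : 0 ≤ C2 := by simpa using (norm_nonneg _).trans (hC2 0)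
  refine ⟨C1 * C2, by positivity, fun x => ?_⟩
  rw [norm_mul]
  calc _ ≤ (C1 * Real.exp (-b * |x|)) * (C2 * Real.exp (-b⁻¹ * |x|)) :=
        mul_le_mul (hC1 x) (hC2 x) (norm_nonneg _) (by positivity)
    _ = C1 * C2 * (Real.exp (-b * |x|) * Real.exp (-b⁻¹ * |x|)) := by ring
    _ = _ := by rw [← Real.exp_add]; ring_nf

lemma FF_cont (hb : 0 < b) (hε : 0 < ε) (h1 : b * ε < Real.pi) (h2 : b⁻¹ * ε < Real.pi) :
    Continuous (FF b ε) := by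
  unfold FF
  refine (Continuous.mul ?_ (Sc_cont hε hb h1)).mul (Sc_cont hε (inv_pos.2 hb) h2)
  simp only [mul_inv]
  exact (tau_inv_cont hε).const_mul _ |> fun h => h

lemma FF_bound (hb : 0 < b) (hε : 0 < ε) (h1 : b * ε < Real.pi) (h2 : b⁻¹ * ε < Real.pi) :
    ∃ C : ℝ, ∀ x, ‖FF b ε x‖ ≤ C * Real.exp (-(b + b⁻¹) * |x|) := by
  obtain ⟨C, p, hC⟩ := SS_bound hb hε h1 h2
  refine ⟨ε⁻¹ * C, fun x => ?_⟩
  have e : FF b ε x = (4 : ℂ)⁻¹ * (((x : ℂ) + ε * I)⁻¹ * (Sc ε b x * Sc ε b⁻¹ x)) := by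
    unfold FF; rw [mul_inv]; ring
  rw [e, norm_mul, norm_mul]
  have h4 : ‖(4 : ℂ)⁻¹‖ ≤ 1 := by rw [norm_inv]; norm_num
  have hi : 0 < ε⁻¹ := inv_pos.2 hε
  calc _ ≤ 1 * (ε⁻¹ * (C * Real.exp (-(b + b⁻¹) * |x|))) := by
        refine mul_le_mul h4 ?_ (by positivity) (by norm_num)
        exact mul_le_mul (norm_tau_inv hε x) (hC x) (norm_nonneg _) hi.le
    _ = _ := by ring

lemma tau_FF (hε : 0 < ε) (x : ℝ) :
    2 * I * (x + ε * I) * FF b ε x = I / 2 * (Sc ε b x * Sc ε b⁻¹ x) := by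
  have := tau_ne hε x
  unfold FF
  rw [mul_inv]
  linear_combination (I / 2 * (Sc ε b x * Sc ε b⁻¹ x)) * mul_inv_cancel₀ this

lemma tau_FF_bound (hb : 0 < b) (hε : 0 < ε) (h1 : b * ε < Real.pi) (h2 : b⁻¹ * ε < Real.pi) :
    ∃ C : ℝ, ∀ x : ℝ, ‖2 * I * (x + ε * I) * FF b ε x‖ ≤ C * Real.exp (-(b + b⁻¹) * |x|) := by
  obtain ⟨C, p, hC⟩ := SS_bound hb hε h1 h2
  refine ⟨C, fun x => ?_⟩
  rw [tau_FF hε, norm_mul]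
  have : ‖I / 2‖ ≤ 1 := by simp; norm_num
  exact (mul_le_of_le_one_left (norm_nonneg _) this).trans (hC x)

lemma FF_int (hb : 0 < b) (hε : 0 < ε) (h1 : b * ε < Real.pi) (h2 : b⁻¹ * ε < Real.pi)
    {w : ℂ} (hw : |w.im| < (b + b⁻¹) / 2) :
    Integrable fun x : ℝ => FF b ε x * exp (2 * I * (x + ε * I) * w) := by
  obtain ⟨C, hC⟩ := FF_bound hb hε h1 h2
  exact Tf_int (FF_cont hb hε h1 h2) hC hw

lemma JJ_deriv (hb : 0 < b) (hε : 0 < ε) (h1 : b * ε < Real.pi) (h2 : b⁻¹ * ε < Real.pi)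
    {w : ℂ} (hw : |w.im| < (b + b⁻¹) / 2) :
    HasDerivAt (JJ b ε) (Tf ε (fun x : ℝ => 2 * I * (x + ε * I) * FF b ε x) w) w := by
  obtain ⟨C, hC⟩ := FF_bound hb hε h1 h2
  obtain ⟨C', hC'⟩ := tau_FF_bound hb hε h1 h2
  exact Tf_deriv hε (FF_cont hb hε h1 h2) hC hC' hw

lemma Sc_conj (c x : ℝ) : (starRingEnd ℂ) (Sc ε c x) = - Sc ε c (-x) := by
  unfold Sc
  rw [map_inv₀, ← sinh_conj, ← inv_neg, ← sinh_neg]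
  congr 2
  simp
  ring

lemma JJ_conj (w : ℂ) : (starRingEnd ℂ) (JJ b ε w) = - JJ b ε ((starRingEnd ℂ) w) := by
  unfold JJ Tf
  rw [← integral_conj, ← integral_neg, ← integral_neg_eq_self]
  congr 1; ext x
  simp only [FF, map_mul, Sc_conj, ← exp_conj, map_inv₀, neg_neg]
  have e1 : (starRingEnd ℂ) (2 * I * (((-x : ℝ) : ℂ) + ε * I) * w) =
      2 * I * (x + ε * I) * (starRingEnd ℂ) w := by
    simp [map_ofNat]; ring
  simp only [map_mul] at e1
  rw [e1]
  have e2 : (starRingEnd ℂ) 4 * (starRingEnd ℂ) (((-x : ℝ) : ℂ) + ε * I) = -(4 * (x + ε * I)) := by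
    simp [map_ofNat]; ring
  rw [e2, inv_neg]; ring

lemma GG_neg (w : ℂ) : GG b ε (-w) * GG b ε w = 1 := by
  unfold GG
  rw [← exp_add, neg_neg]
  convert exp_zero using 2; ring

lemma GG_conj (w : ℂ) : (starRingEnd ℂ) (GG b ε w) = GG b ε (-(starRingEnd ℂ) w) := by
  unfold GG
  rw [← exp_conj, map_div₀, map_sub, JJ_conj, JJ_conj, map_neg, neg_neg]
  congr 1
  simp [map_ofNat]
  ring

lemma GG_diff (hb : 0 < b) (hε : 0 < ε) (h1 : b * ε < Real.pi) (h2 : b⁻¹ * ε < Real.pi)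
    {w : ℂ} (hw : |w.im| < (b + b⁻¹) / 2) : DifferentiableAt ℂ (GG b ε) w := by
  have d1 := (JJ_deriv hb hε h1 h2 hw).differentiableAt
  have d2 := (JJ_deriv hb hε h1 h2 (w := -w) (by simpa using hw)).differentiableAt
  have d3 : DifferentiableAt ℂ (fun w => JJ b ε (-w)) w := d2.comp w (by fun_prop)
  unfold GG
  exact ((d1.sub d3).div_const 2).cexp

lemma Dfun_eq (hb : 0 < b) (hε : 0 < ε) (h1 : b * ε < Real.pi) (h2 : b⁻¹ * ε < Real.pi)
    (a z : ℂ) (h : |a.im| + |z.im| < (b + b⁻¹) / 2) : Dfun b ε a z = Dg (GG b ε) a z := by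
  have i1 : |(a + z).im| < (b + b⁻¹) / 2 := (abs_add_le _ _).trans_lt h
  have i2 : |(a - z).im| < (b + b⁻¹) / 2 := (abs_sub _ _).trans_lt h
  have j1 := FF_int hb hε h1 h2 i1
  have j2 := FF_int hb hε h1 h2 (w := -(a + z)) (by rw [neg_im, abs_neg]; exact i1)
  have j3 := FF_int hb hε h1 h2 i2
  have j4 := FF_int hb hε h1 h2 (w := -(a - z)) (by rw [neg_im, abs_neg]; exact i2)
  have j12 : Integrable fun x : ℝ => FF b ε x * exp (2 * I * (x + ε * I) * (a + z)) -
    FF b ε x * exp (2 * I * (x + ε * I) * -(a + z)) := j1.sub j2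
  have j34 : Integrable fun x : ℝ => FF b ε x * exp (2 * I * (x + ε * I) * (a - z)) -
    FF b ε x * exp (2 * I * (x + ε * I) * -(a - z)) := j3.sub j4
  unfold Dfun Dg GG
  rw [← exp_add]
  congr 1
  unfold JJ Tf
  rw [← integral_sub j1 j2, ← integral_sub j3 j4, ← add_div, ← integral_add j12 j34,
    ← integral_const_mul, ← integral_div]
  congr 1; ext x
  have e0 : (x : ℂ) + I * ε = x + ε * I := by ring
  simp only [e0, FF, Sc]
  have ht := tau_ne hε x
  set τ : ℂ := x + ε * I
  have e1 : ((b⁻¹ : ℝ) : ℂ) * τ = τ / b := by push_cast; ring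
  rw [e1, cos, sin]
  have f1 : exp (2 * I * τ * (a + z)) = exp (2 * a * τ * I) * exp (2 * τ * z * I) := by
    rw [← exp_add]; ring_nf
  have f2 : exp (2 * I * τ * -(a + z)) = exp (-(2 * a * τ) * I) * exp (-(2 * τ * z) * I) := by
    rw [← exp_add]; ring_nf
  have f3 : exp (2 * I * τ * (a - z)) = exp (2 * a * τ * I) * exp (-(2 * τ * z) * I) := by
    rw [← exp_add]; ring_nf
  have f4 : exp (2 * I * τ * -(a - z)) = exp (-(2 * a * τ) * I) * exp (2 * τ * z * I) := by
    rw [← exp_add]; ring_nf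
  rw [f1, f2, f3, f4, mul_inv, div_eq_mul_inv _ (2 * τ * _ * _), mul_inv, mul_inv, mul_inv]
  generalize exp (2 * a * τ * I) = A
  generalize exp (-(2 * a * τ) * I) = A'
  generalize exp (2 * τ * z * I) = B
  generalize exp (-(2 * τ * z) * I) = B'
  generalize (sinh (b * τ))⁻¹ = s1
  generalize (sinh (τ / b))⁻¹ = s2
  linear_combination (-(τ⁻¹ * s1 * s2 * (B + B') * (A - A')) / 8) * I_sq
end

end

section

lemma strip_preconn (r : ℝ) : IsPreconnected {w : ℂ | |w.im| < r} := by
  have : {w : ℂ | |w.im| < r} = imCLM ⁻¹' (Set.Ioo (-r) r) := by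
    ext w; simp [abs_lt]
  rw [this]
  exact ((convex_Ioo (-r) r).linear_preimage imCLM.toLinearMap).isPreconnected

lemma strip_open (r : ℝ) : IsOpen {w : ℂ | |w.im| < r} :=
  isOpen_lt (by fun_prop) (by fun_prop)

lemma strip_const {r : ℝ} (hr : 0 < r) {f : ℂ → ℂ}
    (hf : ∀ w : ℂ, |w.im| < r → HasDerivAt f 0 w) {w : ℂ} (hw : |w.im| < r) : f w = f 0 := by
  refine (strip_open r).is_const_of_deriv_eq_zero (strip_preconn r)
    (fun w hw => (hf w hw).differentiableAt.differentiableWithinAt)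
    (fun w hw => (hf w hw).deriv) hw (by simpa using hr)

section
variable {b ε : ℝ}

noncomputable def HH (b ε : ℝ) : ℂ → ℂ := Tf ε (fun x : ℝ => (x + ε * I)⁻¹ * Sc ε b⁻¹ x)

lemma HH_deriv (hb : 0 < b) (hε : 0 < ε) (h2 : b⁻¹ * ε < Real.pi) {w : ℂ} (hw : |w.im| < b⁻¹ / 2) :
    HasDerivAt (HH b ε) (2 * I * Tf ε (Sc ε b⁻¹) w) w := by
  obtain ⟨C, hC⟩ := Sc_bound hε (inv_pos.2 hb) h2
  have hi : 0 < ε⁻¹ := inv_pos.2 hε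
  have e : ∀ x : ℝ, 2 * I * (x + ε * I) * ((x + ε * I)⁻¹ * Sc ε b⁻¹ x) = 2 * I * Sc ε b⁻¹ x := by
    intro x
    linear_combination (2 * I * Sc ε b⁻¹ x) * mul_inv_cancel₀ (tau_ne hε x)
  have := Tf_deriv hε (f := fun x : ℝ => ((x : ℂ) + ε * I)⁻¹ * Sc ε b⁻¹ x) (C := ε⁻¹ * C) (C' := 2 * C)
    (κ := b⁻¹) ((tau_inv_cont hε).mul (Sc_cont hε (inv_pos.2 hb) h2)) ?_ ?_ hw
  · simp only [e] at this
    have e2 : Tf ε (fun x => 2 * I * Sc ε b⁻¹ x) w = 2 * I * Tf ε (Sc ε b⁻¹) w := by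
      unfold Tf
      rw [← integral_const_mul]
      congr 1; ext x; ring
    rw [e2] at this
    exact this
  · intro x
    rw [norm_mul, mul_assoc]
    exact mul_le_mul (norm_tau_inv hε x) (hC x) (norm_nonneg _) hi.le
  · intro x
    rw [e, norm_mul, mul_assoc]
    have : ‖2 * I‖ = 2 := by simp
    rw [this]
    exact mul_le_mul_of_nonneg_left (hC x) (by norm_num)

lemma JJ_diff (hb : 0 < b) (hε : 0 < ε) (h1 : b * ε < Real.pi) (h2 : b⁻¹ * ε < Real.pi)
    {w : ℂ} (hw : |w.im| < b⁻¹ / 2) :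
    JJ b ε (w + b / 2 * I) - JJ b ε (w - b / 2 * I) = - HH b ε w / 2 := by
  have m1 : (w + b / 2 * I).im = w.im + b / 2 := by simp
  have m2 : (w - b / 2 * I).im = w.im - b / 2 := by simp
  rw [abs_lt] at hw
  have i1 := FF_int hb hε h1 h2 (w := w + b / 2 * I) (by
    rw [m1, abs_lt]; constructor <;> linarith)
  have i2 := FF_int hb hε h1 h2 (w := w - b / 2 * I) (by
    rw [m2, abs_lt]; constructor <;> linarith)
  unfold JJ HH Tf
  rw [← integral_sub i1 i2, ← integral_neg, ← integral_div]
  congr 1; ext x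
  beta_reduce
  have ht := tau_ne hε x
  unfold FF
  have hs : sinh (b * (x + ε * I)) * Sc ε b x = 1 := by
    unfold Sc
    refine mul_inv_cancel₀ (sinh_ne_zero' ?_ (mul_ne_zero (by exact_mod_cast hb.ne') ht))
    simp only [mul_im, ofReal_re, ofReal_im, add_im, I_re, I_im]
    rw [abs_lt]; constructor <;> nlinarith [Real.pi_pos, mul_pos hb hε]
  generalize Sc ε b x = S1 at *
  generalize Sc ε b⁻¹ x = S2 at *
  set τ : ℂ := x + ε * I
  rw [mul_inv]
  have e1 : exp (2 * I * τ * (w + b / 2 * I)) = exp (2 * I * τ * w) * exp (-(b * τ)) := by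
    rw [← exp_add]; congr 1; linear_combination (b * τ) * I_sq
  have e2 : exp (2 * I * τ * (w - b / 2 * I)) = exp (2 * I * τ * w) * exp (b * τ) := by
    rw [← exp_add]; congr 1; linear_combination -(b * τ) * I_sq
  rw [sinh] at hs
  rw [e1, e2]
  linear_combination (-1 / 2 * τ⁻¹ * S2 * exp (2 * I * τ * w)) * hs

lemma GG_shift (hb : 0 < b) (hε : 0 < ε) (h1 : b * ε < Real.pi) (h2 : b⁻¹ * ε < Real.pi) :
    ∃ C : ℂ, ∀ w : ℂ, |w.im| < b⁻¹ / 2 →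
    GG b ε (w + b / 2 * I) = C * cosh (Real.pi * b * w) * GG b ε (w - b / 2 * I) := by
  have hbi : 0 < b⁻¹ := inv_pos.2 hb
  have hbc : (b : ℂ) ≠ 0 := by exact_mod_cast hb.ne'
  set ψ : ℂ → ℂ := fun w => -(HH b ε w + HH b ε (-w)) / 4 with hψ
  have hd : ∀ w : ℂ, |w.im| < b⁻¹ / 2 →
      HasDerivAt (fun w => exp (-ψ w) * cosh (Real.pi * b * w)) 0 w := by
    intro w hw
    have hw' : |(-w).im| < b⁻¹ / 2 := by simpa using hw
    have d1 := HH_deriv hb hε h2 hw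
    have d2 := HH_deriv hb hε h2 hw'
    have d3 : HasDerivAt (fun w => HH b ε (-w)) (-(2 * I * Tf ε (Sc ε b⁻¹) (-w))) w :=
      (d2.comp w (hasDerivAt_neg w)).congr_deriv (by ring)
    have d4 := (((d1.add d3).neg).div_const 4).neg.cexp
    have d5 : HasDerivAt (fun w : ℂ => (Real.pi : ℂ) * b * w) (Real.pi * b) w := by
      simpa using (hasDerivAt_id w).const_mul ((Real.pi : ℂ) * b)
    have d6 := d4.mul d5.ccosh
    have E1 := E_formula hε hbi h2 hw
    have E2 := E_formula hε hbi h2 hw'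
    have q1 : exp (2 * Real.pi * w / (b⁻¹ : ℝ)) = exp (Real.pi * b * w) * exp (Real.pi * b * w) := by
      rw [← exp_add]; congr 1; push_cast; field_simp; ring
    have q2 : exp (2 * Real.pi * -w / (b⁻¹ : ℝ)) = exp (-(Real.pi * b * w)) * exp (-(Real.pi * b * w)) := by
      rw [← exp_add]; congr 1; push_cast; field_simp; ring
    have q3 : 2 * Real.pi * I / (b⁻¹ : ℝ) = 2 * Real.pi * I * b := by
      push_cast; field_simp
    rw [q1, q3] at E1
    rw [q2, q3] at E2
    have q4 : exp (Real.pi * b * w) * exp (-(Real.pi * b * w)) = 1 := by rw [← exp_add]; simp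
    refine d6.congr_deriv ?_
    simp only [Pi.add_apply, Pi.neg_apply]
    rw [cosh, sinh]
    have hX : (2 * I * Tf ε (Sc ε b⁻¹) w + -(2 * I * Tf ε (Sc ε b⁻¹) (-w))) / 4 *
        ((exp (Real.pi * b * w) + exp (-(Real.pi * b * w))) / 2) +
        (exp (Real.pi * b * w) - exp (-(Real.pi * b * w))) / 2 * (Real.pi * b) = 0 := by
      have r0 : exp (Real.pi * b * w) ≠ 0 := exp_ne_zero _
      generalize exp (Real.pi * b * w) = r at *
      generalize exp (-(Real.pi * b * w)) = r' at *
      generalize Tf ε (Sc ε b⁻¹) w = A at *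
      generalize Tf ε (Sc ε b⁻¹) (-w) = B at *
      -- (r + r') A = r' * (1 + r r) A
      have a1 : (r + r') * A = - r' * (2 * Real.pi * I * b) := by
        linear_combination r' * E1 - A * r * q4
      have a2 : (r + r') * B = - r * (2 * Real.pi * I * b) := by
        linear_combination r * E2 - B * r' * q4
      linear_combination (I / 4) * a1 - (I / 4) * a2 + (Real.pi * b * (r - r') / 2) * I_sq
    linear_combination (exp (-(-(HH b ε w + HH b ε (-w)) / 4))) * hX
  refine ⟨exp (ψ 0), fun w hw => ?_⟩
  have hc := strip_const (r := b⁻¹ / 2) (by positivity) hd hw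
  simp only [mul_zero, cosh_zero, mul_one] at hc
  have e1 := JJ_diff hb hε h1 h2 hw
  have e2 := JJ_diff hb hε h1 h2 (w := -w) (by simpa using hw)
  have e3 : GG b ε (w + b / 2 * I) = exp (ψ w) * GG b ε (w - b / 2 * I) := by
    unfold GG
    rw [← exp_add]
    congr 1
    have k1 : -(w + b / 2 * I) = -w - b / 2 * I := by ring
    have k2 : -(w - b / 2 * I) = -w + b / 2 * I := by ring
    rw [k1, k2, hψ]
    linear_combination (1 / 2) * e1 + (1 / 2) * e2
  rw [e3]
  congr 1
  have m1 : exp (ψ w) * exp (-ψ w) = 1 := by rw [← exp_add]; simp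
  have m0 : exp (ψ 0) * exp (-ψ 0) = 1 := by rw [← exp_add]; simp
  linear_combination (-exp (ψ w)) * m0 - exp (ψ w) * exp (ψ 0) * hc + exp (ψ 0) * cosh (Real.pi * b * w) * m1
end

end

section

section
variable {b ε : ℝ}

lemma norm_sin_le (z : ℂ) : ‖sin z‖ ≤ Real.exp |z.im| := by
  have h1 : ‖exp (-z * I)‖ ≤ Real.exp |z.im| := by
    rw [norm_exp]; apply Real.exp_le_exp.2; simpa using le_abs_self z.im
  have h2 : ‖exp (z * I)‖ ≤ Real.exp |z.im| := by
    rw [norm_exp]; apply Real.exp_le_exp.2; simpa using neg_le_abs z.im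
  rw [sin, norm_div, norm_mul, norm_I, mul_one]
  have : ‖(2 : ℂ)‖ = 2 := by simp
  rw [this]
  have := norm_sub_le (exp (-z * I)) (exp (z * I))
  linarith

lemma K_res (hb : 0 < b) (hε : 0 < ε) (h1 : b * ε < Real.pi) (h2 : b⁻¹ * ε < Real.pi)
    {w : ℂ} (hw : |w.im| < (b + b⁻¹) / 2) :
    ∫ x : ℝ, Sc ε b x * Sc ε b⁻¹ x * sin (2 * (x + ε * I) * w) = - (2 * Real.pi * I * w) := by
  have hbi : 0 < b⁻¹ := inv_pos.2 hb
  have hbc : (b : ℂ) ≠ 0 := by exact_mod_cast hb.ne'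
  have hbic : ((b⁻¹ : ℝ) : ℂ) ≠ 0 := by exact_mod_cast hbi.ne'
  obtain ⟨C, p, hC⟩ := SS_bound hb hε h1 h2
  have hcont : Continuous fun x => Sc ε b x * Sc ε b⁻¹ x := (Sc_cont hε hb h1).mul (Sc_cont hε hbi h2)
  have j1 := Tf_int (ε := ε) hcont hC hw
  have j2 := Tf_int (ε := ε) hcont hC (w := -w) (by simpa using hw)
  have hint : Integrable fun x : ℝ => Sc ε b x * Sc ε b⁻¹ x * sin (2 * (x + ε * I) * w) := by
    refine ((j2.sub j1).const_mul (I / 2)).congr (Eventually.of_forall fun x => ?_)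
    simp only [Pi.sub_apply]
    rw [sin]
    have k1 : -(2 * (x + ε * I) * w) * I = 2 * I * (x + ε * I) * -w := by ring
    have k2 : (2 * (x + ε * I) * w) * I = 2 * I * (x + ε * I) * w := by ring
    rw [k1, k2]; ring
  set g : ℂ → ℂ := fun τ => (sinh (b * τ))⁻¹ * (sinh ((b⁻¹ : ℝ) * τ))⁻¹ * sin (2 * τ * w) with hg
  have godd : ∀ τ, g (-τ) = - g τ := by
    intro τ; simp only [hg, mul_neg, sinh_neg, neg_mul, sin_neg, inv_neg]; ring
  have hline : ∀ x : ℝ, g (x + (-ε : ℝ) * I) = - g (((-x : ℝ) : ℂ) + ε * I) := by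
    intro x; rw [← godd]; congr 1; push_cast; ring
  have key := residue_strip (h := fun τ => 2 * w * snc (2 * τ * w) / (shc (b * τ) * shc ((b⁻¹ : ℝ) * τ)))
    (g := g) (y1 := -ε) (y2 := ε) (by linarith) hε
    (U := {τ | |(b * τ).im| < Real.pi} ∩ {τ | |((b⁻¹ : ℝ) * τ).im| < Real.pi}) ?_ ?_ ?_ ?_
    (m := fun x => (Real.exp (2 * ε * |w.re|) * Real.exp ((2 * |w.im| - (b + b⁻¹)) * |x|)) *
      ((2 + |b * x|⁻¹) * (2 + |b⁻¹ * x|⁻¹))) ?_ ?_ ?_ ?_ ?_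
  · simp only [hline] at key
    rw [integral_neg, integral_neg_eq_self (fun x : ℝ => g ((x : ℂ) + ε * I))] at key
    simp only [mul_zero, zero_mul, shc_zero, snc_zero, mul_one, div_one] at key
    have e : ∫ x : ℝ, Sc ε b x * Sc ε b⁻¹ x * sin (2 * (x + ε * I) * w) = ∫ x : ℝ, g (x + ε * I) := rfl
    rw [e]
    linear_combination (-1 / 2) * key
  · exact (isOpen_lt (by fun_prop) (by fun_prop)).inter (isOpen_lt (by fun_prop) (by fun_prop))
  · intro τ t1 t2
    have k1 : ((b : ℂ) * τ).im = b * τ.im := by simp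
    have k2 : (((b⁻¹ : ℝ) : ℂ) * τ).im = b⁻¹ * τ.im := by
      rw [mul_im, ofReal_im, ofReal_re]; ring
    constructor
    · simp only [Set.mem_ofPred_eq, k1]
      rw [abs_lt]; constructor <;> nlinarith
    · simp only [Set.mem_ofPred_eq, k2]
      rw [abs_lt]; constructor <;> nlinarith
  · intro τ hτ
    refine DifferentiableAt.differentiableWithinAt ?_
    refine DifferentiableAt.div ?_ (DifferentiableAt.mul ?_ ?_) (mul_ne_zero (shc_ne hτ.1) (shc_ne hτ.2))
    · exact ((snc_diff _).comp τ (by fun_prop : DifferentiableAt ℂ (fun τ : ℂ => 2 * τ * w) τ)).const_mul _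
    · exact (shc_diff _).comp τ (by fun_prop : DifferentiableAt ℂ (fun τ : ℂ => (b : ℂ) * τ) τ)
    · exact (shc_diff _).comp τ (by fun_prop : DifferentiableAt ℂ (fun τ : ℂ => ((b⁻¹ : ℝ) : ℂ) * τ) τ)
  · intro τ hτ h0
    have n1 := shc_ne hτ.1
    have n2 := shc_ne hτ.2
    simp only [hg]
    rw [mul_shc (b * τ), mul_shc ((b⁻¹ : ℝ) * τ), mul_snc (2 * τ * w)]
    have hbb : (b : ℂ) * ((b⁻¹ : ℝ) : ℂ) = 1 := by push_cast; exact mul_inv_cancel₀ hbc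
    generalize shc (b * τ) = s1 at *
    generalize shc ((b⁻¹ : ℝ) * τ) = s2 at *
    generalize snc (2 * τ * w) = s3
    generalize ((b⁻¹ : ℝ) : ℂ) = b' at *
    field_simp
    linear_combination (-(w * s3)) * hbb
  · have := (tendsto_exp_abs (c := 2 * |w.im| - (b + b⁻¹)) (by linarith) (Real.exp (2 * ε * |w.re|))).1.mul
      ((tend_two hb).1.mul (tend_two hbi).1)
    rwa [zero_mul] at this
  · have := (tendsto_exp_abs (c := 2 * |w.im| - (b + b⁻¹)) (by linarith) (Real.exp (2 * ε * |w.re|))).2.mul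
      ((tend_two hb).2.mul (tend_two hbi).2)
    rwa [zero_mul] at this
  · intro x y hx t1 t2
    have a1 := inv_sinh_line hb x y hx
    have a2 := inv_sinh_line hbi x y hx
    have a3 : ‖sin (2 * (x + y * I) * w)‖ ≤ Real.exp (2 * ε * |w.re|) * Real.exp (2 * |w.im| * |x|) := by
      refine (norm_sin_le _).trans ?_
      rw [← Real.exp_add]
      apply Real.exp_le_exp.2
      have e : (2 * (x + y * I) * w).im = 2 * (y * w.re) + 2 * (x * w.im) := by simp; ring
      rw [e]
      have c1 : |y| ≤ ε := abs_le.2 ⟨t1, t2⟩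
      have c2 := abs_add_le (2 * (y * w.re)) (2 * (x * w.im))
      simp only [abs_mul, abs_two] at c2
      nlinarith [mul_le_mul_of_nonneg_right c1 (abs_nonneg w.re)]
    simp only [hg]
    rw [norm_mul, norm_mul]
    calc _ ≤ ((Real.exp (-b * |x|) * (2 + |b * x|⁻¹)) * (Real.exp (-b⁻¹ * |x|) * (2 + |b⁻¹ * x|⁻¹))) *
          (Real.exp (2 * ε * |w.re|) * Real.exp (2 * |w.im| * |x|)) :=
          mul_le_mul (mul_le_mul a1 a2 (norm_nonneg _) (by positivity)) a3 (norm_nonneg _) (by positivity)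
      _ = (Real.exp (2 * ε * |w.re|) * (Real.exp (-b * |x|) * Real.exp (-b⁻¹ * |x|) *
          Real.exp (2 * |w.im| * |x|))) * ((2 + |b * x|⁻¹) * (2 + |b⁻¹ * x|⁻¹)) := by ring
      _ = _ := by rw [← Real.exp_add, ← Real.exp_add]; ring_nf
  · simp only [hline]
    exact (hint.comp_neg).neg
  · exact hint

lemma KK_eq (hb : 0 < b) (hε : 0 < ε) (h1 : b * ε < Real.pi) (h2 : b⁻¹ * ε < Real.pi)
    {w : ℂ} (hw : |w.im| < (b + b⁻¹) / 2) :
    JJ b ε w + JJ b ε (-w) = Real.pi * I * w ^ 2 + 2 * JJ b ε 0 := by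
  have hbi : 0 < b⁻¹ := inv_pos.2 hb
  have hd : ∀ w : ℂ, |w.im| < (b + b⁻¹) / 2 →
      HasDerivAt (fun w => JJ b ε w + JJ b ε (-w) - Real.pi * I * w ^ 2) 0 w := by
    intro w hw
    have hw' : |(-w).im| < (b + b⁻¹) / 2 := by simpa using hw
    have d1 := JJ_deriv hb hε h1 h2 hw
    have d2 := JJ_deriv hb hε h1 h2 hw'
    have d3 := d2.comp w (hasDerivAt_neg w)
    have d4 : HasDerivAt (fun w : ℂ => Real.pi * I * w ^ 2) (Real.pi * I * (2 * w)) w := by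
      simpa using (hasDerivAt_pow 2 w).const_mul (Real.pi * I)
    refine ((d1.add d3).sub d4).congr_deriv ?_
    obtain ⟨C, hC⟩ := tau_FF_bound hb hε h1 h2
    have hcont : Continuous fun x : ℝ => 2 * I * (x + ε * I) * FF b ε x := by
      have := FF_cont hb hε h1 h2
      fun_prop
    have j1 := Tf_int (ε := ε) hcont hC hw
    have j2 := Tf_int (ε := ε) hcont hC hw'
    have key := K_res hb hε h1 h2 hw
    have : Tf ε (fun x : ℝ => 2 * I * (x + ε * I) * FF b ε x) w -
        Tf ε (fun x : ℝ => 2 * I * (x + ε * I) * FF b ε x) (-w) =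
        - ∫ x : ℝ, Sc ε b x * Sc ε b⁻¹ x * sin (2 * (x + ε * I) * w) := by
      unfold Tf
      rw [← integral_sub j1 j2, ← integral_neg]
      congr 1; ext x
      rw [tau_FF hε, sin]
      have k1 : -(2 * (x + ε * I) * w) * I = 2 * I * (x + ε * I) * -w := by ring
      have k2 : (2 * (x + ε * I) * w) * I = 2 * I * (x + ε * I) * w := by ring
      rw [k1, k2]; ring
    rw [key] at this
    linear_combination this
  have := strip_const (r := (b + b⁻¹) / 2) (by positivity) hd hw
  simp only [neg_zero] at this
  linear_combination this

lemma GG_bound (hb : 0 < b) (hε : 0 < ε) (h1 : b * ε < Real.pi) (h2 : b⁻¹ * ε < Real.pi)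
    (κ : ℝ) (hκ : κ < (b + b⁻¹) / 2) : ∃ K : ℝ, 0 < K ∧ ∀ w : ℂ, |w.im| ≤ κ →
    ‖GG b ε w‖ ≤ K * Real.exp (Real.pi * (|w.re| * w.im)) := by
  obtain ⟨C, hC⟩ := FF_bound hb hε h1 h2
  obtain ⟨M, hM⟩ := Tf_bound (ε := ε) hC hκ
  have hre : ∀ w : ℂ, |w.im| ≤ κ → 0 ≤ w.re → ‖JJ b ε w‖ ≤ |M| := by
    intro w hw h0
    refine (hM w hw).trans ?_
    have : Real.exp (-2 * ε * w.re) ≤ 1 := by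
      rw [Real.exp_le_one_iff]; nlinarith
    calc _ ≤ |M| * Real.exp (-2 * ε * w.re) := by gcongr; exact le_abs_self M
      _ ≤ |M| * 1 := by gcongr
      _ = _ := mul_one _
  have hn : ∀ w : ℂ, |w.im| ≤ κ → ‖GG b ε w‖ =
      Real.exp ((JJ b ε w).re - (JJ b ε 0).re + Real.pi * (w.re * w.im)) := by
    intro w hw
    have k := KK_eq hb hε h1 h2 (hw.trans_lt hκ)
    have e : (JJ b ε w - JJ b ε (-w)) / 2 = JJ b ε w - JJ b ε 0 - Real.pi * I * w ^ 2 / 2 := by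
      linear_combination (-1 / 2) * k
    unfold GG
    rw [norm_exp, e]
    congr 1
    have : ((Real.pi : ℂ) * I * w ^ 2 / 2) = ((Real.pi / 2 : ℝ) : ℂ) * (I * (w * w)) := by
      push_cast; ring
    rw [this, sub_re, sub_re, re_ofReal_mul]
    simp
    ring
  refine ⟨Real.exp (|M| + |(JJ b ε 0).re|), Real.exp_pos _, fun w hw => ?_⟩
  rcases le_or_gt 0 w.re with h0 | h0
  · rw [hn w hw, ← Real.exp_add, abs_of_nonneg h0]
    apply Real.exp_le_exp.2
    have := (re_le_norm (JJ b ε w)).trans (hre w hw h0)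
    have := neg_abs_le (JJ b ε 0).re
    linarith
  · have hw' : |(-w).im| ≤ κ := by simpa using hw
    have k1 := hn (-w) hw'
    have k2 := congrArg norm (GG_neg (b := b) (ε := ε) w)
    rw [norm_mul, norm_one, k1] at k2
    have k3 : ‖GG b ε w‖ = Real.exp (-((JJ b ε (-w)).re - (JJ b ε 0).re + Real.pi * ((-w).re * (-w).im))) := by
      rw [Real.exp_neg]; exact eq_inv_of_mul_eq_one_right k2
    rw [k3, ← Real.exp_add, abs_of_neg h0]
    apply Real.exp_le_exp.2
    have l1 := hre (-w) hw' (by simp; linarith)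
    have l2 := (abs_le.1 ((abs_re_le_norm (JJ b ε (-w))).trans l1)).1
    have l3 := le_abs_self (JJ b ε 0).re
    simp only [neg_re, neg_im]
    linarith

lemma GG_GP (hb : 0 < b) (hε : 0 < ε) (h1 : b * ε < Real.pi) (h2 : b⁻¹ * ε < Real.pi) :
    GP b (GG b ε) where
  hb := hb
  diff := fun w hw => GG_diff hb hε h1 h2 hw
  neg := GG_neg
  conj := GG_conj
  shift := GG_shift hb hε h1 h2
  bound := GG_bound hb hε h1 h2

lemma eps_conds (hb : 0 < b) (hε : ε < Real.pi * min b b⁻¹) :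
    b * ε < Real.pi ∧ b⁻¹ * ε < Real.pi := by
  have hbi : 0 < b⁻¹ := inv_pos.2 hb
  have hbb : b * b⁻¹ = 1 := mul_inv_cancel₀ hb.ne'
  have p := Real.pi_pos
  have l1 : ε < Real.pi * b := hε.trans_le (by gcongr; exact min_le_left _ _)
  have l2 : ε < Real.pi * b⁻¹ := hε.trans_le (by gcongr; exact min_le_right _ _)
  constructor
  · calc b * ε < b * (Real.pi * b⁻¹) := by gcongr
      _ = Real.pi * (b * b⁻¹) := by ring
      _ = Real.pi := by rw [hbb, mul_one]
  · calc b⁻¹ * ε < b⁻¹ * (Real.pi * b) := by gcongr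
      _ = Real.pi * (b * b⁻¹) := by ring
      _ = Real.pi := by rw [hbb, mul_one]
end

end

end Helpers

/-- The exchange relation
`V(u,v;x,x′) = (D_s(u)·D_{−s}(v))^N · V(v,u;x,x′)` for the kernel of
`(Y(ū))*·Y(v)` (Lemma E.3 of the paper); `δ = +1` corresponds to the modular
XXZ magnet, `δ = −1` to the lattice sinh–Gordon model. -/
theorem Vkernel_exchange (b ε : ℝ) (hb : 0 < b) (hε0 : 0 < ε)
    (hε : ε < Real.pi * min b b⁻¹) (s u v : ℝ)
    (N : ℕ) [NeZero N] (hN : 1 ≤ N) (δ : ℝ) (hδ : δ = 1 ∨ δ = -1)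
    (x x' : Fin N → ℝ) :
    Integrable (Vint b ε s N δ x x' u v) ∧
    Integrable (Vint b ε s N δ x x' v u) ∧
      ∫ z : Fin N → ℝ, Vint b ε s N δ x x' u v z =
        (Dfun b ε ((s : ℝ) : ℂ) ((u : ℝ) : ℂ) *
            Dfun b ε (-((s : ℝ) : ℂ)) ((v : ℝ) : ℂ)) ^ N *
          ∫ z : Fin N → ℝ, Vint b ε s N δ x x' v u z := by
  obtain ⟨h1, h2⟩ := eps_conds hb hε
  exact final_of_GP (GG_GP hb hε0 h1 h2) ε (Dfun_eq hb hε0 h1 h2) s u v N δ hδ x x'
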